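/- Let φ be a norm on ℝ², let Ω ⊆ ℝ² be a bounded convex open set, and let (m_j)_{j∈ℕ} be a decreasing sequence with m_j ∈ (0, |Ω|) for all j. Then there exists a sequence of measurable sets (E_j) such that E_{j+1} ⊆ E_j ⊆ Ω and |E_j| = m_j for all j, and each E_j is a minimizer of problem (10) with m := m_j. -/

import Mathlib

open MeasureTheory Set ENNReal Filter

noncomputable section

/-- `φ` is a norm on `ℝⁿ` (represented as `Fin n → ℝ`). -/
structure IsNorm {n : ℕ} (φ : (Fin n → ℝ) → ℝ) : Prop where
  nonneg : ∀ x, 0 ≤ φ x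
  eq_zero_iff : ∀ x, φ x = 0 ↔ x = 0
  smul_eq : ∀ (a : ℝ) (x : Fin n → ℝ), φ (a • x) = |a| * φ x
  add_le : ∀ x y, φ (x + y) ≤ φ x + φ y

/-- The divergence of a vector field `η : ℝⁿ → ℝⁿ`. -/
def diverg {n : ℕ} (η : (Fin n → ℝ) → (Fin n → ℝ)) (x : Fin n → ℝ) : ℝ :=
  ∑ i, fderiv ℝ η x (Pi.single i 1) i

/-- The anisotropic total variation `∫ φ*(Du)` of `u : ℝⁿ → ℝ`:
`sup { ∫ u div η dx : η ∈ C¹_c(ℝⁿ;ℝⁿ), φ(η(x)) ≤ 1 ∀ x }`, as an extended real. -/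
def anisoTV {n : ℕ} (φ : (Fin n → ℝ) → ℝ) (u : (Fin n → ℝ) → ℝ) : ℝ≥0∞ :=
  ⨆ η ∈ {η : (Fin n → ℝ) → (Fin n → ℝ) |
      ContDiff ℝ 1 η ∧ HasCompactSupport η ∧ ∀ x, φ (η x) ≤ 1},
    ENNReal.ofReal (∫ x, u x * diverg η x)

/-- `u ∈ BV(ℝⁿ)` (with respect to the anisotropic total variation). -/
def IsBV {n : ℕ} (φ : (Fin n → ℝ) → ℝ) (u : (Fin n → ℝ) → ℝ) : Prop :=
  Integrable u volume ∧ anisoTV φ u ≠ ⊤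

/-- `u` is admissible for problem (1): `u ∈ BV(ℝⁿ)`, `u = 0` a.e. outside `Ω`,
`u` is a.e. `ℕ`-valued, and `∫_Ω u = m`. -/
def Admissible {n : ℕ} (φ : (Fin n → ℝ) → ℝ) (Ω : Set (Fin n → ℝ)) (m : ℝ)
    (u : (Fin n → ℝ) → ℝ) : Prop :=
  IsBV φ u ∧ (∀ᵐ x ∂volume, x ∉ Ω → u x = 0) ∧
    (∀ᵐ x ∂volume, ∃ k : ℕ, u x = k) ∧ (∫ x in Ω, u x) = m

/-- `u` is a minimizer of problem (1). -/
def IsMinimizer {n : ℕ} (φ : (Fin n → ℝ) → ℝ) (Ω : Set (Fin n → ℝ)) (m : ℝ)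
    (u : (Fin n → ℝ) → ℝ) : Prop :=
  Admissible φ Ω m u ∧ ∀ v, Admissible φ Ω m v → anisoTV φ u ≤ anisoTV φ v

/-- The anisotropic perimeter `P_φ(E)` of a set `E ⊆ ℝⁿ`. -/
def anisoPerimeter {n : ℕ} (φ : (Fin n → ℝ) → ℝ) (E : Set (Fin n → ℝ)) : ℝ≥0∞ :=
  anisoTV φ (E.indicator (1 : (Fin n → ℝ) → ℝ))

/-- The Wulff ball `W_r(x) = {y : φ(y-x) < r}`. -/
def wulffBall {n : ℕ} (φ : (Fin n → ℝ) → ℝ) (x : Fin n → ℝ) (r : ℝ) : Set (Fin n → ℝ) :=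
  {y | φ (y - x) < r}

/-- `E` satisfies the `rW_φ`-condition. -/
def rWCond {n : ℕ} (φ : (Fin n → ℝ) → ℝ) (E : Set (Fin n → ℝ)) (r : ℝ) : Prop :=
  ∀ x ∈ frontier E, ∃ y, wulffBall φ y r ⊆ E ∧ x ∈ frontier (wulffBall φ y r)

/-- The Wulff plaquette `E^r`, the union of all Wulff balls of radius `r` contained
in `E` (with `E^0 = E`). -/
def plaquette {n : ℕ} (φ : (Fin n → ℝ) → ℝ) (E : Set (Fin n → ℝ)) (r : ℝ) :
    Set (Fin n → ℝ) :=
  if r = 0 then E else ⋃ (x) (_ : wulffBall φ x r ⊆ E), wulffBall φ x r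

/-- `R_Ω`: the maximal `R > 0` such that some Wulff ball of radius `R` is contained in `Ω`. -/
def maxInradius {n : ℕ} (φ : (Fin n → ℝ) → ℝ) (Ω : Set (Fin n → ℝ)) : ℝ :=
  sSup {R | 0 < R ∧ ∃ x, wulffBall φ x R ⊆ Ω}

/-- `r_Ω`: the maximal `r > 0` such that `Ω` satisfies the `rW_φ`-condition
(`0` if there is none, since `sSup ∅ = 0`). -/
def maxRollRadius {n : ℕ} (φ : (Fin n → ℝ) → ℝ) (Ω : Set (Fin n → ℝ)) : ℝ :=
  sSup {r | 0 < r ∧ rWCond φ Ω r}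

/-- The set of points of Lebesgue density `1` of `E`. -/
def densityPoints {n : ℕ} (E : Set (Fin n → ℝ)) : Set (Fin n → ℝ) :=
  {x | Tendsto (fun r : ℝ => volume (E ∩ Metric.ball x r) / volume (Metric.ball x r))
    (nhdsWithin 0 (Ioi 0)) (nhds 1)}

/-- `E` is a minimizer of problem (10): the constrained isoperimetric problem
minimizing `P_φ` among measurable subsets of `Ω` of prescribed measure `m`. -/
def IsIsopMinimizer {n : ℕ} (φ : (Fin n → ℝ) → ℝ) (Ω : Set (Fin n → ℝ)) (m : ℝ)
    (E : Set (Fin n → ℝ)) : Prop :=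
  MeasurableSet E ∧ E ⊆ Ω ∧ (volume E).toReal = m ∧
    ∀ F, MeasurableSet F → F ⊆ Ω → (volume F).toReal = m →
      anisoPerimeter φ E ≤ anisoPerimeter φ F

/-- The Euclidean norm on `ℝ²`. -/
def euclNorm (v : Fin 2 → ℝ) : ℝ := Real.sqrt (v 0 ^ 2 + v 1 ^ 2)

/-- The crystalline norm `φ(ν) = |ν₁| + |ν₂|` on `ℝ²`. -/
def crysNorm (v : Fin 2 → ℝ) : ℝ := |v 0| + |v 1|

/-- The open unit square `(0,1)² ⊆ ℝ²`. -/
def unitSquare : Set (Fin 2 → ℝ) := univ.pi fun _ => Ioo (0 : ℝ) 1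

/-- The closed unit square `[0,1]² ⊆ ℝ²`. -/
def closedUnitSquare : Set (Fin 2 → ℝ) := univ.pi fun _ => Icc (0 : ℝ) 1

/-- `j` is the essential supremum `‖u‖_∞` of `u`. -/
def IsEssSup (u : (Fin 2 → ℝ) → ℝ) (j : ℕ) : Prop :=
  (∀ᵐ x ∂volume, u x ≤ (j : ℝ)) ∧ ∀ c : ℝ, (∀ᵐ x ∂volume, u x ≤ c) → (j : ℝ) ≤ c

section PlaneSlicing
open scoped Pointwise Topology

/-- The linear form `x ↦ det (θ, x)` on the plane. -/
def detForm (θ : Fin 2 → ℝ) : (Fin 2 → ℝ) →ₗ[ℝ] ℝ :=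
  θ 0 • LinearMap.proj 1 - θ 1 • LinearMap.proj 0

lemma detForm_apply (θ x : Fin 2 → ℝ) : detForm θ x = θ 0 * x 1 - θ 1 * x 0 := by
  simp [detForm]

lemma detForm_self (θ : Fin 2 → ℝ) : detForm θ θ = 0 := by
  rw [detForm_apply]; ring

lemma detForm_smul_left (a : ℝ) (θ x : Fin 2 → ℝ) : detForm (a • θ) x = a * detForm θ x := by
  simp [detForm_apply]; ring

lemma detForm_zero_left (x : Fin 2 → ℝ) : detForm 0 x = 0 := by
  simp [detForm_apply]

lemma continuous_detForm (θ : Fin 2 → ℝ) : Continuous (detForm θ) :=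
  (detForm θ).continuous_of_finiteDimensional

/-- A vector `n` with `det (θ, n) = 1` (for `θ ≠ 0`). -/
def conormal (θ : Fin 2 → ℝ) : Fin 2 → ℝ :=
  ![-θ 1 / (θ 0 ^ 2 + θ 1 ^ 2), θ 0 / (θ 0 ^ 2 + θ 1 ^ 2)]

lemma sq_add_sq_pos_of_ne_zero {θ : Fin 2 → ℝ} (hθ : θ ≠ 0) : 0 < θ 0 ^ 2 + θ 1 ^ 2 := by
  by_contra! h
  apply hθ
  have h0 : θ 0 = 0 := by nlinarith [sq_nonneg (θ 0), sq_nonneg (θ 1)]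
  have h1 : θ 1 = 0 := by nlinarith [sq_nonneg (θ 0), sq_nonneg (θ 1)]
  ext i
  fin_cases i <;> simp [h0, h1]

lemma detForm_conormal {θ : Fin 2 → ℝ} (hθ : θ ≠ 0) : detForm θ (conormal θ) = 1 := by
  have := sq_add_sq_pos_of_ne_zero hθ
  simp only [detForm_apply, conormal, Matrix.cons_val_zero, Matrix.cons_val_one]
  field_simp
  ring

/-- The point with coordinates `(c, s)` in the frame `(conormal θ, θ)`. -/
def lineMapAt (θ : Fin 2 → ℝ) (p : ℝ × ℝ) : Fin 2 → ℝ := p.1 • conormal θ + p.2 • θ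

lemma continuous_lineMapAt (θ : Fin 2 → ℝ) : Continuous (lineMapAt θ) := by
  unfold lineMapAt; fun_prop

lemma detForm_lineMapAt {θ : Fin 2 → ℝ} (hθ : θ ≠ 0) (p : ℝ × ℝ) :
    detForm θ (lineMapAt θ p) = p.1 := by
  simp [lineMapAt, detForm_self, detForm_conormal hθ]

lemma exists_lineMapAt {θ : Fin 2 → ℝ} (hθ : θ ≠ 0) (x : Fin 2 → ℝ) :
    ∃ s, lineMapAt θ (detForm θ x, s) = x := by
  have := sq_add_sq_pos_of_ne_zero hθ
  refine ⟨(θ 0 * x 0 + θ 1 * x 1) / (θ 0 ^ 2 + θ 1 ^ 2), ?_⟩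
  ext i
  fin_cases i
  · simp [lineMapAt, conormal, detForm_apply]; field_simp; ring
  · simp [lineMapAt, conormal, detForm_apply]; field_simp; ring

lemma measurePreserving_lineMapAt {θ : Fin 2 → ℝ} (hθ : θ ≠ 0) :
    MeasurePreserving (lineMapAt θ) volume volume := by
  have hpos := sq_add_sq_pos_of_ne_zero hθ
  let M : Matrix (Fin 2) (Fin 2) ℝ := Matrix.of ![![conormal θ 0, θ 0], ![conormal θ 1, θ 1]]
  have hdet : M.det = -1 := by
    have := detForm_conormal hθ
    rw [detForm_apply] at this
    simp only [M, Matrix.det_fin_two, Matrix.of_apply, Matrix.cons_val_zero, Matrix.cons_val_one]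
    linarith
  have h1 : MeasurePreserving (Matrix.toLin' M) volume volume := by
    refine ⟨(Matrix.toLin' M).continuous_of_finiteDimensional.measurable, ?_⟩
    rw [Real.map_matrix_volume_pi_eq_smul_volume_pi (by rw [hdet]; norm_num), hdet]
    simp
  have h2 := (volume_preserving_finTwoArrow ℝ).symm
  have h3 := h1.comp h2
  convert h3 using 1
  ext p i
  fin_cases i <;>
  simp [lineMapAt, M, MeasurableEquiv.finTwoArrow, Matrix.mulVec, dotProduct, Fin.sum_univ_two,
    MeasurableEquiv.piFinTwo, mul_comm]

/-- The slice of `A` along the line `det (θ, ·) = c`. -/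
def slice (θ : Fin 2 → ℝ) (A : Set (Fin 2 → ℝ)) (c : ℝ) : Set ℝ := {s | lineMapAt θ (c, s) ∈ A}

lemma lintegral_eq_lintegral_lines {θ : Fin 2 → ℝ} (hθ : θ ≠ 0) {f : (Fin 2 → ℝ) → ℝ≥0∞}
    (hf : Measurable f) : ∫⁻ x, f x = ∫⁻ c, ∫⁻ s, f (lineMapAt θ (c, s)) := by
  rw [← (measurePreserving_lineMapAt hθ).lintegral_comp hf]
  exact lintegral_prod _ (hf.comp (continuous_lineMapAt θ).measurable).aemeasurable

lemma volume_eq_lintegral_slice {θ : Fin 2 → ℝ} (hθ : θ ≠ 0) {A : Set (Fin 2 → ℝ)}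
    (hA : MeasurableSet A) : volume A = ∫⁻ c, volume (slice θ A c) := by
  rw [← (measurePreserving_lineMapAt hθ).measure_preimage hA.nullMeasurableSet]
  exact Measure.prod_apply ((continuous_lineMapAt θ).measurable hA)

lemma measurable_volume_slice {θ : Fin 2 → ℝ} {A : Set (Fin 2 → ℝ)}
    (hA : MeasurableSet A) : Measurable fun c => volume (slice θ A c) :=
  measurable_measure_prodMk_left ((continuous_lineMapAt θ).measurable hA)

lemma slice_nonempty_iff {θ : Fin 2 → ℝ} (hθ : θ ≠ 0) {A : Set (Fin 2 → ℝ)} {c : ℝ} :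
    (slice θ A c).Nonempty ↔ c ∈ detForm θ '' A := by
  constructor
  · rintro ⟨s, hs⟩
    exact ⟨_, hs, detForm_lineMapAt hθ _⟩
  · rintro ⟨x, hx, rfl⟩
    obtain ⟨s, hs⟩ := exists_lineMapAt hθ x
    exact ⟨s, by simpa [slice, hs] using hx⟩

lemma lineMapAt_add (θ : Fin 2 → ℝ) (c s t : ℝ) :
    lineMapAt θ (c, s + t) = lineMapAt θ (c, s) + t • θ := by
  simp [lineMapAt, add_smul, add_assoc]

lemma slice_convex {θ : Fin 2 → ℝ} {K : Set (Fin 2 → ℝ)} (hK : Convex ℝ K) (c : ℝ) :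
    Convex ℝ (slice θ K c) := by
  intro s hs t ht a b ha hb hab
  have := hK hs ht ha hb hab
  have e : a • lineMapAt θ (c, s) + b • lineMapAt θ (c, t)
      = lineMapAt θ (c, a • s + b • t) := by
    ext i
    simp only [lineMapAt, Pi.add_apply, Pi.smul_apply, smul_eq_mul]
    linear_combination (c * conormal θ i) * hab
  rwa [e] at this

lemma slice_isCompact {θ : Fin 2 → ℝ} (hθ : θ ≠ 0) {K : Set (Fin 2 → ℝ)} (hK : IsCompact K)
    (c : ℝ) : IsCompact (slice θ K c) := by
  have hcl : IsClosed (slice θ K c) :=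
    hK.isClosed.preimage ((continuous_lineMapAt θ).comp (by fun_prop : Continuous fun s => (c, s)))
  have hpos := sq_add_sq_pos_of_ne_zero hθ
  have hf : Continuous fun x : Fin 2 → ℝ => (θ 0 * x 0 + θ 1 * x 1) / (θ 0 ^ 2 + θ 1 ^ 2) := by
    fun_prop
  refine (hK.image hf).of_isClosed_subset hcl ?_
  intro s hs
  refine ⟨_, hs, ?_⟩
  simp [lineMapAt, conormal]; field_simp; ring

/-- The symmetric segment `[-θ, θ]`. -/
def symSeg (θ : Fin 2 → ℝ) : Set (Fin 2 → ℝ) :=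
  image (fun a : ℝ => a • θ) (Icc (-1) 1)

/-- The set of `x` with `x + B ⊆ K`. -/
def erosion (K B : Set (Fin 2 → ℝ)) : Set (Fin 2 → ℝ) := {x | ∀ b ∈ B, x + b ∈ K}

/-- The length of the projection of `A` along `θ`, weighted by the length of `θ`. -/
def shadow (θ : Fin 2 → ℝ) (A : Set (Fin 2 → ℝ)) : ℝ := volume.real (detForm θ '' A)

lemma symSeg_isCompact (θ : Fin 2 → ℝ) : IsCompact (symSeg θ) :=
  isCompact_Icc.image (by fun_prop)

lemma symSeg_convex (θ : Fin 2 → ℝ) : Convex ℝ (symSeg θ) :=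
  (convex_Icc _ _).is_linear_image ⟨fun a b => add_smul a b θ, fun a b => by simp [mul_smul]⟩

lemma zero_mem_symSeg (θ : Fin 2 → ℝ) : (0 : Fin 2 → ℝ) ∈ symSeg θ := ⟨0, by simp, by simp⟩

lemma symSeg_zero : symSeg 0 = {0} := by
  ext x; simp only [symSeg, smul_zero, mem_image, mem_singleton_iff]
  constructor
  · rintro ⟨_, _, rfl⟩; rfl
  · rintro rfl; exact ⟨0, by simp, rfl⟩

lemma shadow_zero (A : Set (Fin 2 → ℝ)) : shadow 0 A = 0 := by
  have : detForm 0 '' A ⊆ {0} := by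
    rintro _ ⟨x, _, rfl⟩; simp [detForm_zero_left]
  simp [shadow, Measure.real, measure_mono_null this]

lemma slice_add_symSeg (θ : Fin 2 → ℝ) (K : Set (Fin 2 → ℝ)) (c : ℝ) :
    slice θ (K + symSeg θ) c = slice θ K c + Icc (-1) 1 := by
  ext s
  simp only [slice, mem_ofPred_eq, Set.mem_add, symSeg, mem_image]
  constructor
  · rintro ⟨x, hx, _, ⟨a, ha, rfl⟩, h⟩
    refine ⟨s - a, ?_, a, ha, by ring⟩
    have : s = (s - a) + a := by ring
    rw [this, lineMapAt_add] at h
    rwa [← add_right_cancel h]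
  · rintro ⟨t, ht, a, ha, rfl⟩
    exact ⟨_, ht, _, ⟨a, ha, rfl⟩, (lineMapAt_add _ _ _ _).symm⟩

lemma exists_slice_eq_Icc {θ : Fin 2 → ℝ} (hθ : θ ≠ 0) {K : Set (Fin 2 → ℝ)} (hK : IsCompact K)
    (hc : Convex ℝ K) {c : ℝ} (h : c ∈ detForm θ '' K) :
    ∃ a b, a ≤ b ∧ slice θ K c = Icc a b := by
  have hne := (slice_nonempty_iff hθ).2 h
  have h1 := eq_Icc_of_connected_compact
    ((slice_convex hc c).isConnected hne) (slice_isCompact hθ hK c)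
  refine ⟨_, _, ?_, h1⟩
  rw [h1] at hne
  exact nonempty_Icc.1 hne

lemma volume_add_symSeg {θ : Fin 2 → ℝ} {K : Set (Fin 2 → ℝ)} (hK : IsCompact K)
    (hc : Convex ℝ K) :
    volume.real (K + symSeg θ) = volume.real K + 2 * shadow θ K := by
  rcases eq_or_ne θ 0 with rfl | hθ
  · simp [symSeg_zero, shadow_zero]
  have hS : IsCompact (K + symSeg θ) := hK.add (symSeg_isCompact θ)
  have hD : IsCompact (detForm θ '' K) := hK.image (continuous_detForm θ)
  have key : volume (K + symSeg θ) = volume K + 2 * volume (detForm θ '' K) := by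
    rw [volume_eq_lintegral_slice hθ hS.measurableSet, volume_eq_lintegral_slice hθ hK.measurableSet,
      ← setLIntegral_const, ← lintegral_indicator hD.measurableSet,
      ← lintegral_add_left (measurable_volume_slice hK.measurableSet)]
    congr 1
    ext c
    rw [slice_add_symSeg]
    by_cases h : c ∈ detForm θ '' K
    · obtain ⟨a, b, hab, e⟩ := exists_slice_eq_Icc hθ hK hc h
      rw [indicator_of_mem h, e, Set.Icc_add_Icc hab (by norm_num), Real.volume_Icc, Real.volume_Icc,
        ← ENNReal.ofReal_ofNat, ← ENNReal.ofReal_add (by linarith) (by norm_num)]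
      congr 1; ring
    · have : slice θ K c = ∅ := by
        rw [← not_nonempty_iff_eq_empty, slice_nonempty_iff hθ]; exact h
      simp [this, indicator_of_notMem h]
  rw [Measure.real, key, ENNReal.toReal_add hK.measure_lt_top.ne
    (ENNReal.mul_ne_top (by norm_num) hD.measure_lt_top.ne)]
  simp [shadow, Measure.real]

lemma isClosed_erosion {K B : Set (Fin 2 → ℝ)} (hK : IsClosed K) : IsClosed (erosion K B) := by
  have : erosion K B = ⋂ b ∈ B, (fun x => x + b) ⁻¹' K := by ext; simp [erosion]
  rw [this]
  exact isClosed_biInter fun b _ => hK.preimage (by fun_prop)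

lemma erosion_subset {K B : Set (Fin 2 → ℝ)} (h0 : (0 : Fin 2 → ℝ) ∈ B) : erosion K B ⊆ K :=
  fun x hx => by simpa using hx 0 h0

lemma isCompact_erosion {K B : Set (Fin 2 → ℝ)} (hK : IsCompact K)
    (h0 : (0 : Fin 2 → ℝ) ∈ B) : IsCompact (erosion K B) :=
  hK.of_isClosed_subset (isClosed_erosion hK.isClosed) (erosion_subset h0)

lemma convex_erosion {K B : Set (Fin 2 → ℝ)} (hK : Convex ℝ K) : Convex ℝ (erosion K B) := by
  intro x hx y hy a b ha hb hab c hc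
  have := hK (hx c hc) (hy c hc) ha hb hab
  convert this using 1
  ext i
  simp only [Pi.add_apply, Pi.smul_apply, smul_eq_mul]
  linear_combination (-c i) * hab

lemma erosion_add (K A B : Set (Fin 2 → ℝ)) : erosion K (A + B) = erosion (erosion K A) B := by
  ext x
  simp only [erosion, mem_ofPred_eq, Set.mem_add]
  constructor
  · intro h b hb a ha
    rw [add_assoc]; exact h _ ⟨a, ha, b, hb, add_comm _ _⟩
  · rintro h _ ⟨a, ha, b, hb, rfl⟩
    have := h b hb a ha
    rwa [add_assoc, add_comm b a] at this

lemma erosion_add_subset (K B : Set (Fin 2 → ℝ)) : erosion K B + B ⊆ K := by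
  rintro _ ⟨x, hx, b, hb, rfl⟩
  exact hx b hb

lemma erosion_mono {K L A B : Set (Fin 2 → ℝ)} (hKL : K ⊆ L) (hBA : B ⊆ A) :
    erosion K A ⊆ erosion L B := fun _ hx b hb => hKL (hx b (hBA hb))

lemma slice_erosion_symSeg (θ : Fin 2 → ℝ) (K : Set (Fin 2 → ℝ)) (c a b : ℝ)
    (h : slice θ K c = Icc a b) : Icc (a + 1) (b - 1) ⊆ slice θ (erosion K (symSeg θ)) c := by
  rintro s ⟨hs1, hs2⟩
  rintro _ ⟨t, ht, rfl⟩
  have : s + t ∈ slice θ K c := by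
    rw [h]; exact ⟨by linarith [ht.1], by linarith [ht.2]⟩
  change lineMapAt θ (c, s) + t • θ ∈ K
  rw [← lineMapAt_add]; exact this

lemma volume_le_volume_erosion_symSeg {θ : Fin 2 → ℝ} {K : Set (Fin 2 → ℝ)} (hK : IsCompact K)
    (hc : Convex ℝ K) :
    volume.real K ≤ volume.real (erosion K (symSeg θ)) + 2 * shadow θ K := by
  rcases eq_or_ne θ 0 with rfl | hθ
  · have : erosion K (symSeg 0) = K := by ext; simp [erosion, symSeg_zero]
    simp [this, shadow_zero]
  have hE : IsCompact (erosion K (symSeg θ)) := isCompact_erosion hK (zero_mem_symSeg θ)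
  have hD : IsCompact (detForm θ '' K) := hK.image (continuous_detForm θ)
  have key : volume K ≤ volume (erosion K (symSeg θ)) + 2 * volume (detForm θ '' K) := by
    rw [volume_eq_lintegral_slice hθ hE.measurableSet, volume_eq_lintegral_slice hθ hK.measurableSet,
      ← setLIntegral_const, ← lintegral_indicator hD.measurableSet,
      ← lintegral_add_left (measurable_volume_slice hE.measurableSet)]
    refine lintegral_mono fun c => ?_
    by_cases h : c ∈ detForm θ '' K
    · obtain ⟨a, b, hab, e⟩ := exists_slice_eq_Icc hθ hK hc h
      simp only [indicator_of_mem h, e, Real.volume_Icc]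
      refine le_trans ?_ (add_le_add_left (measure_mono (slice_erosion_symSeg θ K c a b e)) _)
      rw [Real.volume_Icc, ← ENNReal.ofReal_ofNat]
      refine le_trans ?_ ENNReal.ofReal_add_le
      exact ENNReal.ofReal_le_ofReal (by linarith)
    · have : slice θ K c = ∅ := by
        rw [← not_nonempty_iff_eq_empty, slice_nonempty_iff hθ]; exact h
      simp [this]
  have hfin : volume (erosion K (symSeg θ)) + 2 * volume (detForm θ '' K) ≠ ∞ :=
    ENNReal.add_ne_top.2 ⟨hE.measure_lt_top.ne, ENNReal.mul_ne_top (by norm_num) hD.measure_lt_top.ne⟩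
  have := ENNReal.toReal_mono hfin key
  rw [ENNReal.toReal_add hE.measure_lt_top.ne
    (ENNReal.mul_ne_top (by norm_num) hD.measure_lt_top.ne)] at this
  simpa [shadow, Measure.real] using this

lemma exists_detForm_image_eq_Icc (θ : Fin 2 → ℝ) {K : Set (Fin 2 → ℝ)} (hK : IsCompact K)
    (hc : Convex ℝ K) (hne : K.Nonempty) : ∃ a b, a ≤ b ∧ detForm θ '' K = Icc a b := by
  have hne' := hne.image (detForm θ)
  have h1 := eq_Icc_of_connected_compact
    ((hc.linear_image (detForm θ)).isConnected hne') (hK.image (continuous_detForm θ))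
  refine ⟨_, _, ?_, h1⟩
  rw [h1] at hne'
  exact nonempty_Icc.1 hne'

lemma shadow_add (θ : Fin 2 → ℝ) {A B : Set (Fin 2 → ℝ)} (hA : IsCompact A) (hAc : Convex ℝ A)
    (hAn : A.Nonempty) (hB : IsCompact B) (hBc : Convex ℝ B) (hBn : B.Nonempty) :
    shadow θ (A + B) = shadow θ A + shadow θ B := by
  obtain ⟨a, b, hab, e⟩ := exists_detForm_image_eq_Icc θ hA hAc hAn
  obtain ⟨a', b', hab', e'⟩ := exists_detForm_image_eq_Icc θ hB hBc hBn
  rw [shadow, shadow, shadow, Set.image_add, e, e', Set.Icc_add_Icc hab hab', Real.volume_real_Icc,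
    Real.volume_real_Icc, Real.volume_real_Icc, max_eq_left, max_eq_left, max_eq_left] <;> linarith

lemma shadow_mono (θ : Fin 2 → ℝ) {A B : Set (Fin 2 → ℝ)} (hB : IsCompact B) (h : A ⊆ B) :
    shadow θ A ≤ shadow θ B :=
  measureReal_mono (image_mono h) (hB.image (continuous_detForm θ)).measure_lt_top.ne

lemma shadow_nonneg (θ : Fin 2 → ℝ) (A : Set (Fin 2 → ℝ)) : 0 ≤ shadow θ A := measureReal_nonneg

lemma shadow_smul (θ : Fin 2 → ℝ) (s : ℝ) (A : Set (Fin 2 → ℝ)) :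
    shadow θ (s • A) = |s| * shadow θ A := by
  have : detForm θ '' (s • A) = s • (detForm θ '' A) := by
    ext y
    simp only [mem_image, Set.mem_smul_set, exists_exists_and_eq_and, map_smul]
  rw [shadow, this, Measure.real, Measure.addHaar_smul]
  simp [shadow, Measure.real]

lemma shadow_smul_left (θ : Fin 2 → ℝ) (s : ℝ) (A : Set (Fin 2 → ℝ)) :
    shadow (s • θ) A = |s| * shadow θ A := by
  have : detForm (s • θ) '' A = s • (detForm θ '' A) := by
    ext y
    simp only [mem_image, Set.mem_smul_set, exists_exists_and_eq_and, detForm_smul_left, smul_eq_mul]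
  rw [shadow, this, Measure.real, Measure.addHaar_smul]
  simp [shadow, Measure.real]

end PlaneSlicing

section Zonotopes
open scoped Pointwise Topology

/-- The zonotope `∑ [-θ, θ]` generated by a list of vectors. -/
def zonotope : List (Fin 2 → ℝ) → Set (Fin 2 → ℝ)
  | [] => {0}
  | θ :: l => zonotope l + symSeg θ

/-- The perimeter of a convex body relative to the zonotope generated by `l`. -/
def zonoPerim (l : List (Fin 2 → ℝ)) (K : Set (Fin 2 → ℝ)) : ℝ :=
  (l.map fun θ => 2 * shadow θ K).sum

lemma zonoPerim_cons (θ : Fin 2 → ℝ) (l : List (Fin 2 → ℝ)) (K : Set (Fin 2 → ℝ)) :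
    zonoPerim (θ :: l) K = 2 * shadow θ K + zonoPerim l K := by
  simp [zonoPerim]

lemma zonoPerim_nonneg (l : List (Fin 2 → ℝ)) (K : Set (Fin 2 → ℝ)) : 0 ≤ zonoPerim l K := by
  refine List.sum_nonneg ?_
  simp only [List.mem_map, forall_exists_index, and_imp, forall_apply_eq_imp_iff₂]
  exact fun θ _ => mul_nonneg (by norm_num) (shadow_nonneg θ K)

lemma isCompact_zonotope (l : List (Fin 2 → ℝ)) : IsCompact (zonotope l) := by
  induction l with
  | nil => exact isCompact_singleton
  | cons θ l ih => exact ih.add (symSeg_isCompact θ)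

lemma convex_zonotope (l : List (Fin 2 → ℝ)) : Convex ℝ (zonotope l) := by
  induction l with
  | nil => exact convex_singleton 0
  | cons θ l ih => exact ih.add (symSeg_convex θ)

lemma zero_mem_zonotope (l : List (Fin 2 → ℝ)) : (0 : Fin 2 → ℝ) ∈ zonotope l := by
  induction l with
  | nil => rfl
  | cons θ l ih => exact ⟨0, ih, 0, zero_mem_symSeg θ, by simp⟩

lemma nonempty_zonotope (l : List (Fin 2 → ℝ)) : (zonotope l).Nonempty := ⟨0, zero_mem_zonotope l⟩

lemma smul_symSeg (s : ℝ) (θ : Fin 2 → ℝ) : s • symSeg θ = symSeg (s • θ) := by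
  ext y
  simp only [symSeg, mem_image, Set.mem_smul_set, exists_exists_and_eq_and]
  simp only [smul_comm s]

lemma smul_zonotope_cons (s : ℝ) (θ : Fin 2 → ℝ) (l : List (Fin 2 → ℝ)) :
    s • zonotope (θ :: l) = s • zonotope l + symSeg (s • θ) := by
  rw [zonotope, smul_add, smul_symSeg]

lemma nonempty_smul_zonotope (s : ℝ) (l : List (Fin 2 → ℝ)) : (s • zonotope l).Nonempty :=
  (nonempty_zonotope l).smul_set

lemma volume_add_smul_zonotope {K : Set (Fin 2 → ℝ)} (hK : IsCompact K) (hc : Convex ℝ K)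
    (hn : K.Nonempty) {s : ℝ} (hs : 0 ≤ s) (l : List (Fin 2 → ℝ)) :
    volume.real (K + s • zonotope l)
      = volume.real K + s * zonoPerim l K + s ^ 2 * volume.real (zonotope l) := by
  induction l with
  | nil =>
    have : s • zonotope [] = {0} := by simp [zonotope]
    rw [this]
    simp [zonoPerim, zonotope, Measure.real]
  | cons θ l ih =>
    have hZ := isCompact_zonotope l
    have hZc := convex_zonotope l
    rw [smul_zonotope_cons, ← add_assoc, volume_add_symSeg (hK.add (hZ.smul s)) (hc.add (hZc.smul s)),
      ih, shadow_smul_left, shadow_add θ hK hc hn (hZ.smul s) (hZc.smul s)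
        (nonempty_smul_zonotope s l), shadow_smul, zonoPerim_cons, zonotope,
      volume_add_symSeg hZ hZc, abs_of_nonneg hs]
    ring

lemma volume_le_volume_erosion {K : Set (Fin 2 → ℝ)} (hK : IsCompact K) (hc : Convex ℝ K)
    {s : ℝ} (hs : 0 ≤ s) (l : List (Fin 2 → ℝ)) (hn : (erosion K (s • zonotope l)).Nonempty) :
    volume.real K + s ^ 2 * volume.real (zonotope l)
      ≤ volume.real (erosion K (s • zonotope l)) + s * zonoPerim l K := by
  induction l with
  | nil =>
    have : s • zonotope [] = {0} := by simp [zonotope]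
    rw [this]
    simp [zonoPerim, zonotope, erosion, Measure.real]
  | cons θ l ih =>
    have hZ := isCompact_zonotope l
    have hZc := convex_zonotope l
    rw [smul_zonotope_cons, erosion_add] at hn ⊢
    have hn' : (erosion K (s • zonotope l)).Nonempty :=
      hn.mono (erosion_subset (zero_mem_symSeg _))
    have h0 : (0 : Fin 2 → ℝ) ∈ s • zonotope l := ⟨0, zero_mem_zonotope l, by simp⟩
    have hE := isCompact_erosion hK h0
    have hEc : Convex ℝ (erosion K (s • zonotope l)) := convex_erosion hc
    have h1 := ih hn'
    have h2 := volume_le_volume_erosion_symSeg (θ := s • θ) hE hEc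
    have h3 := shadow_mono θ hK (erosion_add_subset K (s • zonotope l))
    rw [shadow_add θ hE hEc hn' (hZ.smul s) (hZc.smul s) (nonempty_smul_zonotope s l), shadow_smul,
      abs_of_nonneg hs] at h3
    rw [shadow_smul_left, abs_of_nonneg hs] at h2
    rw [zonoPerim_cons, zonotope, volume_add_symSeg hZ hZc]
    nlinarith [mul_le_mul_of_nonneg_left h3 hs]

/-- There is a largest dilate of `B` having a translate inside `K`; the set of admissible
translations for that dilate is null. -/
lemma exists_max_erosion {K B : Set (Fin 2 → ℝ)} (hK : IsCompact K) (hc : Convex ℝ K)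
    (hn : K.Nonempty) (hB : IsCompact B) (hBc : Convex ℝ B) (h0 : (0 : Fin 2 → ℝ) ∈ B)
    (hpos : 0 < volume.real B) :
    ∃ s : ℝ, 0 ≤ s ∧ (erosion K (s • B)).Nonempty ∧ volume.real (erosion K (s • B)) = 0 ∧
      ∀ t, s < t → ¬ (erosion K (t • B)).Nonempty := by
  set S : Set ℝ := {s | 0 ≤ s ∧ (erosion K (s • B)).Nonempty} with hS
  have hS0 : (0 : ℝ) ∈ S := by
    refine ⟨le_rfl, ?_⟩
    obtain ⟨x, hx⟩ := hn
    refine ⟨x, ?_⟩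
    rintro _ ⟨b, _, rfl⟩
    simpa using hx
  have hbound : ∀ s ∈ S, s ≤ (volume.real K / volume.real B) ⊔ 1 := by
    rintro s ⟨hs, x, hx⟩
    by_contra! hlt
    have h1 : 1 < s := lt_of_le_of_lt (le_max_right _ _) hlt
    have h2 : volume.real K / volume.real B < s := lt_of_le_of_lt (le_max_left _ _) hlt
    have hsub : x +ᵥ (s • B) ⊆ K := by
      rintro _ ⟨b, hb, rfl⟩
      exact hx b hb
    have h3 := measureReal_mono (μ := volume) hsub hK.measure_lt_top.ne
    have h4 : volume.real (x +ᵥ (s • B)) = s ^ 2 * volume.real B := by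
      rw [Measure.real, measure_vadd, Measure.addHaar_smul]
      simp [Measure.real, abs_of_nonneg (sq_nonneg s)]
      exact Or.inl (sq_nonneg s)
    rw [div_lt_iff₀ hpos] at h2
    rw [h4] at h3
    have h5 : s * volume.real B ≤ s ^ 2 * volume.real B := by gcongr; nlinarith
    linarith
  have hbdd : BddAbove S := ⟨_, hbound⟩
  have hclosed : IsClosed S := by
    rw [← isSeqClosed_iff_isClosed]
    intro u s hu hus
    have hs : 0 ≤ s := ge_of_tendsto' hus fun n => (hu n).1
    choose x hx using fun n => (hu n).2
    have hxK : ∀ n, x n ∈ K := fun n => by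
      have := hx n 0 ⟨0, h0, by simp⟩
      simpa using this
    obtain ⟨y, hy, f, hf, hlim⟩ := hK.tendsto_subseq hxK
    refine ⟨hs, y, ?_⟩
    rintro _ ⟨b, hb, rfl⟩
    have h1 : Tendsto (fun n => x (f n) + u (f n) • b) atTop (𝓝 (y + s • b)) :=
      hlim.add ((hus.comp hf.tendsto_atTop).smul_const b)
    exact hK.isClosed.mem_of_tendsto h1
      (Eventually.of_forall fun n => hx (f n) _ ⟨b, hb, rfl⟩)
  have hmem : sSup S ∈ S := hclosed.csSup_mem ⟨0, hS0⟩ hbdd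
  have hmax : ∀ t, sSup S < t → ¬ (erosion K (t • B)).Nonempty := fun t ht hne =>
    absurd (le_csSup hbdd (show t ∈ S from ⟨hmem.1.trans ht.le, hne⟩)) (not_le.2 ht)
  refine ⟨sSup S, hmem.1, hmem.2, ?_, hmax⟩
  set s := sSup S
  have hEc : Convex ℝ (erosion K (s • B)) := convex_erosion hc
  have hint : interior (erosion K (s • B)) = ∅ := by
    by_contra hne
    obtain ⟨x, hx⟩ := nonempty_iff_ne_empty.2 hne
    obtain ⟨ε, hε, hball⟩ := Metric.isOpen_iff.1 isOpen_interior x hx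
    obtain ⟨C, hC⟩ := hB.isBounded.exists_norm_le
    have hC0 : 0 ≤ C := (norm_nonneg _).trans (hC 0 h0)
    set δ := ε / (C + 1) with hδ
    have hδ0 : 0 < δ := by positivity
    refine hmax (s + δ) (by linarith) ⟨x, ?_⟩
    rw [hBc.add_smul hmem.1 hδ0.le]
    rintro _ ⟨_, ⟨b, hb, rfl⟩, _, ⟨b', hb', rfl⟩, rfl⟩
    have h1 : x + δ • b' ∈ erosion K (s • B) := by
      refine interior_subset (hball ?_)
      rw [mem_ball_iff_norm, add_sub_cancel_left, norm_smul, Real.norm_of_nonneg hδ0.le]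
      calc δ * ‖b'‖ ≤ δ * C := by gcongr; exact hC _ hb'
        _ < δ * (C + 1) := by nlinarith
        _ = ε := by rw [hδ]; field_simp
    have h2 := h1 (s • b) ⟨b, hb, rfl⟩
    convert h2 using 1
    beta_reduce
    abel
  have hsub : erosion K (s • B) ⊆ frontier (erosion K (s • B)) := by
    rw [frontier, hint, sdiff_empty]; exact subset_closure
  simp [Measure.real, measure_mono_null hsub (hEc.addHaar_frontier volume)]

/-- The planar Bonnesen inequality for a single convex body. -/
lemma bonnesen_convex {K : Set (Fin 2 → ℝ)} (hK : IsCompact K) (hc : Convex ℝ K)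
    (l : List (Fin 2 → ℝ)) (hpos : 0 < volume.real (zonotope l)) {r : ℝ} (hr : 0 ≤ r)
    (hrK : r ^ 2 * volume.real (zonotope l) ≤ volume.real K) (hK0 : 0 < volume.real K) :
    volume.real K + r ^ 2 * volume.real (zonotope l)
      ≤ volume.real (erosion K (r • zonotope l)) + r * zonoPerim l K := by
  have hn : K.Nonempty := by
    rw [nonempty_iff_ne_empty]; rintro rfl; simp at hK0
  obtain ⟨s, hs, hsn, hs0, hmax⟩ := exists_max_erosion hK hc hn (isCompact_zonotope l)
    (convex_zonotope l) (zero_mem_zonotope l) hpos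
  have h1 := volume_le_volume_erosion hK hc hs l hsn
  rw [hs0, zero_add] at h1
  rcases le_or_gt r s with h | h
  · refine volume_le_volume_erosion hK hc hr l (hsn.mono (erosion_mono le_rfl ?_))
    rintro _ ⟨b, hb, rfl⟩
    rcases hs.eq_or_lt with h' | h'
    · have : r = 0 := by linarith
      exact ⟨b, hb, by simp [this, ← h']⟩
    · refine ⟨(r / s) • b, ?_, by simp [smul_smul]; field_simp⟩
      exact (convex_zonotope l).smul_mem_of_zero_mem (zero_mem_zonotope l) hb
        ⟨by positivity, (div_le_one h').2 h⟩
  · have hE : 0 ≤ volume.real (erosion K (r • zonotope l)) := measureReal_nonneg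
    set A := volume.real K
    set w := volume.real (zonotope l)
    set p := zonoPerim l K
    have hs' : 0 < s := by
      rcases hs.eq_or_lt with h' | h'
      · rw [← h'] at h1; nlinarith
      · exact h'
    have h2 : 0 ≤ (r - s) * (A - r * s * w) := by
      refine mul_nonneg (by linarith) ?_
      have : r * s * w ≤ r ^ 2 * w := by
        have : r * s ≤ r ^ 2 := by nlinarith
        gcongr
      linarith
    have h3 : r * (A + s ^ 2 * w) ≤ r * (s * p) := by gcongr
    have h4 : s * (A + r ^ 2 * w) ≤ s * (r * p) := by nlinarith
    have := le_of_mul_le_mul_left h4 hs'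
    linarith

lemma isoperimetric_convex {K : Set (Fin 2 → ℝ)} (hK : IsCompact K) (hc : Convex ℝ K)
    (l : List (Fin 2 → ℝ)) (hpos : 0 < volume.real (zonotope l)) :
    2 * (√(volume.real (zonotope l)) * √(volume.real K)) ≤ zonoPerim l K := by
  rcases (measureReal_nonneg (μ := volume) (s := K)).eq_or_lt with h | h
  · rw [← h]; simp [zonoPerim_nonneg]
  have hn : K.Nonempty := by
    rw [nonempty_iff_ne_empty]; rintro rfl; simp at h
  obtain ⟨s, hs, hsn, hs0, -⟩ := exists_max_erosion hK hc hn (isCompact_zonotope l)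
    (convex_zonotope l) (zero_mem_zonotope l) hpos
  have h1 := volume_le_volume_erosion hK hc hs l hsn
  rw [hs0, zero_add] at h1
  have hs' : 0 < s := by
    rcases hs.eq_or_lt with h' | h'
    · rw [← h'] at h1; nlinarith
    · exact h'
  have e1 := Real.sq_sqrt hpos.le
  have e2 := Real.sq_sqrt h.le
  refine le_of_mul_le_mul_left ?_ hs'
  nlinarith [sq_nonneg (s * √(volume.real (zonotope l)) - √(volume.real K))]

end Zonotopes

section Families
open scoped Pointwise Topology

lemma shadow_convexHull_union (θ : Fin 2 → ℝ) {A B : Set (Fin 2 → ℝ)} (hA : Convex ℝ A)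
    (hB : Convex ℝ B) (hAB : (A ∩ B).Nonempty) :
    shadow θ (convexHull ℝ (A ∪ B)) ≤ shadow θ A + shadow θ B := by
  obtain ⟨x, hxA, hxB⟩ := hAB
  have h1 : detForm θ '' (convexHull ℝ (A ∪ B)) = detForm θ '' A ∪ detForm θ '' B := by
    rw [(detForm θ).image_convexHull, image_union]
    refine Convex.convexHull_eq ?_
    rw [Real.convex_iff_isPreconnected]
    exact IsPreconnected.union (detForm θ x) ⟨x, hxA, rfl⟩ ⟨x, hxB, rfl⟩
      (hA.linear_image _).isPreconnected (hB.linear_image _).isPreconnected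
  rw [shadow, h1]
  exact measureReal_union_le _ _

lemma zonoPerim_convexHull_union (l : List (Fin 2 → ℝ)) {A B : Set (Fin 2 → ℝ)}
    (hA : Convex ℝ A) (hB : Convex ℝ B) (hAB : (A ∩ B).Nonempty) :
    zonoPerim l (convexHull ℝ (A ∪ B)) ≤ zonoPerim l A + zonoPerim l B := by
  induction l with
  | nil => simp [zonoPerim]
  | cons θ l ih =>
    simp only [zonoPerim_cons]
    linarith [shadow_convexHull_union θ hA hB hAB]

lemma bonnesen_convex_min {K : Set (Fin 2 → ℝ)} (hK : IsCompact K) (hc : Convex ℝ K)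
    (l : List (Fin 2 → ℝ)) (hpos : 0 < volume.real (zonotope l)) {r : ℝ} (hr : 0 ≤ r) :
    volume.real K + min (r ^ 2 * volume.real (zonotope l)) (volume.real K)
      ≤ volume.real (erosion K (r • zonotope l)) + r * zonoPerim l K := by
  have hE : 0 ≤ volume.real (erosion K (r • zonotope l)) := measureReal_nonneg
  have hK0 : 0 ≤ volume.real K := measureReal_nonneg
  have hp := zonoPerim_nonneg l K
  rcases hK0.eq_or_lt with h0 | h0
  · have h1 := min_le_right (r ^ 2 * volume.real (zonotope l)) (volume.real K)
    have h2 : 0 ≤ r * zonoPerim l K := mul_nonneg hr hp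
    linarith
  rcases le_or_gt (r ^ 2 * volume.real (zonotope l)) (volume.real K) with h | h
  · rw [min_eq_left h]
    exact bonnesen_convex hK hc l hpos hr h h0
  · rw [min_eq_right h.le]
    have h1 := mul_le_mul_of_nonneg_left (isoperimetric_convex hK hc l hpos) hr
    set a := √(volume.real (zonotope l))
    have hb : 0 ≤ √(volume.real K) := Real.sqrt_nonneg _
    have hb2 := Real.sq_sqrt hK0
    have ha2 : a ^ 2 = volume.real (zonotope l) := Real.sq_sqrt hpos.le
    have ha : 0 ≤ a := Real.sqrt_nonneg _
    have h2 : √(volume.real K) ≤ r * a := by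
      refine abs_le_of_sq_le_sq' ?_ (by positivity) |>.2
      nlinarith
    nlinarith [mul_le_mul_of_nonneg_right h2 hb]

lemma min_sum_le_sum_min {ι : Type*} (s : Finset ι) (f : ι → ℝ) (hf : ∀ i ∈ s, 0 ≤ f i) {a : ℝ}
    (ha : 0 ≤ a) : min a (∑ i ∈ s, f i) ≤ ∑ i ∈ s, min a (f i) := by
  classical
  induction s using Finset.induction_on with
  | empty => simp [ha]
  | insert i s hi ih =>
    rw [Finset.sum_insert hi, Finset.sum_insert hi]
    have h1 := ih fun j hj => hf j (Finset.mem_insert_of_mem hj)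
    have h2 := hf i (Finset.mem_insert_self i s)
    have h3 : 0 ≤ ∑ j ∈ s, f j :=
      Finset.sum_nonneg fun j hj => hf j (Finset.mem_insert_of_mem hj)
    refine le_trans ?_ (add_le_add_right h1 _)
    rcases le_total a (f i) with h | h <;> rcases le_total a (∑ j ∈ s, f j) with h' | h' <;>
      simp only [min_eq_left, min_eq_right, h, h'] <;>
      first
        | exact (min_le_left _ _).trans (by linarith)
        | exact (min_le_right _ _).trans (by linarith)

lemma isCompact_convexHull_union {A B : Set (Fin 2 → ℝ)} (hA : IsCompact A) (hAc : Convex ℝ A)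
    (hAn : A.Nonempty) (hB : IsCompact B) (hBc : Convex ℝ B) (hBn : B.Nonempty) :
    IsCompact (convexHull ℝ (A ∪ B)) := by
  have : convexHull ℝ (A ∪ B) =
      (fun p : ((Fin 2 → ℝ) × (Fin 2 → ℝ)) × ℝ => (1 - p.2) • p.1.1 + p.2 • p.1.2) ''
        ((A ×ˢ B) ×ˢ Icc (0 : ℝ) 1) := by
    rw [hAc.convexHull_union hBc hAn hBn]
    ext x
    simp only [mem_convexJoin, segment_eq_image, mem_image, Set.mem_prod, Prod.exists]
    constructor
    · rintro ⟨a, ha, b, hb, t, ht, rfl⟩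
      exact ⟨a, b, t, ⟨⟨ha, hb⟩, ht⟩, rfl⟩
    · rintro ⟨a, b, t, ⟨⟨ha, hb⟩, ht⟩, rfl⟩
      exact ⟨a, ha, b, hb, t, ht, rfl⟩
  rw [this]
  exact ((hA.prod hB).prod isCompact_Icc).image (by fun_prop)

lemma sqrt_add_le_sqrt_add_sqrt {a b : ℝ} (ha : 0 ≤ a) (hb : 0 ≤ b) : √(a + b) ≤ √a + √b := by
  rw [Real.sqrt_le_left (by positivity)]
  nlinarith [Real.sq_sqrt ha, Real.sq_sqrt hb, Real.sqrt_nonneg a, Real.sqrt_nonneg b,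
    mul_nonneg (Real.sqrt_nonneg a) (Real.sqrt_nonneg b)]

/-- The planar Bonnesen inequality for a finite family of convex bodies inside `L`. -/
lemma bonnesen_family {L : Set (Fin 2 → ℝ)} (hL : IsCompact L)
    (l : List (Fin 2 → ℝ)) (hpos : 0 < volume.real (zonotope l)) {r : ℝ} (hr : 0 ≤ r)
    (𝒦 : Finset (Set (Fin 2 → ℝ)))
    (h𝒦 : ∀ K ∈ 𝒦, IsCompact K ∧ Convex ℝ K ∧ K ⊆ L) (hLc : Convex ℝ L) :
    volume.real (⋃ K ∈ 𝒦, K) + min (r ^ 2 * volume.real (zonotope l)) (volume.real (⋃ K ∈ 𝒦, K))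
      ≤ volume.real (erosion L (r • zonotope l)) + r * ∑ K ∈ 𝒦, zonoPerim l K := by
  classical
  induction hn : 𝒦.card using Nat.strong_induction_on generalizing 𝒦 with
  | _ n ih =>
  by_cases hdisj : (𝒦 : Set (Set (Fin 2 → ℝ))).PairwiseDisjoint id
  · have h0 : (0 : Fin 2 → ℝ) ∈ r • zonotope l := ⟨0, zero_mem_zonotope l, by simp⟩
    have hvol : volume.real (⋃ K ∈ 𝒦, K) = ∑ K ∈ 𝒦, volume.real K :=
      measureReal_biUnion_finset hdisj (fun K hK => (h𝒦 K hK).1.measurableSet)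
        (fun K hK => (h𝒦 K hK).1.measure_lt_top.ne)
    have hvolE : volume.real (⋃ K ∈ 𝒦, erosion K (r • zonotope l))
        = ∑ K ∈ 𝒦, volume.real (erosion K (r • zonotope l)) :=
      measureReal_biUnion_finset
        (fun A hA B hB hAB => (hdisj hA hB hAB).mono (erosion_subset h0) (erosion_subset h0))
        (fun K hK => (isCompact_erosion (h𝒦 K hK).1 h0).measurableSet)
        (fun K hK => (isCompact_erosion (h𝒦 K hK).1 h0).measure_lt_top.ne)
    have hE : ∑ K ∈ 𝒦, volume.real (erosion K (r • zonotope l))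
        ≤ volume.real (erosion L (r • zonotope l)) := by
      rw [← hvolE]
      exact measureReal_mono (iUnion₂_subset fun K hK => erosion_mono (h𝒦 K hK).2.2 le_rfl)
        (isCompact_erosion hL h0).measure_lt_top.ne
    have h1 : ∑ K ∈ 𝒦, (volume.real K + min (r ^ 2 * volume.real (zonotope l)) (volume.real K))
        ≤ ∑ K ∈ 𝒦, (volume.real (erosion K (r • zonotope l)) + r * zonoPerim l K) :=
      Finset.sum_le_sum fun K hK => bonnesen_convex_min (h𝒦 K hK).1 (h𝒦 K hK).2.1 l hpos hr
    rw [Finset.sum_add_distrib, Finset.sum_add_distrib, ← Finset.mul_sum] at h1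
    have h2 := min_sum_le_sum_min 𝒦 (fun K => volume.real K) (fun K _ => measureReal_nonneg)
      (a := r ^ 2 * volume.real (zonotope l)) (by positivity)
    rw [hvol]
    linarith
  · simp only [Set.PairwiseDisjoint, Set.Pairwise, not_forall] at hdisj
    obtain ⟨A, hA, B, hB, hAB, hint⟩ := hdisj
    simp only [Function.onFun, id, Set.not_disjoint_iff_nonempty_inter] at hint
    simp only [Finset.mem_coe] at hA hB
    have hBe : B ∈ 𝒦.erase A := Finset.mem_erase.2 ⟨hAB.symm, hB⟩
    set 𝒦₀ := (𝒦.erase A).erase B with h𝒦₀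
    set C := convexHull ℝ (A ∪ B) with hC
    have hcard : (insert C 𝒦₀).card < n := by
      refine (Finset.card_insert_le _ _).trans_lt ?_
      have h1 := Finset.card_erase_lt_of_mem hA
      have h2 := Finset.card_erase_lt_of_mem hBe
      rw [← hn, h𝒦₀]; omega
    have hCL : IsCompact C ∧ Convex ℝ C ∧ C ⊆ L :=
      ⟨isCompact_convexHull_union (h𝒦 A hA).1 (h𝒦 A hA).2.1 (hint.mono inter_subset_left)
        (h𝒦 B hB).1 (h𝒦 B hB).2.1 (hint.mono inter_subset_right), convex_convexHull _ _,
        convexHull_min (union_subset (h𝒦 A hA).2.2 (h𝒦 B hB).2.2) hLc⟩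
    have hnew : ∀ K ∈ insert C 𝒦₀, IsCompact K ∧ Convex ℝ K ∧ K ⊆ L := by
      intro K hK
      rcases Finset.mem_insert.1 hK with rfl | hK
      · exact hCL
      · exact h𝒦 K (Finset.mem_of_mem_erase (Finset.mem_of_mem_erase hK))
    have key := ih _ hcard (insert C 𝒦₀) hnew rfl
    have hsub : (⋃ K ∈ 𝒦, K) ⊆ ⋃ K ∈ insert C 𝒦₀, K := by
      refine iUnion₂_subset fun K hK => ?_
      have hCsub : C ⊆ ⋃ K ∈ insert C 𝒦₀, K :=
        subset_biUnion_of_mem (u := fun K => K) (Finset.mem_coe.2 (Finset.mem_insert_self C 𝒦₀))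
      by_cases hKA : K = A
      · rw [hKA]; exact (subset_union_left.trans (subset_convexHull ℝ _)).trans hCsub
      by_cases hKB : K = B
      · rw [hKB]; exact (subset_union_right.trans (subset_convexHull ℝ _)).trans hCsub
      · exact subset_biUnion_of_mem (u := fun K => K) (Finset.mem_coe.2 (Finset.mem_insert_of_mem
          (Finset.mem_erase.2 ⟨hKB, Finset.mem_erase.2 ⟨hKA, hK⟩⟩)))
    have hfin : volume (⋃ K ∈ insert C 𝒦₀, K) ≠ ∞ :=
      (measure_mono (iUnion₂_subset fun K hK => (hnew K hK).2.2)).trans_lt hL.measure_lt_top |>.ne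
    have hvol := measureReal_mono hsub hfin
    have hsum : ∑ K ∈ insert C 𝒦₀, zonoPerim l K ≤ ∑ K ∈ 𝒦, zonoPerim l K := by
      have h1 : ∑ K ∈ insert C 𝒦₀, zonoPerim l K ≤ zonoPerim l C + ∑ K ∈ 𝒦₀, zonoPerim l K := by
        by_cases hmem : C ∈ 𝒦₀
        · rw [Finset.insert_eq_of_mem hmem]
          linarith [zonoPerim_nonneg l C]
        · rw [Finset.sum_insert hmem]
      have h2 := zonoPerim_convexHull_union l (h𝒦 A hA).2.1 (h𝒦 B hB).2.1 hint
      rw [← Finset.add_sum_erase _ _ hA, ← Finset.add_sum_erase _ _ hBe]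
      linarith
    have h3 := mul_le_mul_of_nonneg_left hsum hr
    have h4 := min_le_min_left (r ^ 2 * volume.real (zonotope l)) hvol
    linarith

lemma isoperimetric_family (l : List (Fin 2 → ℝ)) (hpos : 0 < volume.real (zonotope l))
    (𝒦 : Finset (Set (Fin 2 → ℝ))) (h𝒦 : ∀ K ∈ 𝒦, IsCompact K ∧ Convex ℝ K) :
    2 * (√(volume.real (zonotope l)) * √(volume.real (⋃ K ∈ 𝒦, K))) ≤
      ∑ K ∈ 𝒦, zonoPerim l K := by
  have h1 : volume.real (⋃ K ∈ 𝒦, K) ≤ ∑ K ∈ 𝒦, volume.real K :=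
    measureReal_biUnion_finset_le 𝒦 _
  have h2 : √(∑ K ∈ 𝒦, volume.real K) ≤ ∑ K ∈ 𝒦, √(volume.real K) := by
    classical
    induction 𝒦 using Finset.induction_on with
    | empty => simp
    | insert K s hK ih =>
      rw [Finset.sum_insert hK, Finset.sum_insert hK]
      refine (sqrt_add_le_sqrt_add_sqrt measureReal_nonneg
        (Finset.sum_nonneg fun _ _ => measureReal_nonneg)).trans ?_
      gcongr
      exact ih (fun K hK => h𝒦 K (Finset.mem_insert_of_mem hK)) (measureReal_biUnion_finset_le _ _)
  calc 2 * (√(volume.real (zonotope l)) * √(volume.real (⋃ K ∈ 𝒦, K)))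
      ≤ 2 * (√(volume.real (zonotope l)) * ∑ K ∈ 𝒦, √(volume.real K)) := by
        gcongr
        exact (Real.sqrt_le_sqrt h1).trans h2
    _ = ∑ K ∈ 𝒦, 2 * (√(volume.real (zonotope l)) * √(volume.real K)) := by
        rw [Finset.mul_sum, Finset.mul_sum]
    _ ≤ _ := Finset.sum_le_sum fun K hK =>
        isoperimetric_convex (h𝒦 K hK).1 (h𝒦 K hK).2 l hpos

end Families

section NormBasics
open scoped Pointwise Topology

variable {φ : (Fin 2 → ℝ) → ℝ}

lemma IsNorm.map_zero (hφ : IsNorm φ) : φ 0 = 0 := (hφ.eq_zero_iff 0).2 rfl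

lemma IsNorm.map_neg (hφ : IsNorm φ) (x : Fin 2 → ℝ) : φ (-x) = φ x := by
  have := hφ.smul_eq (-1) x
  simpa using this

lemma IsNorm.map_pos (hφ : IsNorm φ) {x : Fin 2 → ℝ} (hx : x ≠ 0) : 0 < φ x :=
  (hφ.nonneg x).lt_of_ne fun h => hx ((hφ.eq_zero_iff x).1 h.symm)

lemma IsNorm.map_smul_nonneg (hφ : IsNorm φ) {a : ℝ} (ha : 0 ≤ a) (x : Fin 2 → ℝ) :
    φ (a • x) = a * φ x := by rw [hφ.smul_eq, abs_of_nonneg ha]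

lemma IsNorm.convexOn (hφ : IsNorm φ) : ConvexOn ℝ univ φ := by
  refine ⟨convex_univ, fun x _ y _ a b ha hb _ => ?_⟩
  refine (hφ.add_le _ _).trans ?_
  rw [hφ.map_smul_nonneg ha, hφ.map_smul_nonneg hb, smul_eq_mul, smul_eq_mul]

lemma IsNorm.continuous (hφ : IsNorm φ) : Continuous φ := by
  rw [← continuousOn_univ]
  exact hφ.convexOn.continuousOn isOpen_univ

lemma IsNorm.exists_lower_bound (hφ : IsNorm φ) : ∃ c, 0 < c ∧ ∀ x, c * ‖x‖ ≤ φ x := by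
  have hS : IsCompact (Metric.sphere (0 : Fin 2 → ℝ) 1) := isCompact_sphere _ _
  have hne : (Metric.sphere (0 : Fin 2 → ℝ) 1).Nonempty := by
    refine ⟨fun _ => 1, ?_⟩
    simp
  obtain ⟨y, hy, hmin⟩ := hS.exists_isMinOn hne hφ.continuous.continuousOn
  have hy1 : ‖y‖ = 1 := by simpa using hy
  refine ⟨φ y, hφ.map_pos (by rintro rfl; simp at hy1), fun x => ?_⟩
  rcases eq_or_ne x 0 with rfl | hx
  · simp [hφ.map_zero]
  have hx' : 0 < ‖x‖ := norm_pos_iff.2 hx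
  have h1 : φ y ≤ φ (‖x‖⁻¹ • x) := hmin (by simp [norm_smul, hx'.ne'])
  rw [hφ.map_smul_nonneg (by positivity)] at h1
  calc φ y * ‖x‖ ≤ ‖x‖⁻¹ * φ x * ‖x‖ := by gcongr
    _ = φ x := by field_simp

/-- The closed unit ball of `φ`. -/
def unitBall (φ : (Fin 2 → ℝ) → ℝ) : Set (Fin 2 → ℝ) := {x | φ x ≤ 1}

/-- The open ball of radius `r` of `φ`, centred at the origin. -/
def openBallOf (φ : (Fin 2 → ℝ) → ℝ) (r : ℝ) : Set (Fin 2 → ℝ) := {x | φ x < r}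

lemma mem_smul_unitBall (hφ : IsNorm φ) {r : ℝ} (hr : 0 ≤ r) {x : Fin 2 → ℝ} :
    x ∈ r • unitBall φ ↔ φ x ≤ r := by
  rcases hr.eq_or_lt with rfl | hr
  · have hne : (unitBall φ).Nonempty := ⟨0, by simp [unitBall, hφ.map_zero]⟩
    rw [zero_smul_set hne]
    constructor
    · intro h; rw [Set.mem_zero.1 h, hφ.map_zero]
    · intro h; exact (hφ.eq_zero_iff x).1 (le_antisymm h (hφ.nonneg x))
  · rw [mem_smul_set_iff_inv_smul_mem₀ hr.ne', unitBall, mem_ofPred_eq,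
      hφ.map_smul_nonneg (by positivity), inv_mul_le_iff₀ hr, mul_one]

lemma zero_mem_unitBall (hφ : IsNorm φ) : (0 : Fin 2 → ℝ) ∈ unitBall φ := by
  simp [unitBall, hφ.map_zero]

lemma convex_unitBall (hφ : IsNorm φ) : Convex ℝ (unitBall φ) := by
  simpa [unitBall] using hφ.convexOn.convex_le 1

lemma isOpen_openBallOf (hφ : IsNorm φ) (r : ℝ) : IsOpen (openBallOf φ r) :=
  isOpen_lt hφ.continuous continuous_const

lemma isCompact_unitBall (hφ : IsNorm φ) : IsCompact (unitBall φ) := by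
  obtain ⟨c, hc, h⟩ := hφ.exists_lower_bound
  refine (isCompact_closedBall (0 : Fin 2 → ℝ) c⁻¹).of_isClosed_subset
    (isClosed_le hφ.continuous continuous_const) fun x hx => ?_
  have h1 := (h x).trans hx
  rw [mem_closedBall_zero_iff, ← mul_one c⁻¹, le_inv_mul_iff₀ hc]
  exact h1

lemma isCompact_smul_unitBall (hφ : IsNorm φ) (r : ℝ) : IsCompact (r • unitBall φ) :=
  (isCompact_unitBall hφ).smul r

lemma zero_mem_smul_unitBall (hφ : IsNorm φ) (r : ℝ) : (0 : Fin 2 → ℝ) ∈ r • unitBall φ :=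
  ⟨0, zero_mem_unitBall hφ, by simp⟩

lemma openBallOf_one_subset (φ : (Fin 2 → ℝ) → ℝ) : openBallOf φ 1 ⊆ unitBall φ :=
  fun x (hx : φ x < 1) => (hx.le : φ x ≤ 1)

lemma volume_unitBall_pos (hφ : IsNorm φ) : 0 < volume.real (unitBall φ) := by
  refine ENNReal.toReal_pos ?_ (isCompact_unitBall hφ).measure_lt_top.ne
  refine ne_of_gt (lt_of_lt_of_le ?_ (measure_mono (openBallOf_one_subset φ)))
  exact (isOpen_openBallOf hφ 1).measure_pos _ ⟨0, by simp [openBallOf, hφ.map_zero]⟩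

lemma volume_smul_real (s : ℝ) (A : Set (Fin 2 → ℝ)) :
    volume.real (s • A) = s ^ 2 * volume.real A := by
  rw [Measure.real, Measure.addHaar_smul]
  simp [Measure.real, abs_of_nonneg (sq_nonneg s)]
  exact Or.inl (sq_nonneg s)

end NormBasics

section ZonotopeApproximation
open scoped Pointwise Topology

lemma le_sum_abs_of_mem_zonotope {l : List (Fin 2 → ℝ)} {z : Fin 2 → ℝ} (hz : z ∈ zonotope l)
    (f : (Fin 2 → ℝ) →L[ℝ] ℝ) : f z ≤ (l.map fun θ => |f θ|).sum := by
  induction l generalizing z with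
  | nil => rw [show z = 0 from hz]; simp
  | cons θ l ih =>
    obtain ⟨x, hx, _, ⟨a, ha, rfl⟩, rfl⟩ := hz
    have h1 : a * f θ ≤ |f θ| := by
      refine (le_abs_self _).trans ?_
      rw [abs_mul]
      exact mul_le_of_le_one_left (abs_nonneg _) (abs_le.2 ha)
    have h2 := ih hx
    simp only [map_add, map_smul, smul_eq_mul, List.map_cons, List.sum_cons]
    linarith

lemma exists_mem_zonotope_eq_sum_abs (l : List (Fin 2 → ℝ)) (f : (Fin 2 → ℝ) →L[ℝ] ℝ) :
    ∃ z ∈ zonotope l, f z = (l.map fun θ => |f θ|).sum := by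
  induction l with
  | nil => exact ⟨0, rfl, by simp⟩
  | cons θ l ih =>
    obtain ⟨x, hx, h⟩ := ih
    rcases abs_cases (f θ) with ⟨h1, -⟩ | ⟨h1, -⟩
    · exact ⟨x + θ, ⟨x, hx, θ, ⟨1, by simp, by simp⟩, rfl⟩, by simp [h, h1, add_comm]⟩
    · exact ⟨x + -θ, ⟨x, hx, -θ, ⟨-1, by simp, by simp⟩, rfl⟩, by simp [h, h1, add_comm]⟩

lemma mem_zonotope_of_forall_le {l : List (Fin 2 → ℝ)} {z : Fin 2 → ℝ}
    (h : ∀ f : (Fin 2 → ℝ) →L[ℝ] ℝ, f z ≤ (l.map fun θ => |f θ|).sum) : z ∈ zonotope l := by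
  by_contra hz
  obtain ⟨f, u, hfu, hu⟩ := geometric_hahn_banach_closed_point (convex_zonotope l)
    (isCompact_zonotope l).isClosed hz
  obtain ⟨y, hy, hfy⟩ := exists_mem_zonotope_eq_sum_abs l f
  have := hfu y hy
  linarith [h f]

lemma zonotope_subset_of_forall_le {l : List (Fin 2 → ℝ)} {B : Set (Fin 2 → ℝ)} (hBc : Convex ℝ B)
    (hB : IsClosed B)
    (h : ∀ (f : (Fin 2 → ℝ) →L[ℝ] ℝ) (u : ℝ), (∀ x ∈ B, f x ≤ u) →
      (l.map fun θ => |f θ|).sum ≤ u) : zonotope l ⊆ B := by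
  intro z hz
  by_contra hzB
  obtain ⟨f, u, hfu, hu⟩ := geometric_hahn_banach_closed_point hBc hB hzB
  linarith [h f u fun x hx => (hfu x hx).le, le_sum_abs_of_mem_zonotope hz f]

lemma sum_abs_sub_eq_of_concave {c : ℕ → ℝ} {N : ℕ}
    (hc : ∀ i, i + 2 ≤ N → c (i + 2) - c (i + 1) ≤ c (i + 1) - c i) :
    ∀ n, n + 1 ≤ N → 0 ≤ c (n + 1) - c n →
      ∑ i ∈ Finset.range (n + 1), |c (i + 1) - c i| = c (n + 1) - c 0 := by
  intro n
  induction n with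
  | zero => intro _ h; simpa using h
  | succ n ih =>
    intro hn h
    rw [Finset.sum_range_succ, ih (by omega) (h.trans (hc n hn)), abs_of_nonneg h]
    ring

lemma exists_sum_abs_sub_le_of_concave {c : ℕ → ℝ} {N : ℕ}
    (hc : ∀ i, i + 2 ≤ N → c (i + 2) - c (i + 1) ≤ c (i + 1) - c i) :
    ∀ n ≤ N, ∃ k ≤ n, ∑ i ∈ Finset.range n, |c (i + 1) - c i| ≤ 2 * c k - c 0 - c n := by
  intro n
  induction n with
  | zero => intro _; exact ⟨0, le_rfl, by simp; linarith⟩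
  | succ n ih =>
    intro hn
    rcases le_or_gt 0 (c (n + 1) - c n) with h | h
    · exact ⟨n + 1, le_rfl, by rw [sum_abs_sub_eq_of_concave hc n hn h]; linarith⟩
    · obtain ⟨k, hk, h1⟩ := ih (by omega)
      refine ⟨k, by omega, ?_⟩
      rw [Finset.sum_range_succ, abs_of_neg h]
      linarith

lemma le_sum_abs_sub (c : ℕ → ℝ) (n : ℕ) :
    ∀ j ≤ n, 2 * c j - c 0 - c n ≤ ∑ i ∈ Finset.range n, |c (i + 1) - c i| := by
  induction n with
  | zero => intro j hj; obtain rfl : j = 0 := by omega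
            simp; linarith
  | succ n ih =>
    intro j hj
    rw [Finset.sum_range_succ]
    rcases Nat.lt_or_ge n j with h | h
    · obtain rfl : j = n + 1 := by omega
      have := ih n le_rfl
      linarith [le_abs_self (c (n + 1) - c n)]
    · have := ih j h
      linarith [neg_abs_le (c (n + 1) - c n)]

/-- `g` parametrises the upper boundary of the unit ball of `φ` in the frame `(p, q)`. -/
structure IsUpperGraph (φ : (Fin 2 → ℝ) → ℝ) (p q : Fin 2 → ℝ) (g : ℝ → ℝ) : Prop where
  exists_coords : ∀ v : Fin 2 → ℝ, ∃ x y : ℝ, v = x • p + y • q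
  abs_le_one : ∀ x y : ℝ, φ (x • p + y • q) ≤ 1 → |x| ≤ 1
  le_graph : ∀ x y : ℝ, φ (x • p + y • q) ≤ 1 → y ≤ g x
  nonneg : ∀ x : ℝ, |x| ≤ 1 → 0 ≤ g x
  graph_mem : ∀ x : ℝ, |x| ≤ 1 → φ (x • p + g x • q) ≤ 1

lemma exists_isUpperGraph {φ : (Fin 2 → ℝ) → ℝ} (hφ : IsNorm φ) :
    ∃ p q g, IsUpperGraph φ p q g := by
  obtain ⟨p, hp, hmax⟩ := (isCompact_unitBall hφ).exists_isMaxOn ⟨0, zero_mem_unitBall hφ⟩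
    (continuous_apply (0 : Fin 2)).continuousOn
  set q : Fin 2 → ℝ := ![0, 1] with hq
  have hq0 : q ≠ 0 := fun h => by simpa [hq] using congrFun h 1
  have hφq := hφ.map_pos hq0
  have hp1 : φ p ≤ 1 := hp
  have hmax' : ∀ x, φ x ≤ 1 → x 0 ≤ p 0 := fun x hx => hmax hx
  have hM : 0 < p 0 := by
    set e : Fin 2 → ℝ := ![1, 0] with he
    have he0 : e ≠ 0 := fun h => by simpa [he] using congrFun h 0
    have hφe := hφ.map_pos he0
    have := hmax' ((φ e)⁻¹ • e) (by
      rw [hφ.map_smul_nonneg (by positivity), inv_mul_cancel₀ hφe.ne'])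
    refine lt_of_lt_of_le ?_ this
    simpa [he] using hφe
  have h0mem : ∀ x : ℝ, |x| ≤ 1 → φ (x • p + (0 : ℝ) • q) ≤ 1 := by
    intro x hx
    rw [zero_smul, add_zero, hφ.smul_eq]
    exact mul_le_one₀ hx (hφ.nonneg _) hp1
  have hbdd : ∀ x : ℝ, BddAbove {y : ℝ | φ (x • p + y • q) ≤ 1} := by
    intro x
    refine ⟨(1 + |x| * φ p) / φ q, fun y hy => ?_⟩
    rw [le_div_iff₀ hφq]
    have h1 : φ (y • q) ≤ φ (x • p + y • q) + φ (-(x • p)) := by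
      convert hφ.add_le (x • p + y • q) (-(x • p)) using 2
      abel
    rw [hφ.map_neg, hφ.smul_eq, hφ.smul_eq] at h1
    have h2 : φ (x • p + y • q) ≤ 1 := hy
    nlinarith [le_abs_self y]
  refine ⟨p, q, fun x => sSup {y : ℝ | φ (x • p + y • q) ≤ 1}, ?_, ?_, ?_, ?_, ?_⟩
  · intro v
    refine ⟨v 0 / p 0, v 1 - v 0 / p 0 * p 1, ?_⟩
    ext i
    fin_cases i
    · simp [hq]; field_simp
    · simp [hq]
  · intro x y h
    have h1 := hmax' _ h
    have h2 := hmax' (-(x • p + y • q)) (by rwa [hφ.map_neg])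
    simp only [hq, Pi.add_apply, Pi.neg_apply, Pi.smul_apply, smul_eq_mul, Matrix.cons_val_zero,
      mul_zero, add_zero] at h1 h2
    rw [abs_le]
    constructor <;> nlinarith
  · intro x y h
    exact le_csSup (hbdd x) h
  · intro x hx
    exact le_csSup (hbdd x) (h0mem x hx)
  · intro x hx
    have hcl : IsClosed {y : ℝ | φ (x • p + y • q) ≤ 1} :=
      isClosed_le (hφ.continuous.comp (by fun_prop)) continuous_const
    exact hcl.csSup_mem ⟨0, h0mem x hx⟩ (hbdd x)

lemma IsUpperGraph.concave {φ : (Fin 2 → ℝ) → ℝ} (hφ : IsNorm φ) {p q : Fin 2 → ℝ} {g : ℝ → ℝ}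
    (h : IsUpperGraph φ p q g) {x y a b : ℝ} (hx : |x| ≤ 1) (hy : |y| ≤ 1) (ha : 0 ≤ a)
    (hb : 0 ≤ b) (hab : a + b = 1) : a * g x + b * g y ≤ g (a * x + b * y) := by
  refine h.le_graph _ _ ?_
  have h1 := convex_unitBall hφ (h.graph_mem x hx) (h.graph_mem y hy) ha hb hab
  have h2 : φ (a • (x • p + g x • q) + b • (y • p + g y • q)) ≤ 1 := h1
  convert h2 using 2
  ext i
  simp only [Pi.add_apply, Pi.smul_apply, smul_eq_mul]
  ring

/-- The halved edge vectors of the polygon inscribed in the upper graph with `N + 1` equally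
spaced abscissae. -/
def graphEdges (p q : Fin 2 → ℝ) (g : ℝ → ℝ) (N : ℕ) : List (Fin 2 → ℝ) :=
  (g (-1) / 2) • q :: (g 1 / 2) • q :: (List.range N).map fun i : ℕ =>
    (1 / 2 : ℝ) • (((-1 + 2 * ((i + 1 : ℕ) : ℝ) / N) • p + g (-1 + 2 * ((i + 1 : ℕ) : ℝ) / N) • q) -
      ((-1 + 2 * (i : ℝ) / N) • p + g (-1 + 2 * (i : ℝ) / N) • q))

lemma sum_abs_graphEdges (p q : Fin 2 → ℝ) {g : ℝ → ℝ} (hg0 : 0 ≤ g (-1)) (hg1 : 0 ≤ g 1) (N : ℕ)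
    (f : (Fin 2 → ℝ) →L[ℝ] ℝ) (hf : 0 ≤ f q) {c : ℕ → ℝ}
    (hc : ∀ i : ℕ, c i = (-1 + 2 * (i : ℝ) / N) * f p + g (-1 + 2 * (i : ℝ) / N) * f q) :
    ((graphEdges p q g N).map fun θ => |f θ|).sum =
      (g (-1) * f q + g 1 * f q + ∑ i ∈ Finset.range N, |c (i + 1) - c i|) / 2 := by
  have h1 : ∀ n : ℕ, ((List.range n).map fun i => |c (i + 1) - c i|).sum =
      ∑ i ∈ Finset.range n, |c (i + 1) - c i| := fun n => rfl
  simp only [graphEdges, List.map_cons, List.sum_cons, List.map_map, Function.comp_def, map_smul,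
    map_sub, map_add, smul_eq_mul, ← hc, abs_mul, ← h1, abs_of_nonneg hf]
  rw [abs_of_nonneg (by positivity : 0 ≤ g (-1) / 2), abs_of_nonneg (by positivity : 0 ≤ g 1 / 2),
    List.sum_map_mul_left]
  norm_num
  ring

lemma sum_abs_neg_apply (l : List (Fin 2 → ℝ)) (f : (Fin 2 → ℝ) →L[ℝ] ℝ) :
    (l.map fun θ => |(-f) θ|).sum = (l.map fun θ => |f θ|).sum := by simp

lemma exists_gridpoint_right {x : ℝ} (hx : -1 ≤ x) (hx0 : x ≤ 0) {N : ℕ} (hN : 2 ≤ N) :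
    ∃ i ≤ N, ∃ s : ℝ, 0 ≤ s ∧ s ≤ 2 / N ∧ -1 + 2 * (i : ℝ) / N = (1 - s) * x + s * 1 := by
  have hN' : (2 : ℝ) ≤ N := by exact_mod_cast hN
  have hN0 : (0 : ℝ) < N := by linarith
  set i := ⌈(x + 1) * N / 2⌉₊ with hi
  have h1 : (x + 1) * N / 2 ≤ i := Nat.le_ceil _
  have h2 : (i : ℝ) < (x + 1) * N / 2 + 1 := Nat.ceil_lt_add_one (by
    have : 0 ≤ x + 1 := by linarith
    positivity)
  have h3 : x ≤ -1 + 2 * (i : ℝ) / N := by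
    rw [← sub_le_iff_le_add', le_div_iff₀ hN0]; linarith
  have h4 : -1 + 2 * (i : ℝ) / N ≤ x + 2 / N := by
    rw [← le_sub_iff_add_le', div_le_iff₀ hN0]
    have : (x + 2 / N - -1) * N = (x + 1) * N + 2 := by field_simp; ring
    rw [this]; linarith
  refine ⟨i, ?_, (-1 + 2 * (i : ℝ) / N - x) / (1 - x), ?_, ?_, ?_⟩
  · have : (i : ℝ) < N + 1 := by nlinarith
    have : i < N + 1 := by exact_mod_cast this
    omega
  · exact div_nonneg (by linarith) (by linarith)
  · have : 0 ≤ 2 / (N : ℝ) := by positivity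
    rw [div_le_iff₀ (by linarith)]
    nlinarith
  · have : 1 - x ≠ 0 := by linarith
    field_simp
    ring

lemma exists_gridpoint_left {x : ℝ} (hx : x ≤ 1) (hx0 : 0 ≤ x) {N : ℕ} (hN : 2 ≤ N) :
    ∃ i ≤ N, ∃ s : ℝ, 0 ≤ s ∧ s ≤ 2 / N ∧ -1 + 2 * (i : ℝ) / N = (1 - s) * x + s * (-1) := by
  obtain ⟨i, hi, s, hs, hs', h⟩ := exists_gridpoint_right (x := -x) (by linarith) (by linarith) hN
  have hN0 : (N : ℝ) ≠ 0 := by positivity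
  refine ⟨N - i, by omega, s, hs, hs', ?_⟩
  rw [Nat.cast_sub hi]
  have : -1 + 2 * ((N : ℝ) - i) / N = -(-1 + 2 * (i : ℝ) / N) := by field_simp; ring
  rw [this, h]; ring

lemma abs_gridpoint_le {i N : ℕ} (hN : 2 ≤ N) (hi : i ≤ N) : |-1 + 2 * (i : ℝ) / N| ≤ 1 := by
  have hN' : (2 : ℝ) ≤ N := by exact_mod_cast hN
  have hN0 : (0 : ℝ) < N := by linarith
  have hi' : (i : ℝ) ≤ N := by exact_mod_cast hi
  have h0 : 0 ≤ 2 * (i : ℝ) / N := by positivity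
  have h1 : 2 * (i : ℝ) / N ≤ 2 := by rw [div_le_iff₀ hN0]; linarith
  rw [abs_le]; constructor <;> linarith

lemma IsUpperGraph.zonotope_subset {φ : (Fin 2 → ℝ) → ℝ} (hφ : IsNorm φ) {p q : Fin 2 → ℝ}
    {g : ℝ → ℝ} (h : IsUpperGraph φ p q g) {N : ℕ} (hN : 2 ≤ N) :
    zonotope (graphEdges p q g N) ⊆ unitBall φ := by
  have hN0 : (N : ℝ) ≠ 0 := by positivity
  have key : ∀ (f : (Fin 2 → ℝ) →L[ℝ] ℝ) (u : ℝ), 0 ≤ f q → (∀ x ∈ unitBall φ, f x ≤ u) →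
      ((graphEdges p q g N).map fun θ => |f θ|).sum ≤ u := by
    intro f u hf hu
    set c : ℕ → ℝ := fun i => (-1 + 2 * (i : ℝ) / N) * f p + g (-1 + 2 * (i : ℝ) / N) * f q with hc
    rw [sum_abs_graphEdges p q (h.nonneg _ (by norm_num)) (h.nonneg _ (by norm_num)) N f hf
      (c := c) fun i => rfl]
    have hconc : ∀ i, i + 2 ≤ N → c (i + 2) - c (i + 1) ≤ c (i + 1) - c i := by
      intro i hi
      have h1 := h.concave hφ (abs_gridpoint_le hN (show i ≤ N by omega)) (abs_gridpoint_le hN hi)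
        (a := 1 / 2) (b := 1 / 2) (by norm_num) (by norm_num) (by norm_num)
      have h2 : (1 / 2 : ℝ) * (-1 + 2 * (i : ℝ) / N) + 1 / 2 * (-1 + 2 * ((i + 2 : ℕ) : ℝ) / N)
          = -1 + 2 * ((i + 1 : ℕ) : ℝ) / N := by push_cast; field_simp; ring
      rw [h2] at h1
      have h3 := mul_le_mul_of_nonneg_right h1 hf
      have h4 := congrArg (fun t => t * f p) h2
      simp only [hc] at h4 ⊢
      nlinarith
    obtain ⟨k, hk, hsum⟩ := exists_sum_abs_sub_le_of_concave hconc N le_rfl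
    have hck : c k ≤ u := by
      have := hu _ (h.graph_mem _ (abs_gridpoint_le hN hk))
      simpa [hc] using this
    have hc0 : c 0 = -f p + g (-1) * f q := by simp [hc]
    have hcN : c N = f p + g 1 * f q := by
      simp only [hc]
      rw [show -1 + 2 * (N : ℝ) / N = 1 by field_simp; norm_num]; ring
    linarith
  refine zonotope_subset_of_forall_le (convex_unitBall hφ) (isCompact_unitBall hφ).isClosed ?_
  intro f u hu
  rcases le_total 0 (f q) with hf | hf
  · exact key f u hf hu
  · rw [← sum_abs_neg_apply]
    refine key (-f) u (by simpa using hf) fun x hx => ?_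
    have := hu (-x) (by simpa [unitBall, hφ.map_neg] using hx)
    simpa using this

lemma IsUpperGraph.apply_le {φ : (Fin 2 → ℝ) → ℝ} (hφ : IsNorm φ) {p q : Fin 2 → ℝ}
    {g : ℝ → ℝ} (h : IsUpperGraph φ p q g) {N : ℕ} (hN : 2 ≤ N) (f : (Fin 2 → ℝ) →L[ℝ] ℝ)
    {w : Fin 2 → ℝ} (hw : φ w ≤ 1) :
    (1 - 2 / N) * f w ≤ (1 + 2 / N) * ((graphEdges p q g N).map fun θ => |f θ|).sum := by
  have hN' : (2 : ℝ) ≤ N := by exact_mod_cast hN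
  have hN0 : (N : ℝ) ≠ 0 := by positivity
  have h2N : 2 / (N : ℝ) ≤ 1 := by rw [div_le_iff₀ (by linarith)]; linarith
  have key : ∀ (f : (Fin 2 → ℝ) →L[ℝ] ℝ) (w : Fin 2 → ℝ), 0 ≤ f q → φ w ≤ 1 →
      (1 - 2 / N) * f w ≤ (1 + 2 / N) * ((graphEdges p q g N).map fun θ => |f θ|).sum := by
    intro f w hf hw
    set S := ((graphEdges p q g N).map fun θ => |f θ|).sum with hS
    have hS0 : 0 ≤ S := List.sum_nonneg (by simp)
    obtain ⟨x, y, rfl⟩ := h.exists_coords w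
    have hx := h.abs_le_one x y hw
    have hyg := mul_le_mul_of_nonneg_right (h.le_graph x y hw) hf
    set e : ℝ → ℝ := fun t => t * f p + g t * f q with he
    set c : ℕ → ℝ := fun i => e (-1 + 2 * (i : ℝ) / N) with hc
    have hgm := h.nonneg (-1) (by norm_num)
    have hg1 := h.nonneg 1 (by norm_num)
    have hc0 : c 0 = -f p + g (-1) * f q := by simp [hc, he]
    have hcN : c N = f p + g 1 * f q := by
      simp only [hc, he]
      rw [show -1 + 2 * (N : ℝ) / N = 1 by field_simp; norm_num]; ring
    have hcS : ∀ j ≤ N, c j ≤ S := by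
      intro j hj
      rw [hS, sum_abs_graphEdges p q hgm hg1 N f hf (c := c) fun i => rfl]
      have := le_sum_abs_sub c N j hj
      linarith
    have hconc : ∀ s t t' : ℝ, |t| ≤ 1 → |t'| ≤ 1 → 0 ≤ s → s ≤ 1 →
        (1 - s) * e t + s * e t' ≤ e ((1 - s) * t + s * t') := by
      intro s t t' ht ht' hs hs1
      have h1 := h.concave hφ ht ht' (a := 1 - s) (b := s) (by linarith) hs (by ring)
      have h3 := mul_le_mul_of_nonneg_right h1 hf
      simp only [he]
      nlinarith
    have hm1 : -S ≤ e (-1) := by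
      have := hcS N le_rfl
      have h5 : 0 ≤ g (-1) * f q := by positivity
      have h6 : 0 ≤ g 1 * f q := by positivity
      simp only [he]; linarith
    have h1 : -S ≤ e 1 := by
      have := hcS 0 (by omega)
      have h5 : 0 ≤ g (-1) * f q := by positivity
      have h6 : 0 ≤ g 1 * f q := by positivity
      simp only [he]; linarith
    have main : ∃ s : ℝ, 0 ≤ s ∧ s ≤ 2 / N ∧ (1 - s) * e x ≤ (1 + s) * S := by
      rcases le_total x 0 with hx0 | hx0
      · obtain ⟨i, hi, s, hs, hs', heq⟩ := exists_gridpoint_right (abs_le.1 hx).1 hx0 hN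
        refine ⟨s, hs, hs', ?_⟩
        have h7 := hconc s x 1 hx (by norm_num) hs (by linarith)
        rw [← heq] at h7
        have h8 := hcS i hi
        simp only [hc] at h8
        nlinarith
      · obtain ⟨i, hi, s, hs, hs', heq⟩ := exists_gridpoint_left (abs_le.1 hx).2 hx0 hN
        refine ⟨s, hs, hs', ?_⟩
        have h7 := hconc s x (-1) hx (by norm_num) hs (by linarith)
        rw [← heq] at h7
        have h8 := hcS i hi
        simp only [hc] at h8
        nlinarith
    have hfw : f (x • p + y • q) ≤ e x := by simp [he]; linarith
    obtain ⟨s, hs, hs', hmain⟩ := main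
    rcases le_total (f (x • p + y • q)) 0 with hneg | hpos
    · have : 0 ≤ (1 + 2 / (N : ℝ)) * S := by positivity
      nlinarith
    · nlinarith
  rcases le_total 0 (f q) with hf | hf
  · exact key f w hf hw
  · have := key (-f) (-w) (by simpa using hf) (by rwa [hφ.map_neg])
    rw [sum_abs_neg_apply] at this
    simpa using this

/-- The unit ball of a planar norm is approximated from inside by zonotopes. -/
lemma exists_zonotope_approx {φ : (Fin 2 → ℝ) → ℝ} (hφ : IsNorm φ) {ε : ℝ} (hε : 0 < ε) :
    ∃ l, zonotope l ⊆ unitBall φ ∧ unitBall φ ⊆ (1 + ε) • zonotope l := by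
  obtain ⟨p, q, g, h⟩ := exists_isUpperGraph hφ
  obtain ⟨N, hN⟩ := exists_nat_gt (max 3 (2 * (2 + ε) / ε))
  have hN3 : (3 : ℝ) < N := lt_of_le_of_lt (le_max_left _ _) hN
  have hNε := lt_of_le_of_lt (le_max_right _ _) hN
  have hN2 : 2 ≤ N := by
    have : (2 : ℝ) ≤ N := by linarith
    exact_mod_cast this
  refine ⟨graphEdges p q g N, h.zonotope_subset hφ hN2, fun w hw => ?_⟩
  rw [mem_smul_set_iff_inv_smul_mem₀ (by positivity)]
  refine mem_zonotope_of_forall_le fun f => ?_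
  have h1 := h.apply_le hφ hN2 f hw
  set S := ((graphEdges p q g N).map fun θ => |f θ|).sum with hS
  have hS0 : 0 ≤ S := List.sum_nonneg (by simp)
  rw [map_smul, smul_eq_mul, inv_mul_le_iff₀ (by positivity)]
  have h2 : 2 / (N : ℝ) < 1 := by rw [div_lt_iff₀ (by linarith)]; linarith
  have h3 : 1 + 2 / (N : ℝ) ≤ (1 + ε) * (1 - 2 / N) := by
    rw [div_lt_iff₀ hε] at hNε
    have : 2 / (N : ℝ) * (2 + ε) ≤ ε := by
      rw [div_mul_eq_mul_div, div_le_iff₀ (by linarith)]; linarith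
    nlinarith
  have h4 := mul_le_mul_of_nonneg_right h3 hS0
  have h5 : 0 < 1 - 2 / (N : ℝ) := by linarith
  nlinarith

end ZonotopeApproximation

section Steiner
open scoped Pointwise Topology

variable {φ : (Fin 2 → ℝ) → ℝ}

lemma steiner_squeeze (hφ : IsNorm φ) {C : Set (Fin 2 → ℝ)} (hC : IsCompact C)
    (hc : Convex ℝ C) (hn : C.Nonempty) {ε : ℝ} (hε : 0 < ε) (hε1 : ε ≤ 1) :
    ∃ P : ℝ, 0 ≤ P ∧ ∀ s : ℝ, 0 ≤ s →
      s * P - s ^ 2 * (3 * ε * volume.real (unitBall φ)) ≤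
        volume.real (C + s • unitBall φ) - volume.real C - s ^ 2 * volume.real (unitBall φ) ∧
      volume.real (C + s • unitBall φ) - volume.real C - s ^ 2 * volume.real (unitBall φ) ≤
        s * ((1 + ε) * P) + s ^ 2 * (3 * ε * volume.real (unitBall φ)) := by
  obtain ⟨l, hl1, hl2⟩ := exists_zonotope_approx hφ hε
  set w := volume.real (unitBall φ) with hw
  set z := volume.real (zonotope l) with hz
  have hz0 : 0 ≤ z := measureReal_nonneg
  have hzw : z ≤ w := measureReal_mono hl1 (isCompact_unitBall hφ).measure_lt_top.ne
  have hwz : w ≤ (1 + ε) ^ 2 * z := by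
    rw [hz, ← volume_smul_real]
    exact measureReal_mono hl2 ((isCompact_zonotope l).smul _).measure_lt_top.ne
  have hε3 : (1 + ε) ^ 2 * z ≤ z + 3 * ε * w := by nlinarith [mul_nonneg hε.le hz0]
  refine ⟨zonoPerim l C, zonoPerim_nonneg l C, fun s hs => ?_⟩
  have h1 : volume.real (C + s • zonotope l) ≤ volume.real (C + s • unitBall φ) :=
    measureReal_mono (add_subset_add_left (smul_set_mono hl1))
      (hC.add (isCompact_smul_unitBall hφ s)).measure_lt_top.ne
  have h2 : volume.real (C + s • unitBall φ) ≤ volume.real (C + (s * (1 + ε)) • zonotope l) := by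
    refine measureReal_mono (add_subset_add_left ?_)
      (hC.add ((isCompact_zonotope l).smul _)).measure_lt_top.ne
    rw [mul_smul]
    exact smul_set_mono hl2
  rw [volume_add_smul_zonotope hC hc hn hs] at h1
  rw [volume_add_smul_zonotope hC hc hn (by positivity)] at h2
  have hs2 : 0 ≤ s ^ 2 := sq_nonneg s
  have h3 := mul_le_mul_of_nonneg_left (show w - z ≤ 3 * ε * w by linarith) hs2
  have h4 := mul_le_mul_of_nonneg_left (show (1 + ε) ^ 2 * z - w ≤ 3 * ε * w by linarith) hs2
  constructor
  · linarith
  · linarith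

/-- Steiner's formula for a convex body and the unit ball of a planar norm. -/
lemma exists_steiner (hφ : IsNorm φ) {C : Set (Fin 2 → ℝ)} (hC : IsCompact C)
    (hc : Convex ℝ C) (hn : C.Nonempty) :
    ∃ b : ℝ, ∀ s : ℝ, 0 ≤ s → volume.real (C + s • unitBall φ) =
      volume.real C + b * s + volume.real (unitBall φ) * s ^ 2 := by
  set w := volume.real (unitBall φ) with hw
  have hw0 : 0 ≤ w := measureReal_nonneg
  set b := volume.real (C + (1 : ℝ) • unitBall φ) - volume.real C - (1 : ℝ) ^ 2 * w with hb
  refine ⟨b, fun s hs => ?_⟩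
  set V := volume.real (C + s • unitBall φ)
  have key : ∀ ε : ℝ, 0 < ε → ε ≤ 1 →
      |V - volume.real C - s ^ 2 * w - s * b| ≤ ε * (s * (b + 3 * w) + 3 * s * w + 3 * s ^ 2 * w) := by
    intro ε hε hε1
    obtain ⟨P, hP, h⟩ := steiner_squeeze hφ hC hc hn hε hε1
    have hs1 := h s hs
    have h11 := h 1 zero_le_one
    rw [← hw] at hs1 h11
    rw [← hb] at h11
    have hPb : P ≤ b + 3 * w := by nlinarith [mul_le_mul_of_nonneg_right hε1 hw0]
    have h5 := mul_le_mul_of_nonneg_left h11.1 hs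
    have h6 := mul_le_mul_of_nonneg_left h11.2 hs
    have h7 := mul_le_mul_of_nonneg_left hPb (mul_nonneg hε.le hs)
    rw [abs_le]
    constructor <;> nlinarith [hs1.1, hs1.2]
  set M := s * (b + 3 * w) + 3 * s * w + 3 * s ^ 2 * w
  have hlim : Tendsto (fun ε : ℝ => ε * M) (𝓝[>] 0) (𝓝 (0 * M)) :=
    (tendsto_id.mul_const M).mono_left nhdsWithin_le_nhds
  have hle : |V - volume.real C - s ^ 2 * w - s * b| ≤ 0 * M := by
    refine ge_of_tendsto hlim ?_
    filter_upwards [Ioc_mem_nhdsGT (zero_lt_one' ℝ)] with ε hε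
    exact key ε hε.1 hε.2
  rw [zero_mul] at hle
  have := abs_eq_zero.1 (le_antisymm hle (abs_nonneg _))
  linarith

end Steiner

section PerimeterUpperBound
open scoped Pointwise Topology

variable {φ : (Fin 2 → ℝ) → ℝ}

lemma det_id_add_smul (A : (Fin 2 → ℝ) →L[ℝ] (Fin 2 → ℝ)) (t : ℝ) :
    (ContinuousLinearMap.id ℝ (Fin 2 → ℝ) + t • A).det =
      1 + t * (∑ i, A (Pi.single i 1) i) + t ^ 2 * A.det := by
  have h : ∀ B : (Fin 2 → ℝ) →L[ℝ] (Fin 2 → ℝ), B.det =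
      B (Pi.single 0 1) 0 * B (Pi.single 1 1) 1 - B (Pi.single 1 1) 0 * B (Pi.single 0 1) 1 := by
    intro B
    rw [ContinuousLinearMap.det, ← LinearMap.det_toMatrix', Matrix.det_fin_two]
    simp [LinearMap.toMatrix'_apply]
  rw [h, h, Fin.sum_univ_two]
  simp
  ring

lemma volume_add_openBallOf (hφ : IsNorm φ) {C : Set (Fin 2 → ℝ)} (hC : IsCompact C)
    {b r : ℝ} (hr : 0 < r) (hb : ∀ s : ℝ, 0 ≤ s → volume.real (C + s • unitBall φ) =
      volume.real C + b * s + volume.real (unitBall φ) * s ^ 2) :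
    volume.real (C + openBallOf φ r) =
      volume.real C + b * r + volume.real (unitBall φ) * r ^ 2 := by
  have hsub : C + openBallOf φ r ⊆ C + r • unitBall φ :=
    add_subset_add_left fun x hx => (mem_smul_unitBall hφ hr.le).2 (le_of_lt hx)
  have hfin : volume (C + r • unitBall φ) ≠ ∞ :=
    (hC.add (isCompact_smul_unitBall hφ r)).measure_lt_top.ne
  apply le_antisymm
  · rw [← hb r hr.le]
    exact measureReal_mono hsub hfin
  · have hlim : Tendsto (fun s : ℝ => volume.real C + b * s + volume.real (unitBall φ) * s ^ 2)
        (𝓝[<] r) (𝓝 (volume.real C + b * r + volume.real (unitBall φ) * r ^ 2)) := by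
      refine (Continuous.tendsto ?_ r).mono_left nhdsWithin_le_nhds
      fun_prop
    refine le_of_tendsto hlim ?_
    filter_upwards [Ioo_mem_nhdsLT hr] with s hs
    rw [← hb s hs.1.le]
    refine measureReal_mono (add_subset_add_left fun x hx => ?_)
      ((measure_mono hsub).trans_lt hfin.lt_top).ne
    exact lt_of_le_of_lt ((mem_smul_unitBall hφ hs.1.le).1 hx) hs.2

lemma volume_perturbation_le (hφ : IsNorm φ) {C : Set (Fin 2 → ℝ)} (hC : IsCompact C) {r : ℝ}
    (hr : 0 < r) {η : (Fin 2 → ℝ) → (Fin 2 → ℝ)} (hη : ContDiff ℝ 1 η)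
    (hη1 : ∀ x, φ (η x) ≤ 1) {t : ℝ} (ht : 0 ≤ t) {L : NNReal} (hL : LipschitzWith L η)
    (htL : t * L < 1) :
    ∫ x in C + openBallOf φ r, (1 + t * diverg η x + t ^ 2 * (fderiv ℝ η x).det) ≤
      volume.real (C + (r + t) • unitBall φ) := by
  have hEo : IsOpen (C + openBallOf φ r) := (isOpen_openBallOf hφ r).add_left
  set E := C + openBallOf φ r with hE
  have hF : IsCompact (C + (r + t) • unitBall φ) := hC.add (isCompact_smul_unitBall hφ _)
  have himg : (fun x => x + t • η x) '' E ⊆ C + (r + t) • unitBall φ := by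
    rintro _ ⟨_, ⟨c, hc, v, hv, rfl⟩, rfl⟩
    refine ⟨c, hc, v + t • η (c + v), ?_, by simp [add_assoc]⟩
    rw [mem_smul_unitBall hφ (by positivity)]
    refine (hφ.add_le _ _).trans (add_le_add (le_of_lt hv) ?_)
    rw [hφ.map_smul_nonneg ht]
    exact mul_le_of_le_one_right ht (hη1 _)
  have hinj : InjOn (fun x => x + t • η x) E := by
    intro x _ y _ hxy
    have h1 : x - y = t • (η y - η x) := by
      have : x + t • η x = y + t • η y := hxy
      rw [smul_sub, sub_eq_sub_iff_add_eq_add, this, add_comm]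
    by_contra hne
    have hpos : 0 < ‖x - y‖ := norm_pos_iff.2 (sub_ne_zero.2 hne)
    have h2 : ‖x - y‖ ≤ t * (L * ‖x - y‖) := by
      nth_rewrite 1 [h1]
      rw [norm_smul, Real.norm_of_nonneg ht, norm_sub_rev]
      gcongr
      simpa [dist_eq_norm] using hL.dist_le_mul x y
    nlinarith
  have hder : ∀ x ∈ E, HasFDerivWithinAt (fun x => x + t • η x)
      (ContinuousLinearMap.id ℝ (Fin 2 → ℝ) + t • fderiv ℝ η x) E x := fun x _ =>
    ((hasFDerivAt_id x).add
      ((hη.differentiable one_ne_zero x).hasFDerivAt.const_smul t)).hasFDerivWithinAt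
  have hcv := integral_image_eq_integral_abs_det_fderiv_smul volume hEo.measurableSet hder hinj
    (fun _ => (1 : ℝ))
  have hcont : Continuous fun x => fderiv ℝ η x := hη.continuous_fderiv one_ne_zero
  have hdet : Continuous fun x => (ContinuousLinearMap.id ℝ (Fin 2 → ℝ) + t • fderiv ℝ η x).det :=
    ContinuousLinearMap.continuous_det.comp (by fun_prop)
  have hEsub : E ⊆ C + (r + t) • unitBall φ := by
    refine add_subset_add_left fun v hv => (mem_smul_unitBall hφ (by positivity)).2 ?_
    have : φ v < r := hv
    linarith
  have hint : ∀ f : (Fin 2 → ℝ) → ℝ, Continuous f → IntegrableOn f E volume := fun f hf =>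
    (hf.continuousOn.integrableOn_compact hF).mono_set hEsub
  calc ∫ x in E, (1 + t * diverg η x + t ^ 2 * (fderiv ℝ η x).det)
      = ∫ x in E, (ContinuousLinearMap.id ℝ (Fin 2 → ℝ) + t • fderiv ℝ η x).det := by
        simp only [det_id_add_smul, diverg]
    _ ≤ ∫ x in E, |(ContinuousLinearMap.id ℝ (Fin 2 → ℝ) + t • fderiv ℝ η x).det| :=
        integral_mono (hint _ hdet) (hint _ hdet.abs) fun x => le_abs_self _
    _ = volume.real ((fun x => x + t • η x) '' E) := by
        simpa using hcv.symm
    _ ≤ _ := measureReal_mono himg hF.measure_lt_top.ne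

lemma continuous_diverg {η : (Fin 2 → ℝ) → (Fin 2 → ℝ)} (hη : ContDiff ℝ 1 η) :
    Continuous (diverg η) := by
  have hcont : Continuous fun x => fderiv ℝ η x := hη.continuous_fderiv one_ne_zero
  unfold diverg
  fun_prop

lemma setIntegral_diverg_le (hφ : IsNorm φ) {C : Set (Fin 2 → ℝ)} (hC : IsCompact C)
    {b r : ℝ} (hr : 0 < r) (hb : ∀ s : ℝ, 0 ≤ s → volume.real (C + s • unitBall φ) =
      volume.real C + b * s + volume.real (unitBall φ) * s ^ 2)
    {η : (Fin 2 → ℝ) → (Fin 2 → ℝ)} (hη : ContDiff ℝ 1 η) (hηc : HasCompactSupport η)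
    (hη1 : ∀ x, φ (η x) ≤ 1) :
    ∫ x in C + openBallOf φ r, diverg η x ≤ b + 2 * r * volume.real (unitBall φ) := by
  obtain ⟨L, hL⟩ := hη.lipschitzWith_of_hasCompactSupport hηc one_ne_zero
  have hcont : Continuous fun x => fderiv ℝ η x := hη.continuous_fderiv one_ne_zero
  have hdet : Continuous fun x => (fderiv ℝ η x).det :=
    ContinuousLinearMap.continuous_det.comp hcont
  have hvol := volume_add_openBallOf hφ hC hr hb
  set E := C + openBallOf φ r with hE
  set w := volume.real (unitBall φ)
  have hF : IsCompact (C + r • unitBall φ) := hC.add (isCompact_smul_unitBall hφ _)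
  have hEsub : E ⊆ C + r • unitBall φ :=
    add_subset_add_left fun v hv => (mem_smul_unitBall hφ hr.le).2 (le_of_lt hv)
  have hint : ∀ f : (Fin 2 → ℝ) → ℝ, Continuous f → IntegrableOn f E volume := fun f hf =>
    (hf.continuousOn.integrableOn_compact hF).mono_set hEsub
  set D := ∫ x in E, (fderiv ℝ η x).det
  have key : ∀ t : ℝ, 0 < t → t * L < 1 →
      ∫ x in E, diverg η x ≤ b + 2 * r * w + t * (w - D) := by
    intro t ht htL
    have h1 := volume_perturbation_le hφ hC hr hη hη1 ht.le hL htL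
    have h0 : ∫ x in E, (1 + t * diverg η x + t ^ 2 * (fderiv ℝ η x).det) =
        volume.real E + t * (∫ x in E, diverg η x) + t ^ 2 * D := by
      have e1 : Continuous fun x => t * diverg η x := (continuous_diverg hη).const_mul t
      have e2 : Continuous fun x => t ^ 2 * (fderiv ℝ η x).det := hdet.const_mul _
      rw [integral_add (hint (fun x => 1 + t * diverg η x) (continuous_const.add e1)) (hint _ e2),
        integral_add (hint _ continuous_const) (hint _ e1), integral_const_mul, integral_const_mul]
      simp
      exact Or.inl rfl
    rw [← hE, h0, hvol, hb _ (by positivity)] at h1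
    have h2 : t * (∫ x in E, diverg η x) ≤ t * (b + 2 * r * w + t * (w - D)) := by
      nlinarith
    exact le_of_mul_le_mul_left h2 ht
  have hlim : Tendsto (fun t : ℝ => b + 2 * r * w + t * (w - D)) (𝓝[>] 0)
      (𝓝 (b + 2 * r * w + 0 * (w - D))) := by
    refine (Continuous.tendsto ?_ 0).mono_left nhdsWithin_le_nhds
    fun_prop
  rw [zero_mul, add_zero] at hlim
  refine ge_of_tendsto hlim ?_
  have hpos : (0 : ℝ) < 1 / (L + 1) := by positivity
  filter_upwards [Ioo_mem_nhdsGT hpos] with t ht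
  refine key t ht.1 ?_
  have h3 := ht.2
  rw [lt_div_iff₀ (by positivity)] at h3
  nlinarith [ht.1]

lemma anisoPerimeter_add_openBallOf_le (hφ : IsNorm φ) {C : Set (Fin 2 → ℝ)} (hC : IsCompact C)
    {b r : ℝ} (hr : 0 < r) (hb : ∀ s : ℝ, 0 ≤ s → volume.real (C + s • unitBall φ) =
      volume.real C + b * s + volume.real (unitBall φ) * s ^ 2) :
    anisoPerimeter φ (C + openBallOf φ r) ≤
      ENNReal.ofReal (b + 2 * r * volume.real (unitBall φ)) := by
  have hEo : IsOpen (C + openBallOf φ r) := (isOpen_openBallOf hφ r).add_left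
  refine iSup₂_le fun η hη => ENNReal.ofReal_le_ofReal ?_
  refine le_trans (le_of_eq ?_) (setIntegral_diverg_le hφ hC hr hb hη.1 hη.2.1 hη.2.2)
  rw [← integral_indicator hEo.measurableSet]
  congr 1
  ext x
  by_cases hx : x ∈ C + openBallOf φ r <;> simp [hx]

end PerimeterUpperBound

section Mollification
open scoped Pointwise Topology Convolution

/-- The convolution of `f` with the mollifier `ρ`. -/
def moll (ρ f : (Fin 2 → ℝ) → ℝ) (x : Fin 2 → ℝ) : ℝ := ∫ t, ρ (x - t) * f t

lemma moll_eq_convolution (ρ f : (Fin 2 → ℝ) → ℝ) :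
    moll ρ f = ρ ⋆[ContinuousLinearMap.lsmul ℝ ℝ, volume] f := by
  ext x
  rw [convolution_eq_swap]
  simp [moll]

variable {ρ : (Fin 2 → ℝ) → ℝ}

lemma contDiff_moll (hρ : ContDiff ℝ 1 ρ) (hρc : HasCompactSupport ρ)
    {f : (Fin 2 → ℝ) → ℝ} (hf : Integrable f) : ContDiff ℝ 1 (moll ρ f) := by
  rw [moll_eq_convolution]
  exact_mod_cast hρc.contDiff_convolution_left (n := 1) _ (by exact_mod_cast hρ)
    hf.locallyIntegrable

lemma hasCompactSupport_moll {f : (Fin 2 → ℝ) → ℝ} (hρc : HasCompactSupport ρ)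
    (hfc : HasCompactSupport f) : HasCompactSupport (moll ρ f) := by
  rw [moll_eq_convolution]
  exact hρc.convolution _ hfc

lemma fderiv_moll (hρ : ContDiff ℝ 1 ρ) (hρc : HasCompactSupport ρ)
    {f : (Fin 2 → ℝ) → ℝ} (hf : Integrable f) (x θ : Fin 2 → ℝ) :
    fderiv ℝ (moll ρ f) x θ = ∫ t, fderiv ℝ ρ (x - t) θ * f t := by
  rw [moll_eq_convolution,
    (hρc.hasFDerivAt_convolution_left _ hρ hf.locallyIntegrable x).fderiv, convolution_eq_swap]
  have hint := (hρc.fderiv (𝕜 := ℝ)).convolutionExists_left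
    (ContinuousLinearMap.precompL (Fin 2 → ℝ) (ContinuousLinearMap.lsmul ℝ ℝ))
    (hρ.continuous_fderiv one_ne_zero) hf.locallyIntegrable x
  have hint2 := (convolutionExistsAt_iff_integrable_swap).1 hint
  rw [ContinuousLinearMap.integral_apply hint2]
  simp [ContinuousLinearMap.precompL_apply]

lemma fderiv_neg_of_even (hρ : ContDiff ℝ 1 ρ)
    (hρe : ∀ x, ρ (-x) = ρ x) (x θ : Fin 2 → ℝ) :
    fderiv ℝ ρ (-x) θ = - fderiv ℝ ρ x θ := by
  have h1 : HasFDerivAt ρ (fderiv ℝ ρ (-x)) (-x) :=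
    (hρ.differentiable one_ne_zero _).hasFDerivAt
  have h2 := h1.comp x (hasFDerivAt_id x).neg
  have h3 : (ρ ∘ fun x => -id x) = ρ := by ext y; simp [hρe]
  have h4 : fderiv ℝ ρ x = _ := (h3 ▸ h2 : HasFDerivAt ρ _ x).fderiv
  rw [h4]; simp

lemma integral_mul_fderiv_moll (hρ : ContDiff ℝ 1 ρ) (hρc : HasCompactSupport ρ)
    (hρe : ∀ x, ρ (-x) = ρ x) {f a : (Fin 2 → ℝ) → ℝ}
    (hf : Integrable f) (ha : Integrable a) (θ : Fin 2 → ℝ) :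
    ∫ x, f x * fderiv ℝ (moll ρ a) x θ = - ∫ x, a x * fderiv ℝ (moll ρ f) x θ := by
  simp_rw [fderiv_moll hρ hρc hf, fderiv_moll hρ hρc ha, ← integral_const_mul]
  have hc : Continuous fun x => fderiv ℝ ρ x θ :=
    (hρ.continuous_fderiv one_ne_zero).clm_apply continuous_const
  obtain ⟨C, hC⟩ := (hρc.fderiv (𝕜 := ℝ)).exists_bound_of_continuous
    (hρ.continuous_fderiv one_ne_zero)
  rw [integral_integral_swap, ← integral_neg]
  · congr 1; ext t
    rw [← integral_neg]
    congr 1; ext x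
    have := fderiv_neg_of_even hρ hρe (t - x) θ
    rw [neg_sub] at this
    rw [this]; ring
  · have h1 := (hf.mul_prod ha).bdd_mul
      (f := fun p : (Fin 2 → ℝ) × (Fin 2 → ℝ) => fderiv ℝ ρ (p.1 - p.2) θ) (c := C * ‖θ‖)
      (hc.comp (continuous_fst.sub continuous_snd)).aestronglyMeasurable
      (Eventually.of_forall fun p => ((fderiv ℝ ρ (p.1 - p.2)).le_opNorm θ).trans
        (mul_le_mul_of_nonneg_right (hC _) (norm_nonneg _)))
    refine h1.congr (Eventually.of_forall fun p => ?_)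
    simp only [Function.uncurry]; ring

lemma abs_moll_le_one (hρ0 : ∀ x, 0 ≤ ρ x) (hρi : ∫ x, ρ x = 1)
    {a : (Fin 2 → ℝ) → ℝ} (ha1 : ∀ x, |a x| ≤ 1) (x : Fin 2 → ℝ) : |moll ρ a x| ≤ 1 := by
  have hint : Integrable ρ := by
    by_contra h
    rw [integral_undef h] at hρi
    exact zero_ne_one hρi
  rw [moll, ← Real.norm_eq_abs]
  refine (norm_integral_le_of_norm_le (hint.comp_sub_left x)
    (Eventually.of_forall fun t => ?_)).trans ?_
  · rw [norm_mul, Real.norm_eq_abs, Real.norm_eq_abs, abs_of_nonneg (hρ0 _)]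
    exact mul_le_of_le_one_right (hρ0 _) (ha1 t)
  · rw [integral_sub_left_eq_self, hρi]

end Mollification

section MollifiedGradient
open scoped Pointwise Topology

def gradSum (l : List (Fin 2 → ℝ)) (u : (Fin 2 → ℝ) → ℝ) (x : Fin 2 → ℝ) : ℝ≥0∞ :=
  (l.map fun θ => ‖fderiv ℝ u x θ‖ₑ).sum

lemma diverg_smul_const {g : (Fin 2 → ℝ) → ℝ} (hg : ContDiff ℝ 1 g) (θ x : Fin 2 → ℝ) :
    diverg (fun y => g y • θ) x = fderiv ℝ g x θ := by
  have hd : HasFDerivAt (fun y => g y • θ) ((fderiv ℝ g x).smulRight θ) x :=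
    (hg.differentiable one_ne_zero x).hasFDerivAt.smul_const θ
  rw [diverg, hd.fderiv]
  conv_rhs => rw [← Finset.univ_sum_single θ]
  rw [map_sum]
  refine Finset.sum_congr rfl fun i _ => ?_
  have : (Pi.single i (θ i) : Fin 2 → ℝ) = θ i • Pi.single i (1 : ℝ) := by
    rw [← Pi.single_smul]; simp
  rw [this, map_smul]
  simp [mul_comm]

lemma exists_field_integral_eq {ρ : (Fin 2 → ℝ) → ℝ} (hρ : ContDiff ℝ 1 ρ)
    (hρc : HasCompactSupport ρ) (hρe : ∀ x, ρ (-x) = ρ x) (hρ0 : ∀ x, 0 ≤ ρ x)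
    (hρi : ∫ x, ρ x = 1) {f : (Fin 2 → ℝ) → ℝ} (hf : Integrable f) (hfc : HasCompactSupport f)
    (l : List (Fin 2 → ℝ)) :
    ∃ η : (Fin 2 → ℝ) → (Fin 2 → ℝ), ContDiff ℝ 1 η ∧ HasCompactSupport η ∧
      (∀ x, η x ∈ zonotope l) ∧ 0 ≤ ∫ x, f x * diverg η x ∧
      ∫⁻ x, gradSum l (moll ρ f) x = ENNReal.ofReal (∫ x, f x * diverg η x) := by
  induction l with
  | nil =>
    refine ⟨0, contDiff_const, HasCompactSupport.zero, fun x => zero_mem_zonotope _, ?_, ?_⟩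
    · simp [diverg]
    · simp [diverg, gradSum]
  | cons θ l ih =>
    obtain ⟨η, hη, hηc, hηz, hη0, hηi⟩ := ih
    set u := moll ρ f with hu
    have huC : ContDiff ℝ 1 u := contDiff_moll hρ hρc hf
    have huc : HasCompactSupport u := hasCompactSupport_moll hρc hfc
    set D : (Fin 2 → ℝ) → ℝ := fun x => fderiv ℝ u x θ with hD
    have hDc : Continuous D := (huC.continuous_fderiv one_ne_zero).clm_apply continuous_const
    have hDs : HasCompactSupport D := huc.fderiv_apply (𝕜 := ℝ) θ
    have hDi : Integrable D := hDc.integrable_of_hasCompactSupport hDs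
    set a : (Fin 2 → ℝ) → ℝ := fun x => D x * |D x|⁻¹ with ha
    have ham : Measurable a := hDc.measurable.mul hDc.abs.measurable.inv
    have ha1 : ∀ x, |a x| ≤ 1 := fun x => by
      rw [ha]; simp only [abs_mul, abs_inv, abs_abs]
      rw [← div_eq_mul_inv]; exact div_self_le_one _
    have hac : HasCompactSupport a := hDs.mul_right
    have hai : Integrable a := by
      refine IntegrableOn.integrable_of_forall_notMem_eq_zero (s := tsupport a) ?_
        fun x hx => image_eq_zero_of_notMem_tsupport hx
      exact Measure.integrableOn_of_bounded (M := 1) hac.isCompact.measure_lt_top.ne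
        ham.aestronglyMeasurable (Eventually.of_forall fun x => by simpa using ha1 x)
    have haD : ∀ x, a x * D x = ‖D x‖ := fun x => by
      by_cases h : D x = 0
      · simp [ha, h]
      · have : |D x| ≠ 0 := abs_ne_zero.2 h
        simp only [ha, Real.norm_eq_abs]
        field_simp
        exact (sq_abs _).symm
    set g := moll ρ a with hg
    have hgC : ContDiff ℝ 1 g := contDiff_moll hρ hρc hai
    have hgc : HasCompactSupport g := hasCompactSupport_moll hρc hac
    have hswap := integral_mul_fderiv_moll hρ hρc hρe hf hai θ
    have hη'C : ContDiff ℝ 1 fun x => (-g x) • θ := hgC.neg.smul contDiff_const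
    have hdiv : ∀ x, diverg (fun x => (-g x) • θ + η x) x =
        - fderiv ℝ g x θ + diverg η x := fun x => by
      have h1 : fderiv ℝ (fun x => (-g x) • θ + η x) x =
          fderiv ℝ (fun x => (-g x) • θ) x + fderiv ℝ η x :=
        fderiv_fun_add (hη'C.differentiable one_ne_zero x) (hη.differentiable one_ne_zero x)
      have h2 := diverg_smul_const hgC.neg θ x
      have h3 : fderiv ℝ (fun y => -g y) x = -fderiv ℝ g x := fderiv_fun_neg
      rw [h3] at h2
      rw [diverg] at h2 ⊢
      simp only [h1, _root_.add_apply, Pi.add_apply, Finset.sum_add_distrib]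
      rw [h2]; rfl
    have hi1 : Integrable fun x => f x * fderiv ℝ g x θ := by
      obtain ⟨C, hC⟩ := (hgc.fderiv_apply (𝕜 := ℝ) θ).exists_bound_of_continuous
        ((hgC.continuous_fderiv one_ne_zero).clm_apply continuous_const)
      exact hf.mul_bdd (c := C) (((hgC.continuous_fderiv one_ne_zero).clm_apply
        continuous_const).aestronglyMeasurable) (Eventually.of_forall hC)
    have hi2 : Integrable fun x => f x * diverg η x := by
      have hdc : HasCompactSupport (diverg η) := by
        refine hηc.fderiv (𝕜 := ℝ) |>.mono' ?_
        refine subset_closure.trans' fun x hx => ?_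
        contrapose! hx
        rw [Function.notMem_support] at hx
        simp [diverg, hx]
      obtain ⟨C, hC⟩ := hdc.exists_bound_of_continuous (continuous_diverg hη)
      exact hf.mul_bdd (c := C) (continuous_diverg hη).aestronglyMeasurable (Eventually.of_forall hC)
    have hkey : ∫ x, f x * diverg (fun x => (-g x) • θ + η x) x =
        (∫ x, ‖D x‖) + ∫ x, f x * diverg η x := by
      simp_rw [hdiv, mul_add, mul_neg]
      have hi3 : Integrable fun x => -(f x * fderiv ℝ g x θ) := hi1.neg
      rw [integral_add hi3 hi2, integral_neg, hswap, neg_neg]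
      congr 1
      exact integral_congr_ae (Eventually.of_forall haD)
    have hpos : 0 ≤ ∫ x, ‖D x‖ := integral_nonneg fun _ => norm_nonneg _
    refine ⟨fun x => (-g x) • θ + η x, hη'C.add hη, (hgc.neg.smul_right).add hηc, fun x => ?_, ?_, ?_⟩
    · have h1 := abs_le.1 (abs_moll_le_one hρ0 hρi ha1 x)
      exact ⟨η x, hηz x, (-g x) • θ, ⟨-g x, ⟨by linarith [h1.2], by linarith [h1.1]⟩, rfl⟩,
        add_comm _ _⟩
    · rw [hkey]; positivity
    · rw [hkey, ENNReal.ofReal_add hpos hη0, ← hηi, ofReal_integral_norm_eq_lintegral_enorm hDi]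
      simp only [gradSum, List.map_cons, List.sum_cons]
      rw [lintegral_add_left hDc.measurable.enorm]

lemma lintegral_gradSum_moll_le {φ : (Fin 2 → ℝ) → ℝ} {l : List (Fin 2 → ℝ)}
    (hl : zonotope l ⊆ unitBall φ) {ρ : (Fin 2 → ℝ) → ℝ} (hρ : ContDiff ℝ 1 ρ)
    (hρc : HasCompactSupport ρ) (hρe : ∀ x, ρ (-x) = ρ x) (hρ0 : ∀ x, 0 ≤ ρ x)
    (hρi : ∫ x, ρ x = 1) {F : Set (Fin 2 → ℝ)} (hF : MeasurableSet F)
    (hFb : Bornology.IsBounded F) :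
    ∫⁻ x, gradSum l (moll ρ (F.indicator 1)) x ≤ anisoPerimeter φ F := by
  have hfi : Integrable (F.indicator (1 : (Fin 2 → ℝ) → ℝ)) :=
    (integrable_indicator_iff hF).2 (integrableOn_const hFb.measure_lt_top.ne)
  have hfc : HasCompactSupport (F.indicator (1 : (Fin 2 → ℝ) → ℝ)) :=
    HasCompactSupport.intro hFb.isCompact_closure fun x hx =>
      indicator_of_notMem (fun h => hx (subset_closure h)) _
  obtain ⟨η, hη, hηc, hηz, -, hηi⟩ :=
    exists_field_integral_eq hρ hρc hρe hρ0 hρi hfi hfc l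
  rw [hηi]
  exact le_iSup₂_of_le η ⟨hη, hηc, fun x => hl (hηz x)⟩ le_rfl

end MollifiedGradient

section LevelSets
open scoped Pointwise Topology

lemma exists_crossing {v : ℝ → ℝ} (hv : Continuous v) {τ τ' a b : ℝ} (hτ : τ < τ') (hab : a ≤ b)
    (ha : τ' < v a) (hb : v b ≤ τ) :
    ∃ p q, a ≤ p ∧ p < q ∧ τ' ≤ v p ∧ v q ≤ τ ∧ (∀ s ∈ Ico a q, τ < v s) ∧
      ∀ s ∈ Ioo p q, v s ≤ τ' := by
  have hc1 : IsCompact (Icc a b ∩ {s | v s ≤ τ}) :=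
    isCompact_Icc.inter_right (isClosed_le hv continuous_const)
  obtain ⟨q, ⟨⟨hq1, hq2⟩, hq3⟩, hq4⟩ := hc1.exists_isLeast ⟨b, ⟨hab, le_rfl⟩, hb⟩
  have hc2 : IsCompact (Icc a q ∩ {s | τ' ≤ v s}) :=
    isCompact_Icc.inter_right (isClosed_le continuous_const hv)
  obtain ⟨p, ⟨⟨hp1, hp2⟩, hp3⟩, hp4⟩ := hc2.exists_isGreatest ⟨a, ⟨le_rfl, hq1⟩, ha.le⟩
  simp only [Set.mem_ofPred_eq] at hq3 hp3
  refine ⟨p, q, hp1, lt_of_le_of_ne hp2 ?_, hp3, hq3, fun s hs => ?_, fun s hs => ?_⟩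
  · rintro rfl; linarith
  · by_contra! h
    exact absurd (hq4 ⟨⟨hs.1, hs.2.le.trans hq2⟩, h⟩) (not_le.2 hs.2)
  · by_contra! h
    exact absurd (hp4 ⟨⟨hp1.trans hs.1.le, hs.2.le⟩, h.le⟩) (not_le.2 hs.1)

lemma exists_crossing_left {v : ℝ → ℝ} (hv : Continuous v) {τ τ' a b : ℝ} (hτ : τ < τ')
    (hab : b ≤ a) (ha : τ' < v a) (hb : v b ≤ τ) :
    ∃ p q, p ≤ a ∧ q < p ∧ τ' ≤ v p ∧ v q ≤ τ ∧ (∀ s ∈ Ioc q a, τ < v s) ∧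
      ∀ s ∈ Ioo q p, v s ≤ τ' := by
  obtain ⟨p, q, h1, h2, h3, h4, h5, h6⟩ := exists_crossing (v := fun s => v (-s))
    (hv.comp continuous_neg) hτ (neg_le_neg hab) (by simpa using ha) (by simpa using hb)
  refine ⟨-p, -q, by linarith, by linarith, h3, h4, fun s hs => ?_, fun s hs => ?_⟩
  · simpa using h5 (-s) ⟨by linarith [hs.2], by linarith [hs.1]⟩
  · simpa using h6 (-s) ⟨by linarith [hs.2], by linarith [hs.1]⟩

lemma ofReal_le_lintegral_deriv {v : ℝ → ℝ} (hv : ContDiff ℝ 1 v) {p q h : ℝ} (hpq : p ≤ q)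
    (hh : h ≤ |v q - v p|) : ENNReal.ofReal h ≤ ∫⁻ s in Ioo p q, ‖deriv v s‖ₑ := by
  rw [setLIntegral_congr Ioo_ae_eq_Icc]
  refine le_trans ?_ (enorm_sub_le_lintegral_deriv_of_contDiffOn_Icc hv.contDiffOn hpq)
  rw [Real.enorm_eq_ofReal_abs]
  exact ENNReal.ofReal_le_ofReal hh

lemma lintegral_deriv_two_sided {v : ℝ → ℝ} (hv : ContDiff ℝ 1 v) {τ h a b c : ℝ} (hh : 0 < h)
    {T : Set ℝ} (hba : b ≤ a) (hac : a ≤ c) (ha : τ + h < v a) (hb : v b ≤ τ) (hc : v c ≤ τ)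
    (hT : ∀ s, v s ≤ τ + h → (∀ r ∈ uIcc a s, τ < v r) → s ∈ T) :
    2 * ENNReal.ofReal h ≤ ∫⁻ s in T, ‖deriv v s‖ₑ := by
  obtain ⟨p, q, h1, h2, h3, h4, h5, h6⟩ :=
    exists_crossing hv.continuous (lt_add_of_pos_right τ hh) hac ha hc
  obtain ⟨p', q', h1', h2', h3', h4', h5', h6'⟩ :=
    exists_crossing_left hv.continuous (lt_add_of_pos_right τ hh) hba ha hb
  have hsub : Ioo q' p' ∪ Ioo p q ⊆ T := by
    rintro s (hs | hs)
    · refine hT s (h6' s hs) fun r hr => h5' r ?_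
      rw [uIcc_of_ge (hs.2.le.trans h1')] at hr
      exact ⟨hs.1.trans_le hr.1, hr.2⟩
    · refine hT s (h6 s hs) fun r hr => h5 r ?_
      rw [uIcc_of_le (h1.trans hs.1.le)] at hr
      exact ⟨hr.1, hr.2.trans_lt hs.2⟩
  refine le_trans ?_ (lintegral_mono_set hsub)
  rw [lintegral_union measurableSet_Ioo]
  · rw [two_mul]
    refine add_le_add (ofReal_le_lintegral_deriv hv h2'.le ?_) (ofReal_le_lintegral_deriv hv h2.le ?_)
    · exact (by linarith : h ≤ v p' - v q').trans (le_abs_self _)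
    · rw [abs_sub_comm]
      exact (by linarith : h ≤ v p - v q).trans (le_abs_self _)
  · refine Set.disjoint_left.2 fun s hs hs' => ?_
    linarith [hs.2, hs'.1]

/-- `U` is a union of connected components of `W`. -/
def IsComponentUnion (W U : Set (Fin 2 → ℝ)) : Prop :=
  ∀ A, IsPreconnected A → A ⊆ W → (A ∩ U).Nonempty → A ⊆ U

lemma exists_abs_le_of_isBounded_line {θ : Fin 2 → ℝ} (hθ : θ ≠ 0) {W : Set (Fin 2 → ℝ)}
    (hW : Bornology.IsBounded W) (c : ℝ) : ∃ R, ∀ s, lineMapAt θ (c, s) ∈ W → |s| < R := by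
  obtain ⟨C, hC⟩ := hW.exists_norm_le
  refine ⟨(C + ‖lineMapAt θ (c, 0)‖) / ‖θ‖ + 1, fun s hs => ?_⟩
  have h := lineMapAt_add θ c 0 s
  rw [zero_add] at h
  have h2 : s • θ = lineMapAt θ (c, s) - lineMapAt θ (c, 0) := by rw [h]; abel
  have h3 : |s| * ‖θ‖ ≤ C + ‖lineMapAt θ (c, 0)‖ := by
    rw [← Real.norm_eq_abs, ← norm_smul, h2]
    exact (norm_sub_le _ _).trans (add_le_add (hC _ hs) le_rfl)
  have hp : 0 < ‖θ‖ := norm_pos_iff.2 hθ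
  have := (le_div_iff₀ hp).2 h3
  linarith

lemma two_mul_volume_image_le {u : (Fin 2 → ℝ) → ℝ} (hu : ContDiff ℝ 1 u) {τ h : ℝ} (hh : 0 < h)
    (hb : Bornology.IsBounded {x | τ < u x}) {U : Set (Fin 2 → ℝ)} (hUm : MeasurableSet U)
    (hU : IsComponentUnion {x | τ < u x} U) (θ : Fin 2 → ℝ) :
    ENNReal.ofReal h * (2 * volume (detForm θ '' (U ∩ {x | τ + h < u x}))) ≤
      ∫⁻ x in U ∩ {x | u x ≤ τ + h}, ‖fderiv ℝ u x θ‖ₑ := by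
  rcases eq_or_ne θ 0 with rfl | hθ
  · have : volume (detForm 0 '' (U ∩ {x | τ + h < u x})) = 0 := by
      refine measure_mono_null (t := {0}) ?_ (by simp)
      rintro _ ⟨x, -, rfl⟩
      simp [detForm_zero_left]
    simp [this]
  have hTm : MeasurableSet (U ∩ {x | u x ≤ τ + h}) :=
    hUm.inter (isClosed_le hu.continuous continuous_const).measurableSet
  have hDm : Measurable fun x => ‖fderiv ℝ u x θ‖ₑ :=
    ((hu.continuous_fderiv one_ne_zero).clm_apply continuous_const).measurable.enorm
  rw [← lintegral_indicator hTm, lintegral_eq_lintegral_lines hθ (hDm.indicator hTm)]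
  set g : ℝ → ℝ≥0∞ := fun c => ∫⁻ s, (U ∩ {x | u x ≤ τ + h}).indicator
    (fun x => ‖fderiv ℝ u x θ‖ₑ) (lineMapAt θ (c, s)) with hg
  have hgm : Measurable g :=
    Measurable.lintegral_prod_right' (f := fun p => (U ∩ {x | u x ≤ τ + h}).indicator
      (fun x => ‖fderiv ℝ u x θ‖ₑ) (lineMapAt θ p))
      ((hDm.indicator hTm).comp (continuous_lineMapAt θ).measurable)
  have hsub : detForm θ '' (U ∩ {x | τ + h < u x}) ⊆ {c | 2 * ENNReal.ofReal h ≤ g c} := by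
    rintro _ ⟨x, ⟨hxU, hxu⟩, rfl⟩
    obtain ⟨a, ha⟩ := exists_lineMapAt hθ x
    set c := detForm θ x
    set v : ℝ → ℝ := fun s => u (lineMapAt θ (c, s)) with hv
    have hγ : ∀ s, lineMapAt θ (c, s) = lineMapAt θ (c, 0) + s • θ := fun s => by
      rw [← lineMapAt_add, zero_add]
    replace hγ := funext hγ
    have hγC : ContDiff ℝ 1 fun s => lineMapAt θ (c, s) := by
      rw [hγ]; fun_prop
    have hvC : ContDiff ℝ 1 v := hu.comp hγC
    have hvd : ∀ s, deriv v s = fderiv ℝ u (lineMapAt θ (c, s)) θ := fun s => by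
      have h1 : HasDerivAt (fun s : ℝ => lineMapAt θ (c, s)) θ s := by
        rw [hγ]
        simpa using ((hasDerivAt_id s).smul_const θ).const_add (lineMapAt θ (c, 0))
      exact ((hu.differentiable one_ne_zero _).hasFDerivAt.comp_hasDerivAt s h1).deriv
    obtain ⟨R, hR⟩ := exists_abs_le_of_isBounded_line hθ hb c
    have hout : ∀ s, R ≤ |s| → v s ≤ τ := fun s hs => by
      by_contra! h
      exact absurd (hR s h) (not_lt.2 hs)
    have haR : |a| < R := hR a (by rw [ha]; exact (lt_add_of_pos_right τ hh).trans hxu)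
    have hR0 : 0 < R := (abs_nonneg _).trans_lt haR
    have hTc : MeasurableSet ((fun s => lineMapAt θ (c, s)) ⁻¹' (U ∩ {x | u x ≤ τ + h})) :=
      hγC.continuous.measurable hTm
    have hgc : g c = ∫⁻ s in (fun s => lineMapAt θ (c, s)) ⁻¹' (U ∩ {x | u x ≤ τ + h}),
        ‖deriv v s‖ₑ := by
      rw [← lintegral_indicator hTc, hg]
      refine lintegral_congr fun s => ?_
      simp only [indicator, hvd]
      rfl
    rw [Set.mem_ofPred_eq, hgc]
    refine lintegral_deriv_two_sided hvC hh (b := -R) (c := R) (a := a) (τ := τ)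
      (by linarith [abs_lt.1 haR]) (by linarith [abs_lt.1 haR]) (by simpa [hv, ha] using hxu)
      (hout _ (by simp [abs_of_pos hR0])) (hout _ (by simp [abs_of_pos hR0])) fun s hs1 hs2 => ?_
    refine ⟨?_, hs1⟩
    refine hU ((fun s => lineMapAt θ (c, s)) '' uIcc a s)
      (isPreconnected_uIcc.image _ hγC.continuous.continuousOn) ?_ ?_ ⟨s, right_mem_uIcc, rfl⟩
    · rintro _ ⟨r, hr, rfl⟩
      exact hs2 r hr
    · exact ⟨x, ⟨a, left_mem_uIcc, ha⟩, hxU⟩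
  refine le_trans ?_ (mul_meas_ge_le_lintegral hgm (2 * ENNReal.ofReal h))
  rw [mul_left_comm, ← mul_assoc]
  gcongr

/-- The perimeter of `A` relative to the zonotope generated by `l`, as an extended real. -/
def perSum (l : List (Fin 2 → ℝ)) (A : Set (Fin 2 → ℝ)) : ℝ≥0∞ :=
  (l.map fun θ => 2 * volume (detForm θ '' A)).sum

lemma perSum_mul_le {u : (Fin 2 → ℝ) → ℝ} (hu : ContDiff ℝ 1 u) {τ h : ℝ} (hh : 0 < h)
    (hb : Bornology.IsBounded {x | τ < u x}) {U : Set (Fin 2 → ℝ)} (hUm : MeasurableSet U)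
    (hU : IsComponentUnion {x | τ < u x} U) (l : List (Fin 2 → ℝ)) :
    ENNReal.ofReal h * perSum l (U ∩ {x | τ + h < u x}) ≤
      ∫⁻ x in U ∩ {x | u x ≤ τ + h}, gradSum l u x := by
  unfold perSum gradSum
  induction l with
  | nil => simp
  | cons θ l ih =>
    simp only [List.map_cons, List.sum_cons]
    rw [mul_add, lintegral_add_left
      ((hu.continuous_fderiv one_ne_zero).clm_apply continuous_const).measurable.enorm]
    exact add_le_add (two_mul_volume_image_le hu hh hb hUm hU θ) ih

lemma tendsto_perSum {u : (Fin 2 → ℝ) → ℝ} {τ : ℝ} {U : Set (Fin 2 → ℝ)}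
    (hU : U ⊆ {x | τ < u x}) (l : List (Fin 2 → ℝ)) :
    Tendsto (fun n : ℕ => perSum l (U ∩ {x | τ + 1 / ((n : ℝ) + 1) < u x})) atTop
      (𝓝 (perSum l U)) := by
  unfold perSum
  induction l with
  | nil => simp
  | cons θ l ih =>
    simp only [List.map_cons, List.sum_cons]
    refine Tendsto.add (ENNReal.Tendsto.const_mul ?_ (Or.inr (by simp))) ih
    have hun : detForm θ '' U =
        ⋃ n : ℕ, detForm θ '' (U ∩ {x | τ + 1 / ((n : ℝ) + 1) < u x}) := by
      rw [← image_iUnion, ← inter_iUnion]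
      congr 1
      refine (inter_eq_left.2 fun x hx => ?_).symm
      have hxu : τ < u x := hU hx
      obtain ⟨n, hn⟩ := exists_nat_one_div_lt (sub_pos.2 hxu)
      refine mem_iUnion.2 ⟨n, ?_⟩
      rw [Set.mem_ofPred_eq]
      linarith
    rw [hun]
    refine tendsto_measure_iUnion_atTop fun a b hab => ?_
    refine image_mono (inter_subset_inter_right _ fun x hx => ?_)
    rw [Set.mem_ofPred_eq] at hx ⊢
    have := Nat.one_div_le_one_div (α := ℝ) hab
    linarith

lemma exists_mul_le_lintegral_band {u : (Fin 2 → ℝ) → ℝ} (hu : ContDiff ℝ 1 u) {τ : ℝ}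
    (hb : Bornology.IsBounded {x | τ < u x}) {𝒰 : Finset (Set (Fin 2 → ℝ))}
    (hUm : ∀ U ∈ 𝒰, MeasurableSet U) (hU : ∀ U ∈ 𝒰, IsComponentUnion {x | τ < u x} U)
    (hUs : ∀ U ∈ 𝒰, U ⊆ {x | τ < u x}) (hd : (𝒰 : Set (Set (Fin 2 → ℝ))).PairwiseDisjoint id)
    {l : List (Fin 2 → ℝ)} {M : ℝ} (hM : ENNReal.ofReal M < ∑ U ∈ 𝒰, perSum l U) :
    ∃ h₀ > 0, ∀ h, 0 < h → h ≤ h₀ →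
      ENNReal.ofReal (M * h) ≤ ∫⁻ x in u ⁻¹' Ioc τ (τ + h), gradSum l u x := by
  have hlim : Tendsto (fun n : ℕ => ∑ U ∈ 𝒰, perSum l (U ∩ {x | τ + 1 / ((n : ℝ) + 1) < u x}))
      atTop (𝓝 (∑ U ∈ 𝒰, perSum l U)) :=
    tendsto_finsetSum _ fun U h => tendsto_perSum (hUs U h) l
  obtain ⟨n, hn⟩ := (hlim.eventually_const_lt hM).exists
  refine ⟨1 / ((n : ℝ) + 1), by positivity, fun h hh hhn => ?_⟩
  have hmono : ∀ U, perSum l (U ∩ {x | τ + 1 / ((n : ℝ) + 1) < u x}) ≤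
      perSum l (U ∩ {x | τ + h < u x}) := fun U => by
    refine List.sum_le_sum fun θ _ => ?_
    gcongr
  calc ENNReal.ofReal (M * h) = ENNReal.ofReal h * ENNReal.ofReal M := by
        rw [mul_comm, ENNReal.ofReal_mul hh.le]
    _ ≤ ENNReal.ofReal h * ∑ U ∈ 𝒰, perSum l (U ∩ {x | τ + h < u x}) := by
        gcongr
        exact hn.le.trans (Finset.sum_le_sum fun U _ => hmono U)
    _ = ∑ U ∈ 𝒰, ENNReal.ofReal h * perSum l (U ∩ {x | τ + h < u x}) := Finset.mul_sum _ _ _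
    _ ≤ ∑ U ∈ 𝒰, ∫⁻ x in U ∩ {x | u x ≤ τ + h}, gradSum l u x :=
        Finset.sum_le_sum fun U h => perSum_mul_le hu hh hb (hUm U h) (hU U h) l
    _ = ∫⁻ x in ⋃ U ∈ 𝒰, U ∩ {x | u x ≤ τ + h}, gradSum l u x := by
        refine (lintegral_biUnion_finset (fun A hA B hB hAB => ?_) (fun U h => ?_) _).symm
        · exact (hd hA hB hAB).mono inter_subset_left inter_subset_left
        · exact (hUm U h).inter (isClosed_le hu.continuous continuous_const).measurableSet
    _ ≤ _ := by
        refine lintegral_mono_set (iUnion₂_subset fun U h x hx => ⟨hUs U h hx.1, hx.2⟩)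

lemma ofReal_mul_sub_le_measure_Ioc {ν : Measure ℝ} {s t M : ℝ} (hst : s ≤ t) (hM : 0 ≤ M)
    (H : ∀ τ ∈ Ico s t, ∃ h₀ > 0, ∀ h, 0 < h → h ≤ h₀ →
      ENNReal.ofReal (M * h) ≤ ν (Ioc τ (τ + h))) :
    ENNReal.ofReal (M * (t - s)) ≤ ν (Ioc s t) := by
  set S : Set ℝ := {τ ∈ Icc s t | ENNReal.ofReal (M * (τ - s)) ≤ ν (Ioc s τ)} with hS
  have hne : S.Nonempty := ⟨s, ⟨le_rfl, hst⟩, by simp⟩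
  have hbdd : BddAbove S := ⟨t, fun τ hτ => hτ.1.2⟩
  have hmem : sSup S ∈ S := by
    refine ⟨⟨le_csSup hbdd ⟨⟨le_rfl, hst⟩, by simp⟩, csSup_le hne fun τ hτ => hτ.1.2⟩, ?_⟩
    obtain ⟨τ, -, hτ, hτS⟩ := exists_seq_tendsto_sSup hne hbdd
    have hlim : Tendsto (fun n => ENNReal.ofReal (M * (τ n - s))) atTop
        (𝓝 (ENNReal.ofReal (M * (sSup S - s)))) :=
      ENNReal.tendsto_ofReal ((hτ.sub_const s).const_mul M)
    exact le_of_tendsto' hlim fun n =>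
      (hτS n).2.trans (measure_mono (Ioc_subset_Ioc_right (le_csSup hbdd (hτS n))))
  rcases eq_or_lt_of_le hmem.1.2 with h | h
  · have := hmem.2; rwa [h] at this
  · exfalso
    obtain ⟨h₀, h₀pos, hh₀⟩ := H _ ⟨hmem.1.1, h⟩
    set k := min h₀ (t - sSup S) with hk
    have hkpos : 0 < k := lt_min h₀pos (sub_pos.2 h)
    have hk2 : k ≤ t - sSup S := min_le_right _ _
    have hin : sSup S + k ∈ S := by
      refine ⟨⟨by linarith [hmem.1.1], by linarith⟩, ?_⟩
      rw [← Ioc_union_Ioc_eq_Ioc hmem.1.1 (by linarith : sSup S ≤ sSup S + k),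
        measure_union (Ioc_disjoint_Ioc_of_le le_rfl) measurableSet_Ioc,
        show M * (sSup S + k - s) = M * (sSup S - s) + M * k by ring,
        ENNReal.ofReal_add (mul_nonneg hM (sub_nonneg.2 hmem.1.1)) (by positivity)]
      exact add_le_add hmem.2 (hh₀ k hkpos (min_le_left _ _))
    linarith [le_csSup hbdd hin]

/-- The connected components of `W`. -/
def components (W : Set (Fin 2 → ℝ)) : Set (Set (Fin 2 → ℝ)) :=
  (fun x => connectedComponentIn W x) '' W

lemma isComponentUnion_of_mem_components {W U : Set (Fin 2 → ℝ)} (hU : U ∈ components W) :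
    IsComponentUnion W U := by
  obtain ⟨x, hx, rfl⟩ := hU
  rintro A hA hAW ⟨y, hyA, hyU⟩
  simp only [] at hyU ⊢
  rw [connectedComponentIn_eq hyU]
  exact hA.subset_connectedComponentIn hyA hAW

lemma pairwiseDisjoint_components (W : Set (Fin 2 → ℝ)) : (components W).PairwiseDisjoint id := by
  rintro _ ⟨x, hx, rfl⟩ _ ⟨y, hy, rfl⟩ hne
  refine Set.disjoint_left.2 fun z hz hz' => hne ?_
  exact (connectedComponentIn_eq hz).trans (connectedComponentIn_eq hz').symm

lemma exists_level_sum_perSum_le {u : (Fin 2 → ℝ) → ℝ} (hu : ContDiff ℝ 1 u)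
    (hb : ∀ τ > 0, Bornology.IsBounded {x | τ < u x}) {l : List (Fin 2 → ℝ)} {s t M : ℝ}
    (hs : 0 < s) (hst : s ≤ t) (hM : 0 ≤ M)
    (hlt : ∫⁻ x, gradSum l u x < ENNReal.ofReal (M * (t - s))) :
    ∃ τ ∈ Ico s t, ∀ 𝒰 : Finset (Set (Fin 2 → ℝ)), (𝒰 : Set (Set (Fin 2 → ℝ))) ⊆
      components {x | τ < u x} → ∑ U ∈ 𝒰, perSum l U ≤ ENNReal.ofReal M := by
  by_contra! H
  refine absurd hlt (not_lt.2 ?_)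
  set ν := (volume.withDensity (gradSum l u)).map u with hν
  have hνI : ∀ a b, ν (Ioc a b) = ∫⁻ x in u ⁻¹' Ioc a b, gradSum l u x := fun a b => by
    rw [hν, Measure.map_apply hu.continuous.measurable measurableSet_Ioc,
      withDensity_apply _ (hu.continuous.measurable measurableSet_Ioc)]
  have := ofReal_mul_sub_le_measure_Ioc (ν := ν) hst hM fun τ hτ => by
    obtain ⟨𝒰, h𝒰, hlt⟩ := H τ hτ
    have ho : IsOpen {x | τ < u x} := isOpen_lt continuous_const hu.continuous
    simp_rw [hνI]
    refine exists_mul_le_lintegral_band hu (hb τ (hs.trans_le hτ.1)) (fun U h => ?_)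
      (fun U h => isComponentUnion_of_mem_components (h𝒰 h)) (fun U h => ?_)
      ((pairwiseDisjoint_components _).subset h𝒰) hlt
    · obtain ⟨x, hx, rfl⟩ := h𝒰 h
      exact ho.connectedComponentIn.measurableSet
    · obtain ⟨x, hx, rfl⟩ := h𝒰 h
      exact connectedComponentIn_subset _ _
  refine this.trans ?_
  rw [hνI]
  exact setLIntegral_le_lintegral _ _

end LevelSets

section ComponentHull
open scoped Pointwise Topology

lemma volume_detForm_image_closure_convexHull_le (θ : Fin 2 → ℝ) {U : Set (Fin 2 → ℝ)}
    (hU : IsPreconnected U) :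
    volume (detForm θ '' closure (convexHull ℝ U)) ≤ volume (detForm θ '' U) := by
  have hI : Convex ℝ (detForm θ '' U) :=
    ((hU.image _ (continuous_detForm θ).continuousOn).ordConnected).convex
  have hsub : detForm θ '' closure (convexHull ℝ U) ⊆ closure (detForm θ '' U) := by
    refine (image_closure_subset_closure_image (continuous_detForm θ)).trans (closure_mono ?_)
    rw [LinearMap.image_convexHull, hI.convexHull_eq]
  refine (measure_mono hsub).trans ?_
  rw [closure_eq_self_union_frontier]
  refine (measure_union_le _ _).trans ?_
  rw [hI.addHaar_frontier volume, add_zero]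

lemma ofReal_zonoPerim_hull_le (l : List (Fin 2 → ℝ)) {U : Set (Fin 2 → ℝ)}
    (hU : IsPreconnected U) :
    ENNReal.ofReal (zonoPerim l (closure (convexHull ℝ U))) ≤ perSum l U := by
  induction l with
  | nil => simp [zonoPerim, perSum]
  | cons θ l ih =>
    rw [zonoPerim_cons, perSum, List.map_cons, List.sum_cons]
    refine ENNReal.ofReal_add_le.trans (add_le_add ?_ ih)
    rw [ENNReal.ofReal_mul (by norm_num), ENNReal.ofReal_ofNat]
    gcongr
    exact ENNReal.ofReal_toReal_le.trans (volume_detForm_image_closure_convexHull_le θ hU)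

end ComponentHull

section BumpApproximation
open scoped Pointwise Topology Convolution

/-- A bump function centred at the origin with support of radius `1 / (n + 1)`. -/
def shrinkingBump (n : ℕ) : ContDiffBump (0 : Fin 2 → ℝ) where
  rIn := 1 / ((n : ℝ) + 1) / 2
  rOut := 1 / ((n : ℝ) + 1)
  rIn_pos := by positivity
  rIn_lt_rOut := half_lt_self (by positivity)

lemma tendsto_rOut_shrinkingBump : Tendsto (fun n => (shrinkingBump n).rOut) atTop (𝓝 0) :=
  tendsto_one_div_add_atTop_nhds_zero_nat

/-- The mollification of the indicator function of `F` at scale `1 / (n + 1)`. -/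
def mollIndicator (F : Set (Fin 2 → ℝ)) (n : ℕ) : (Fin 2 → ℝ) → ℝ :=
  moll ((shrinkingBump n).normed volume) (F.indicator 1)

lemma integrable_indicator_one {F : Set (Fin 2 → ℝ)} (hF : MeasurableSet F)
    (hFb : Bornology.IsBounded F) : Integrable (F.indicator (1 : (Fin 2 → ℝ) → ℝ)) :=
  (integrable_indicator_iff hF).2 (integrableOn_const hFb.measure_lt_top.ne)

lemma contDiff_mollIndicator {F : Set (Fin 2 → ℝ)} (hF : MeasurableSet F)
    (hFb : Bornology.IsBounded F) (n : ℕ) : ContDiff ℝ 1 (mollIndicator F n) :=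
  contDiff_moll (shrinkingBump n).contDiff_normed (shrinkingBump n).hasCompactSupport_normed
    (integrable_indicator_one hF hFb)

lemma mem_cthickening_of_mollIndicator_pos {F : Set (Fin 2 → ℝ)} {n : ℕ} {x : Fin 2 → ℝ}
    (hx : 0 < mollIndicator F n x) : x ∈ Metric.cthickening (shrinkingBump n).rOut F := by
  by_contra hcon
  refine absurd hx (not_lt.2 (le_of_eq ?_))
  refine integral_eq_zero_of_ae (Eventually.of_forall fun t => ?_)
  by_cases ht : t ∈ F
  · have : (shrinkingBump n).normed volume (x - t) = 0 := by
      by_contra h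
      have h2 : x - t ∈ tsupport ((shrinkingBump n).normed volume) := subset_tsupport _ h
      rw [(shrinkingBump n).tsupport_normed_eq, mem_closedBall_zero_iff, ← dist_eq_norm] at h2
      exact hcon (Metric.mem_cthickening_of_dist_le x t _ F ht h2)
    simp [this]
  · simp [ht]

lemma lintegral_gradSum_mollIndicator_le {φ : (Fin 2 → ℝ) → ℝ} {l : List (Fin 2 → ℝ)}
    (hl : zonotope l ⊆ unitBall φ) {F : Set (Fin 2 → ℝ)} (hF : MeasurableSet F)
    (hFb : Bornology.IsBounded F) (n : ℕ) :
    ∫⁻ x, gradSum l (mollIndicator F n) x ≤ anisoPerimeter φ F :=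
  lintegral_gradSum_moll_le hl (shrinkingBump n).contDiff_normed
    (shrinkingBump n).hasCompactSupport_normed (shrinkingBump n).normed_neg
    (shrinkingBump n).nonneg_normed (shrinkingBump n).integral_normed hF hFb

lemma tendsto_volume_mollIndicator_le {F : Set (Fin 2 → ℝ)} (hF : MeasurableSet F)
    (hFb : Bornology.IsBounded F) {t : ℝ} (ht : t < 1) :
    Tendsto (fun n => volume (F ∩ {x | mollIndicator F n x ≤ t})) atTop (𝓝 0) := by
  have hae : ∀ᵐ x ∂volume, Tendsto (fun n => mollIndicator F n x) atTop
      (𝓝 (F.indicator (1 : (Fin 2 → ℝ) → ℝ) x)) := by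
    simp_rw [mollIndicator, moll_eq_convolution]
    refine ContDiffBump.ae_convolution_tendsto_right_of_locallyIntegrable (K := 2)
      tendsto_rOut_shrinkingBump (Eventually.of_forall fun n => ?_)
      (integrable_indicator_one hF hFb).locallyIntegrable
    simp only [shrinkingBump]; linarith
  have : IsFiniteMeasure (volume.restrict F) := ⟨by simpa using hFb.measure_lt_top⟩
  have h := tendstoInMeasure_of_tendsto_ae (μ := volume.restrict F)
    (fun n => (contDiff_mollIndicator hF hFb n).continuous.aestronglyMeasurable)
    (ae_restrict_of_ae hae) (ENNReal.ofReal (1 - t)) (by simpa using ht)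
  refine tendsto_of_tendsto_of_tendsto_of_le_of_le tendsto_const_nhds h (fun _ => zero_le)
    fun n => ?_
  rw [Measure.restrict_apply' hF, inter_comm]
  refine measure_mono fun x hx => ⟨?_, hx.2⟩
  have h1 : mollIndicator F n x ≤ t := hx.1
  rw [Set.mem_ofPred_eq, indicator_of_mem hx.2, edist_dist, Real.dist_eq, abs_sub_comm]
  exact ENNReal.ofReal_le_ofReal ((by simp only [Pi.one_apply]; linarith :
    1 - t ≤ (1 : (Fin 2 → ℝ) → ℝ) x - mollIndicator F n x).trans (le_abs_self _))

end BumpApproximation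

section ConvexFamily
open scoped Pointwise Topology

variable {φ : (Fin 2 → ℝ) → ℝ}

lemma exists_convex_family {l : List (Fin 2 → ℝ)} (hl : zonotope l ⊆ unitBall φ)
    {Ω F : Set (Fin 2 → ℝ)} (hΩb : Bornology.IsBounded Ω) (hΩc : Convex ℝ Ω)
    (hF : MeasurableSet F) (hFΩ : F ⊆ Ω) (hP : anisoPerimeter φ F ≠ ∞) {δ : ℝ} (hδ : 0 < δ) :
    ∃ 𝒦 : Finset (Set (Fin 2 → ℝ)),
      (∀ K ∈ 𝒦, IsCompact K ∧ Convex ℝ K ∧ K ⊆ Metric.cthickening δ Ω) ∧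
      volume.real F - δ ≤ volume.real (⋃ K ∈ 𝒦, K) ∧
      ∑ K ∈ 𝒦, zonoPerim l K ≤ (anisoPerimeter φ F).toReal + δ := by
  classical
  set P := (anisoPerimeter φ F).toReal with hPdef
  have hP0 : 0 ≤ P := ENNReal.toReal_nonneg
  rcases lt_or_ge (volume.real F) δ with hsmall | hbig
  · refine ⟨∅, by simp, ?_, by simpa using by positivity⟩
    simp only [Finset.notMem_empty, iUnion_of_empty, iUnion_empty, measureReal_empty]
    linarith
  have hFb : Bornology.IsBounded F := hΩb.subset hFΩ
  have hFfin : volume F ≠ ∞ := hFb.measure_lt_top.ne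
  set σ := δ / (4 * (P + δ)) with hσ
  have hPδ : 0 < P + δ := by positivity
  have hσ0 : 0 < σ := by positivity
  have hσ4 : (P + δ) * σ = δ / 4 := by rw [hσ]; field_simp
  have hσ1 : σ ≤ 1 / 4 := by
    rw [hσ, div_le_div_iff₀ (by positivity) (by norm_num)]
    linarith
  obtain ⟨n, hn1, hn2⟩ := (((tendsto_volume_mollIndicator_le hF hFb
    (show 1 - σ < 1 by linarith)).eventually_le_const
    (show (0 : ℝ≥0∞) < ENNReal.ofReal (δ / 2) by simpa using hδ)).and
    (tendsto_rOut_shrinkingBump.eventually_le_const hδ)).exists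
  set u := mollIndicator F n with hu
  have huC : ContDiff ℝ 1 u := contDiff_mollIndicator hF hFb n
  have hthick : ∀ τ > 0, {x | τ < u x} ⊆ Metric.cthickening δ Ω := fun τ hτ x hx =>
    (Metric.cthickening_mono hn2 Ω) (Metric.cthickening_subset_of_subset _ hFΩ
      (mem_cthickening_of_mollIndicator_pos (lt_trans hτ hx)))
  have hbdd : ∀ τ > 0, Bornology.IsBounded {x | τ < u x} := fun τ hτ =>
    hΩb.cthickening.subset (hthick τ hτ)
  obtain ⟨τ, ⟨hτ1, hτ2⟩, hτ⟩ := exists_level_sum_perSum_le huC hbdd (l := l) hσ0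
    (show σ ≤ 1 - σ by linarith) hPδ.le
    ((lintegral_gradSum_mollIndicator_le hl hF hFb n).trans_lt (by
      rw [← ENNReal.ofReal_toReal hP, ← hPdef]
      exact (ENNReal.ofReal_lt_ofReal_iff (by nlinarith)).2 (by nlinarith)))
  have hτ0 : 0 < τ := hσ0.trans_le hτ1
  set W := {x | τ < u x} with hW
  have hWo : IsOpen W := isOpen_lt continuous_const huC.continuous
  have hWvol : volume.real F - δ / 2 ≤ volume.real W := by
    have h1 : F ⊆ W ∪ (F ∩ {x | u x ≤ 1 - σ}) := fun x hx => by
      rcases le_or_gt (u x) (1 - σ) with h | h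
      · exact Or.inr ⟨hx, h⟩
      · exact Or.inl (hτ2.trans h)
    have h2 : volume.real (F ∩ {x | u x ≤ 1 - σ}) ≤ δ / 2 :=
      ENNReal.toReal_le_of_le_ofReal (by positivity) hn1
    have h3 := measureReal_mono h1 (measure_union_lt_top (hbdd τ hτ0).measure_lt_top
      ((measure_mono inter_subset_left).trans_lt hFfin.lt_top)).ne
    linarith [measureReal_union_le (μ := volume) W (F ∩ {x | u x ≤ 1 - σ})]
  obtain ⟨C, hCW, hC, hCvol⟩ := hWo.exists_lt_isCompact (μ := volume)
    (r := ENNReal.ofReal (volume.real F - δ)) (by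
      rw [← ENNReal.ofReal_toReal (hbdd τ hτ0).measure_lt_top.ne]
      have : volume.real F - δ < volume.real W := by linarith
      exact (ENNReal.ofReal_lt_ofReal_iff (by linarith : 0 < volume.real W)).2 this)
  obtain ⟨b, hb, hbf, hCb⟩ := hC.elim_finite_subcover_image (b := components W) (c := id)
    (by rintro _ ⟨x, -, rfl⟩; exact hWo.connectedComponentIn)
    (fun x hx => mem_iUnion₂.2 ⟨_, ⟨x, hCW hx, rfl⟩, mem_connectedComponentIn (hCW hx)⟩)
  have hbW : ∀ U ∈ b, U ⊆ W ∧ IsPreconnected U := fun U hU => by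
    obtain ⟨x, -, rfl⟩ := hb hU
    exact ⟨connectedComponentIn_subset _ _, isPreconnected_connectedComponentIn⟩
  have hKsub : ∀ U ∈ b, closure (convexHull ℝ U) ⊆ Metric.cthickening δ Ω := fun U hU =>
    closure_minimal (convexHull_min ((hbW U hU).1.trans (hthick τ hτ0)) (hΩc.cthickening δ))
      Metric.isClosed_cthickening
  refine ⟨hbf.toFinset.image fun U => closure (convexHull ℝ U), ?_, ?_, ?_⟩
  · simp only [Finset.mem_image, Set.Finite.mem_toFinset, forall_exists_index, and_imp,
      forall_apply_eq_imp_iff₂]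
    exact fun U hU => ⟨Metric.isCompact_of_isClosed_isBounded isClosed_closure
      (hΩb.cthickening.subset (hKsub U hU)), (convex_convexHull ℝ U).closure, hKsub U hU⟩
  · have hsub : C ⊆ ⋃ K ∈ hbf.toFinset.image fun U => closure (convexHull ℝ U), K := by
      intro x hx
      obtain ⟨U, hU, hxU⟩ := mem_iUnion₂.1 (hCb hx)
      refine mem_iUnion₂.2 ⟨_, Finset.mem_image.2 ⟨U, hbf.mem_toFinset.2 hU, rfl⟩, ?_⟩
      exact subset_closure (subset_convexHull ℝ U hxU)
    have hfin : volume (⋃ K ∈ hbf.toFinset.image fun U => closure (convexHull ℝ U), K) ≠ ∞ := by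
      refine ((measure_mono (iUnion₂_subset fun K hK => ?_)).trans_lt
        (hΩb.cthickening (δ := δ)).measure_lt_top).ne
      obtain ⟨U, hU, rfl⟩ := Finset.mem_image.1 hK
      exact hKsub U (hbf.mem_toFinset.1 hU)
    refine le_trans ?_ (measureReal_mono hsub hfin)
    exact (ENNReal.ofReal_le_iff_le_toReal hC.measure_lt_top.ne).1 hCvol.le
  · refine (Finset.sum_image_le_of_nonneg fun K _ => zonoPerim_nonneg l K).trans ?_
    have h1 := hτ hbf.toFinset (by simpa using hb)
    rw [← ENNReal.ofReal_le_ofReal_iff hPδ.le,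
      ENNReal.ofReal_sum_of_nonneg fun U _ => zonoPerim_nonneg l _]
    exact (Finset.sum_le_sum fun U hU =>
      ofReal_zonoPerim_hull_le l (hbW U (hbf.mem_toFinset.1 hU)).2).trans h1

end ConvexFamily

section IsoperimetricInequalities
open scoped Pointwise Topology

variable {φ : (Fin 2 → ℝ) → ℝ}

lemma iInter_cthickening_seq (Ω : Set (Fin 2 → ℝ)) :
    ⋂ n : ℕ, Metric.cthickening (1 / ((n : ℝ) + 1)) Ω = closure Ω := by
  rw [Metric.closure_eq_iInter_cthickening' Ω (range fun n : ℕ => 1 / ((n : ℝ) + 1)), biInter_range]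
  intro ε hε
  obtain ⟨n, hn⟩ := exists_nat_one_div_lt hε
  exact ⟨_, ⟨n, rfl⟩, by positivity, hn.le⟩

lemma tendsto_volume_erosion_cthickening {Ω : Set (Fin 2 → ℝ)} (hΩb : Bornology.IsBounded Ω)
    {B : Set (Fin 2 → ℝ)} (h0 : (0 : Fin 2 → ℝ) ∈ B) :
    Tendsto (fun n : ℕ => volume.real (erosion (Metric.cthickening (1 / ((n : ℝ) + 1)) Ω) B))
      atTop (𝓝 (volume.real (erosion (closure Ω) B))) := by
  have hcl : ∀ n : ℕ, IsClosed (erosion (Metric.cthickening (1 / ((n : ℝ) + 1)) Ω) B) :=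
    fun n => isClosed_erosion Metric.isClosed_cthickening
  have hfin : ∀ n : ℕ, volume (erosion (Metric.cthickening (1 / ((n : ℝ) + 1)) Ω) B) ≠ ∞ :=
    fun n => (hΩb.cthickening.subset (erosion_subset h0)).measure_lt_top.ne
  have hI : erosion (closure Ω) B =
      ⋂ n : ℕ, erosion (Metric.cthickening (1 / ((n : ℝ) + 1)) Ω) B := by
    rw [← iInter_cthickening_seq]
    ext x
    simp only [erosion, mem_iInter, Set.mem_ofPred_eq]
    exact ⟨fun h n b hb => h b hb n, fun h b hb n => h n b hb⟩
  rw [hI]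
  refine (ENNReal.tendsto_toReal ?_).comp (tendsto_measure_iInter_atTop
    (fun n => (hcl n).measurableSet.nullMeasurableSet) (fun a b hab => ?_) ⟨0, hfin 0⟩)
  · exact ((measure_mono (iInter_subset _ 0)).trans_lt (hfin 0).lt_top).ne
  · exact erosion_mono (Metric.cthickening_mono (Nat.one_div_le_one_div hab) Ω) Subset.rfl

lemma volume_zonotope_ge {l : List (Fin 2 → ℝ)} {ε : ℝ} (hl : unitBall φ ⊆ (1 + ε) • zonotope l) :
    volume.real (unitBall φ) ≤ (1 + ε) ^ 2 * volume.real (zonotope l) := by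
  rw [← volume_smul_real]
  exact measureReal_mono hl ((isCompact_zonotope l).smul _).measure_lt_top.ne

lemma tendsto_one_add_one_div : Tendsto (fun n : ℕ => 1 + 1 / ((n : ℝ) + 1)) atTop (𝓝 1) := by
  simpa using (tendsto_one_div_add_atTop_nhds_zero_nat (𝕜 := ℝ)).const_add 1

lemma zonotope_bonnesen {l : List (Fin 2 → ℝ)} (hl : zonotope l ⊆ unitBall φ)
    (hz : 0 < volume.real (zonotope l))
    {Ω F : Set (Fin 2 → ℝ)} (hΩb : Bornology.IsBounded Ω) (hΩc : Convex ℝ Ω)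
    (hF : MeasurableSet F) (hFΩ : F ⊆ Ω) (hP : anisoPerimeter φ F ≠ ∞) {r : ℝ} (hr : 0 ≤ r) :
    volume.real F + min (r ^ 2 * volume.real (zonotope l)) (volume.real F) ≤
      volume.real (erosion (closure Ω) (r • zonotope l)) + r * (anisoPerimeter φ F).toReal := by
  have hδ := tendsto_one_div_add_atTop_nhds_zero_nat (𝕜 := ℝ)
  have hm : Tendsto (fun n : ℕ => volume.real F - 1 / ((n : ℝ) + 1)) atTop (𝓝 (volume.real F)) := by
    simpa using hδ.const_sub (volume.real F)
  have h1 := hm.add ((tendsto_const_nhds (x := r ^ 2 * volume.real (zonotope l))).min hm)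
  have h2 := (tendsto_volume_erosion_cthickening hΩb
    (zero_mem_smul_set (a := r) (zero_mem_zonotope l))).add
    ((hδ.const_add (anisoPerimeter φ F).toReal).const_mul r)
  rw [add_zero] at h2
  refine le_of_tendsto_of_tendsto' h1 h2 fun n => ?_
  obtain ⟨𝒦, h𝒦, hvol, hper⟩ := exists_convex_family hl hΩb hΩc hF hFΩ hP
    (show (0 : ℝ) < 1 / ((n : ℝ) + 1) by positivity)
  have hb := bonnesen_family (Metric.isCompact_of_isClosed_isBounded
    Metric.isClosed_cthickening hΩb.cthickening) l hz hr 𝒦 h𝒦 (hΩc.cthickening _)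
  refine (add_le_add hvol (min_le_min le_rfl hvol)).trans (hb.trans ?_)
  gcongr

lemma zonotope_isoperimetric {l : List (Fin 2 → ℝ)} (hl : zonotope l ⊆ unitBall φ)
    (hz : 0 < volume.real (zonotope l))
    {Ω F : Set (Fin 2 → ℝ)} (hΩb : Bornology.IsBounded Ω) (hΩc : Convex ℝ Ω)
    (hF : MeasurableSet F) (hFΩ : F ⊆ Ω) (hP : anisoPerimeter φ F ≠ ∞) :
    2 * (√(volume.real (zonotope l)) * √(volume.real F)) ≤ (anisoPerimeter φ F).toReal := by
  have hδ := tendsto_one_div_add_atTop_nhds_zero_nat (𝕜 := ℝ)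
  have hm : Tendsto (fun n : ℕ => volume.real F - 1 / ((n : ℝ) + 1)) atTop (𝓝 (volume.real F)) := by
    simpa using hδ.const_sub (volume.real F)
  have h1 := ((hm.sqrt).const_mul (√(volume.real (zonotope l)))).const_mul 2
  have h2 := hδ.const_add (anisoPerimeter φ F).toReal
  rw [add_zero] at h2
  refine le_of_tendsto_of_tendsto' h1 h2 fun n => ?_
  obtain ⟨𝒦, h𝒦, hvol, hper⟩ := exists_convex_family hl hΩb hΩc hF hFΩ hP
    (show (0 : ℝ) < 1 / ((n : ℝ) + 1) by positivity)
  refine le_trans ?_ ((isoperimetric_family l hz 𝒦 fun K hK => ⟨(h𝒦 K hK).1, (h𝒦 K hK).2.1⟩).trans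
    hper)
  gcongr

lemma volume_zonotope_pos (hφ : IsNorm φ) {l : List (Fin 2 → ℝ)} {ε : ℝ} (hε : 0 < ε)
    (hl : unitBall φ ⊆ (1 + ε) • zonotope l) : 0 < volume.real (zonotope l) := by
  have h := (volume_unitBall_pos hφ).trans_le (volume_zonotope_ge hl)
  exact pos_of_mul_pos_right h (by positivity)

/-- The lower bound for the perimeter in terms of the erosion of the container. -/
lemma bonnesen (hφ : IsNorm φ)
    {Ω F : Set (Fin 2 → ℝ)} (hΩb : Bornology.IsBounded Ω) (hΩc : Convex ℝ Ω)
    (hF : MeasurableSet F) (hFΩ : F ⊆ Ω) (hP : anisoPerimeter φ F ≠ ∞) {r : ℝ} (hr : 0 ≤ r) :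
    volume.real F + min (r ^ 2 * volume.real (unitBall φ)) (volume.real F) ≤
      volume.real (erosion (closure Ω) (r • unitBall φ)) + r * (anisoPerimeter φ F).toReal := by
  have h2 := ((tendsto_one_add_one_div.mul_const r).mul_const
    (anisoPerimeter φ F).toReal).const_add (volume.real (erosion (closure Ω) (r • unitBall φ)))
  rw [one_mul] at h2
  refine ge_of_tendsto' h2 fun n => ?_
  have hε : (0 : ℝ) < 1 / ((n : ℝ) + 1) := by positivity
  set ε := 1 / ((n : ℝ) + 1)
  obtain ⟨l, hl1, hl2⟩ := exists_zonotope_approx hφ hε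
  have h := zonotope_bonnesen hl1 (volume_zonotope_pos hφ hε hl2) hΩb hΩc hF hFΩ hP
    (show 0 ≤ (1 + ε) * r by positivity)
  have hsub : r • unitBall φ ⊆ ((1 + ε) * r) • zonotope l := by
    rw [mul_comm, mul_smul]
    exact smul_set_mono hl2
  have hfin : volume (erosion (closure Ω) (r • unitBall φ)) ≠ ∞ :=
    (hΩb.closure.subset (erosion_subset (zero_mem_smul_unitBall hφ r))).measure_lt_top.ne
  have he := measureReal_mono (μ := volume) (erosion_mono (Subset.refl (closure Ω)) hsub) hfin
  have hv : r ^ 2 * volume.real (unitBall φ) ≤ ((1 + ε) * r) ^ 2 * volume.real (zonotope l) := by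
    nlinarith [mul_le_mul_of_nonneg_left (volume_zonotope_ge hl2) (sq_nonneg r)]
  linarith [min_le_min hv (le_refl (volume.real F))]

/-- The anisotropic isoperimetric inequality for sets in a bounded convex container. -/
lemma isoperimetric (hφ : IsNorm φ)
    {Ω F : Set (Fin 2 → ℝ)} (hΩb : Bornology.IsBounded Ω) (hΩc : Convex ℝ Ω)
    (hF : MeasurableSet F) (hFΩ : F ⊆ Ω) (hP : anisoPerimeter φ F ≠ ∞) :
    2 * (√(volume.real (unitBall φ)) * √(volume.real F)) ≤ (anisoPerimeter φ F).toReal := by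
  have h2 := tendsto_one_add_one_div.mul_const (anisoPerimeter φ F).toReal
  rw [one_mul] at h2
  refine ge_of_tendsto' h2 fun n => ?_
  have hε : (0 : ℝ) < 1 / ((n : ℝ) + 1) := by positivity
  set ε := 1 / ((n : ℝ) + 1)
  obtain ⟨l, hl1, hl2⟩ := exists_zonotope_approx hφ hε
  have h := zonotope_isoperimetric hl1 (volume_zonotope_pos hφ hε hl2) hΩb hΩc hF hFΩ hP
  have hs : √(volume.real (unitBall φ)) ≤ (1 + ε) * √(volume.real (zonotope l)) := by
    refine (Real.sqrt_le_sqrt (volume_zonotope_ge hl2)).trans (le_of_eq ?_)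
    rw [Real.sqrt_mul (by positivity), Real.sqrt_sq (by positivity)]
  calc _ ≤ 2 * ((1 + ε) * √(volume.real (zonotope l)) * √(volume.real F)) := by gcongr
    _ = (1 + ε) * (2 * (√(volume.real (zonotope l)) * √(volume.real F))) := by ring
    _ ≤ _ := by gcongr

end IsoperimetricInequalities

section InnerParallelSets
open scoped Pointwise Topology

variable {φ : (Fin 2 → ℝ) → ℝ}

/-- The inner parallel body of `K` at distance `r`. -/
def innerBody (φ : (Fin 2 → ℝ) → ℝ) (K : Set (Fin 2 → ℝ)) (r : ℝ) : Set (Fin 2 → ℝ) :=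
  erosion K (r • unitBall φ)

lemma mem_innerBody (hφ : IsNorm φ) {K : Set (Fin 2 → ℝ)} {r : ℝ} (hr : 0 ≤ r) {x : Fin 2 → ℝ} :
    x ∈ innerBody φ K r ↔ ∀ v, φ v ≤ r → x + v ∈ K := by
  simp only [innerBody, erosion, Set.mem_ofPred_eq, mem_smul_unitBall hφ hr]

lemma innerBody_anti (hφ : IsNorm φ) (K : Set (Fin 2 → ℝ)) {r s : ℝ} (hs : 0 ≤ s) (hsr : s ≤ r) :
    innerBody φ K r ⊆ innerBody φ K s := fun x hx => by
  rw [mem_innerBody hφ (hs.trans hsr)] at hx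
  rw [mem_innerBody hφ hs]
  exact fun v hv => hx v (hv.trans hsr)

lemma innerBody_zero (hφ : IsNorm φ) (K : Set (Fin 2 → ℝ)) : innerBody φ K 0 = K := by
  ext x
  rw [mem_innerBody hφ le_rfl]
  refine ⟨fun h => by simpa using h 0 hφ.map_zero.le, fun h v hv => ?_⟩
  rw [(hφ.eq_zero_iff v).1 (le_antisymm hv (hφ.nonneg v)), add_zero]
  exact h

lemma isCompact_innerBody (hφ : IsNorm φ) {K : Set (Fin 2 → ℝ)} (hK : IsCompact K) (r : ℝ) :
    IsCompact (innerBody φ K r) :=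
  isCompact_erosion hK (zero_mem_smul_unitBall hφ r)

lemma convex_innerBody {K : Set (Fin 2 → ℝ)} (hK : Convex ℝ K) (r : ℝ) :
    Convex ℝ (innerBody φ K r) := convex_erosion hK

lemma innerBody_combo (hφ : IsNorm φ) {K : Set (Fin 2 → ℝ)} (hK : Convex ℝ K) {r s a b : ℝ}
    (hr : 0 ≤ r) (hs : 0 ≤ s) (ha : 0 ≤ a) (hb : 0 ≤ b) (hab : a + b = 1) {x y : Fin 2 → ℝ}
    (hx : x ∈ innerBody φ K r) (hy : y ∈ innerBody φ K s) :
    a • x + b • y ∈ innerBody φ K (a * r + b * s) := by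
  rw [mem_innerBody hφ hr] at hx
  rw [mem_innerBody hφ hs] at hy
  rw [mem_innerBody hφ (by positivity)]
  intro v hv
  rcases (show 0 ≤ a * r + b * s by positivity).eq_or_lt with h0 | h0
  · have hv0 : v = 0 := (hφ.eq_zero_iff v).1 (le_antisymm (h0 ▸ hv) (hφ.nonneg v))
    have h1 := hx 0 (by rw [hφ.map_zero]; exact hr)
    have h2 := hy 0 (by rw [hφ.map_zero]; exact hs)
    rw [add_zero] at h1 h2
    rw [hv0, add_zero]
    exact hK h1 h2 ha hb hab
  · set c := a * r + b * s with hc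
    have key : ∀ t, 0 ≤ t → φ ((t / c) • v) ≤ t := fun t ht => by
      rw [hφ.map_smul_nonneg (by positivity), div_mul_eq_mul_div, div_le_iff₀ h0]
      gcongr
    have h := hK (hx _ (key r hr)) (hy _ (key s hs)) ha hb hab
    convert h using 1
    have : v = ((a * r + b * s) / c) • v := by rw [← hc, div_self h0.ne', one_smul]
    rw [smul_add, smul_add, smul_smul, smul_smul, add_add_add_comm, ← add_smul]
    congr 1
    conv_lhs => rw [this]
    congr 1
    ring

lemma openBallOf_decomp (hφ : IsNorm φ) {r s : ℝ} (hs : 0 < s) (hsr : s ≤ r) {v : Fin 2 → ℝ}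
    (hv : φ v < r) : ∃ p q, φ p < s ∧ φ q ≤ r - s ∧ q + p = v := by
  have hr : 0 < r := hs.trans_le hsr
  refine ⟨(s / r) • v, ((r - s) / r) • v, ?_, ?_, ?_⟩
  · rw [hφ.map_smul_nonneg (by positivity), div_mul_eq_mul_div, div_lt_iff₀ hr]
    exact mul_lt_mul_of_pos_left hv hs
  · have : 0 ≤ r - s := sub_nonneg.2 hsr
    rw [hφ.map_smul_nonneg (by positivity), div_mul_eq_mul_div, div_le_iff₀ hr]
    exact mul_le_mul_of_nonneg_left hv.le this
  · rw [← add_smul, ← add_div, sub_add_cancel, div_self hr.ne', one_smul]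

lemma innerBody_add_openBallOf_anti (hφ : IsNorm φ) (K : Set (Fin 2 → ℝ)) {r s : ℝ} (hs : 0 < s)
    (hsr : s ≤ r) :
    innerBody φ K r + openBallOf φ r ⊆ innerBody φ K s + openBallOf φ s := by
  rintro _ ⟨c, hc, v, hv, rfl⟩
  obtain ⟨p, q, hp, hq, rfl⟩ := openBallOf_decomp hφ hs hsr hv
  refine ⟨c + q, ?_, p, hp, by simp [add_assoc]⟩
  rw [mem_innerBody hφ (hs.le.trans hsr)] at hc
  rw [mem_innerBody hφ hs.le]
  intro w hw
  rw [add_assoc]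
  exact hc _ ((hφ.add_le _ _).trans (by linarith))

lemma volume_singleton_add (a : Fin 2 → ℝ) (A : Set (Fin 2 → ℝ)) :
    volume.real ({a} + A) = volume.real A := by
  rw [singleton_add, image_add_left, Measure.real, measure_preimage_add, Measure.real]

/-- The volume of the opening of `K` by the ball of radius `r`. -/
def openingVol (φ : (Fin 2 → ℝ) → ℝ) (K : Set (Fin 2 → ℝ)) (r : ℝ) : ℝ :=
  volume.real (innerBody φ K r + r • unitBall φ)

lemma openingVol_zero (hφ : IsNorm φ) (K : Set (Fin 2 → ℝ)) :
    openingVol φ K 0 = volume.real K := by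
  rw [openingVol, innerBody_zero hφ, zero_smul_set ⟨0, zero_mem_unitBall hφ⟩, add_zero]

lemma openingVol_combo (hφ : IsNorm φ) {K : Set (Fin 2 → ℝ)} (hK : IsCompact K)
    (hKc : Convex ℝ K) {r s a b : ℝ} (hr : 0 ≤ r) (hs : 0 ≤ s) (ha : 0 ≤ a) (hb : 0 ≤ b)
    (hab : a + b = 1) (hne : (innerBody φ K s).Nonempty) :
    a ^ 2 * openingVol φ K r ≤ openingVol φ K (a * r + b * s) := by
  obtain ⟨y, hy⟩ := hne
  rw [openingVol, openingVol, ← volume_smul_real, ← volume_singleton_add (b • y)]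
  refine measureReal_mono ?_ ((isCompact_innerBody hφ hK _).add
    (isCompact_smul_unitBall hφ _)).measure_lt_top.ne
  rintro _ ⟨_, rfl, _, ⟨_, ⟨c, hc, v, hv, rfl⟩, rfl⟩, rfl⟩
  rw [mem_smul_unitBall hφ hr] at hv
  refine ⟨a • c + b • y, innerBody_combo hφ hKc hr hs ha hb hab hc hy, a • v, ?_, ?_⟩
  · rw [mem_smul_unitBall hφ (by positivity), hφ.map_smul_nonneg ha]
    have : 0 ≤ b * s := by positivity
    nlinarith [mul_le_mul_of_nonneg_left hv ha]
  · simp only [smul_add]; abel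

lemma le_openingVol_of_tendsto (hφ : IsNorm φ) {K : Set (Fin 2 → ℝ)} (hK : IsCompact K)
    {r m : ℝ} (hr : 0 ≤ r) {s : ℕ → ℝ} (hs0 : ∀ n, 0 ≤ s n) (hsr : ∀ n, s n ≤ r)
    (hsm : Monotone s) (hs : Tendsto s atTop (𝓝 r)) (hm : ∀ n, m ≤ openingVol φ K (s n)) :
    m ≤ openingVol φ K r := by
  have hW : IsCompact (r • unitBall φ) := isCompact_smul_unitBall hφ r
  have hCc : ∀ n, IsCompact (innerBody φ K (s n) + r • unitBall φ) := fun n =>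
    (isCompact_innerBody hφ hK _).add hW
  have hanti : ∀ a b, a ≤ b → innerBody φ K (s b) ⊆ innerBody φ K (s a) := fun a b hab =>
    innerBody_anti hφ K (hs0 a) (hsm hab)
  have hinner : ⋂ n, innerBody φ K (s n) ⊆ innerBody φ K r := by
    intro c hc
    rw [mem_iInter] at hc
    rintro _ ⟨w, hw, rfl⟩
    refine hK.isClosed.mem_of_tendsto (f := fun n => c + s n • w) ?_
      (Eventually.of_forall fun n => hc n _ ⟨w, hw, rfl⟩) (b := atTop)
    exact (hs.smul_const w).const_add c
  have hsub : ⋂ n, (innerBody φ K (s n) + r • unitBall φ) ⊆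
      innerBody φ K r + r • unitBall φ := by
    intro x hx
    rw [mem_iInter] at hx
    have hne := IsCompact.nonempty_iInter_of_sequence_nonempty_isCompact_isClosed
      (fun n => innerBody φ K (s n) ∩ (fun c => x - c) ⁻¹' (r • unitBall φ))
      (fun n => inter_subset_inter_left _ (hanti _ _ n.le_succ))
      (fun n => by
        obtain ⟨c, hc, v, hv, hcv⟩ := hx n
        refine ⟨c, hc, ?_⟩
        simpa [← hcv] using hv)
      ((isCompact_innerBody hφ hK _).inter_right (hW.isClosed.preimage (by fun_prop)))
      (fun n => (isCompact_innerBody hφ hK _).isClosed.inter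
        (hW.isClosed.preimage (by fun_prop)))
    obtain ⟨c, hc⟩ := hne
    rw [mem_iInter] at hc
    exact ⟨c, hinner (mem_iInter.2 fun n => (hc n).1), x - c, (hc 0).2, by simp⟩
  have hlim : Tendsto (fun n => volume.real (innerBody φ K (s n) + r • unitBall φ)) atTop
      (𝓝 (volume.real (⋂ n, (innerBody φ K (s n) + r • unitBall φ)))) := by
    refine (ENNReal.tendsto_toReal ?_).comp (tendsto_measure_iInter_atTop
      (fun n => (hCc n).measurableSet.nullMeasurableSet)
      (fun a b hab => add_subset_add_right (hanti a b hab)) ⟨0, (hCc 0).measure_lt_top.ne⟩)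
    exact ((measure_mono (iInter_subset _ 0)).trans_lt (hCc 0).measure_lt_top).ne
  refine (ge_of_tendsto' hlim fun n => (hm n).trans ?_).trans
    (measureReal_mono hsub ((isCompact_innerBody hφ hK r).add hW).measure_lt_top.ne)
  refine measureReal_mono (add_subset_add_left fun v hv => ?_) (hCc n).measure_lt_top.ne
  rw [mem_smul_unitBall hφ (hs0 n)] at hv
  exact (mem_smul_unitBall hφ hr).2 (hv.trans (hsr n))

lemma exists_openingVol_eq (hφ : IsNorm φ) {K : Set (Fin 2 → ℝ)} (hK : IsCompact K)
    (hKc : Convex ℝ K) {R m : ℝ} (hR : 0 ≤ R) (hne : (innerBody φ K R).Nonempty)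
    (hm1 : openingVol φ K R < m) (hm2 : m < volume.real K) :
    ∃ r, 0 < r ∧ r ≤ R ∧ openingVol φ K r = m := by
  set S := {s ∈ Icc 0 R | m ≤ openingVol φ K s} with hS
  have h0S : (0 : ℝ) ∈ S := ⟨⟨le_rfl, hR⟩, by rw [openingVol_zero hφ]; exact hm2.le⟩
  have hbdd : BddAbove S := ⟨R, fun s hs => hs.1.2⟩
  obtain ⟨s, hsm, hs, hsS⟩ := exists_seq_tendsto_sSup ⟨0, h0S⟩ hbdd
  set r := sSup S with hr
  have hr0 : 0 ≤ r := le_csSup hbdd h0S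
  have hrR : r ≤ R := csSup_le ⟨0, h0S⟩ fun s hs => hs.1.2
  have hrm : m ≤ openingVol φ K r := le_openingVol_of_tendsto hφ hK hr0 (fun n => (hsS n).1.1)
    (fun n => le_csSup hbdd (hsS n)) hsm hs fun n => (hsS n).2
  have hrR' : r < R := lt_of_le_of_ne hrR fun h => by rw [h] at hrm; linarith
  have hrm' : openingVol φ K r ≤ m := by
    have hlim : Tendsto (fun a : ℝ => a ^ 2 * openingVol φ K r) (𝓝[<] 1)
        (𝓝 (1 ^ 2 * openingVol φ K r)) := by
      refine (Continuous.tendsto ?_ 1).mono_left nhdsWithin_le_nhds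
      fun_prop
    rw [one_pow, one_mul] at hlim
    refine le_of_tendsto hlim ?_
    filter_upwards [Ioo_mem_nhdsLT (zero_lt_one (α := ℝ))] with a ha
    refine (openingVol_combo hφ hK hKc hr0 hR ha.1.le (sub_nonneg.2 ha.2.le) (by ring)
      hne).trans ?_
    by_contra! h
    have h1 : 0 < (1 - a) * (R - r) := mul_pos (sub_pos.2 ha.2) (sub_pos.2 hrR')
    have h2 : 0 < a * (R - r) := mul_pos ha.1 (sub_pos.2 hrR')
    have := le_csSup hbdd (a := a * r + (1 - a) * R) ⟨⟨by nlinarith, by nlinarith⟩, h.le⟩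
    rw [← hr] at this
    nlinarith
  refine ⟨r, hr0.lt_of_ne fun h => ?_, hrR, le_antisymm hrm' hrm⟩
  rw [← h, openingVol_zero hφ] at hrm'
  linarith

end InnerParallelSets

section NestedMinimizers

open scoped Pointwise Topology

variable {φ : (Fin 2 → ℝ) → ℝ}

/-- The candidate minimizers in a convex body `K` with anisotropic inradius `R` and incentre `x₀`:
Wulff balls around `x₀`, neighbourhoods of shrunken copies of the innermost parallel body, and
openings of `K`. -/
def isopFamily (φ : (Fin 2 → ℝ) → ℝ) (K : Set (Fin 2 → ℝ)) (x₀ : Fin 2 → ℝ) (R : ℝ) :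
    Set (Set (Fin 2 → ℝ)) :=
  {E | ∃ r, 0 < r ∧ r ≤ R ∧ E = {x₀} + openBallOf φ r} ∪
    ({E | ∃ a : ℝ, 0 < a ∧ a ≤ 1 ∧
        E = ({(1 - a) • x₀} + a • innerBody φ K R) + openBallOf φ R} ∪
      {E | ∃ r, 0 < r ∧ r ≤ R ∧ E = innerBody φ K r + openBallOf φ r})

lemma openBallOf_mono (φ : (Fin 2 → ℝ) → ℝ) {r s : ℝ} (h : r ≤ s) :
    openBallOf φ r ⊆ openBallOf φ s := fun _ hx => lt_of_lt_of_le hx h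

lemma segment_copy_mono {C : Set (Fin 2 → ℝ)} (hC : Convex ℝ C) {x₀ : Fin 2 → ℝ} (hx : x₀ ∈ C)
    {a c : ℝ} (ha : 0 ≤ a) (hac : a ≤ c) :
    ({(1 - a) • x₀} + a • C : Set (Fin 2 → ℝ)) ⊆ {(1 - c) • x₀} + c • C := by
  rcases (ha.trans hac).eq_or_lt with h | hc
  · have : a = c := le_antisymm hac (h ▸ ha)
    rw [this]
  rintro _ ⟨_, rfl, _, ⟨y, hy, rfl⟩, rfl⟩
  refine ⟨_, rfl, c • ((1 - a / c) • x₀ + (a / c) • y), ⟨_, ?_, rfl⟩, ?_⟩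
  · exact hC hx hy (sub_nonneg.2 ((div_le_one hc).2 hac)) (by positivity) (by ring)
  · ext i
    simp
    field_simp
    ring

lemma mem_segment_copy {C : Set (Fin 2 → ℝ)} {x₀ : Fin 2 → ℝ} (hx : x₀ ∈ C) (a : ℝ) :
    x₀ ∈ ({(1 - a) • x₀} + a • C : Set (Fin 2 → ℝ)) :=
  ⟨_, rfl, a • x₀, ⟨x₀, hx, rfl⟩, by ext i; simp; ring⟩

lemma segment_copy_subset {C : Set (Fin 2 → ℝ)} (hC : Convex ℝ C) {x₀ : Fin 2 → ℝ} (hx : x₀ ∈ C)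
    {a : ℝ} (ha : 0 ≤ a) (ha1 : a ≤ 1) :
    ({(1 - a) • x₀} + a • C : Set (Fin 2 → ℝ)) ⊆ C := by
  rintro _ ⟨_, rfl, _, ⟨y, hy, rfl⟩, rfl⟩
  exact hC hx hy (sub_nonneg.2 ha1) ha (by ring)

lemma isChain_isopFamily (hφ : IsNorm φ) {K : Set (Fin 2 → ℝ)} (hKc : Convex ℝ K)
    {x₀ : Fin 2 → ℝ} {R : ℝ} (hx : x₀ ∈ innerBody φ K R) :
    IsChain (· ⊆ ·) (isopFamily φ K x₀ R) := by
  have hC := convex_innerBody (φ := φ) hKc R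
  have h12 : ∀ r a : ℝ, r ≤ R → {x₀} + openBallOf φ r ⊆
      ({(1 - a) • x₀} + a • innerBody φ K R) + openBallOf φ R := fun r a hr =>
    add_subset_add (singleton_subset_iff.2 (mem_segment_copy hx a)) (openBallOf_mono φ hr)
  have h23 : ∀ a r : ℝ, 0 < a → a ≤ 1 → 0 < r → r ≤ R →
      ({(1 - a) • x₀} + a • innerBody φ K R) + openBallOf φ R ⊆
        innerBody φ K r + openBallOf φ r := fun a r ha ha1 hr hrR =>
    (add_subset_add_right (segment_copy_subset hC hx ha.le ha1)).trans
      (innerBody_add_openBallOf_anti hφ K hr hrR)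
  have h13 : ∀ s r : ℝ, s ≤ R → 0 < r → r ≤ R →
      {x₀} + openBallOf φ s ⊆ innerBody φ K r + openBallOf φ r := fun s r hs hr hrR =>
    (h12 s 1 hs).trans (h23 1 r one_pos le_rfl hr hrR)
  rintro E (⟨r, hr, hrR, rfl⟩ | ⟨a, ha, ha1, rfl⟩ | ⟨r, hr, hrR, rfl⟩) F
    (⟨s, hs, hsR, rfl⟩ | ⟨c, hc, hc1, rfl⟩ | ⟨s, hs, hsR, rfl⟩) -
  · exact (le_total r s).imp (fun h => add_subset_add_left (openBallOf_mono φ h))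
      fun h => add_subset_add_left (openBallOf_mono φ h)
  · exact .inl (h12 r c hrR)
  · exact .inl (h13 r s hrR hs hsR)
  · exact .inr (h12 s a hsR)
  · exact (le_total a c).imp (fun h => add_subset_add_right (segment_copy_mono hC hx ha.le h))
      fun h => add_subset_add_right (segment_copy_mono hC hx hc.le h)
  · exact .inl (h23 a s ha ha1 hs hsR)
  · exact .inr (h13 s r hsR hr hrR)
  · exact .inr (h23 c r hc hc1 hr hrR)
  · exact (le_total r s).symm.imp (fun h => innerBody_add_openBallOf_anti hφ K hs h)
      fun h => innerBody_add_openBallOf_anti hφ K hr h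

lemma innerBody_add_openBallOf_subset (hφ : IsNorm φ) (K : Set (Fin 2 → ℝ)) {r : ℝ}
    (hr : 0 ≤ r) : innerBody φ K r + openBallOf φ r ⊆ interior K := by
  refine interior_maximal ?_ (IsOpen.add_left (isOpen_openBallOf hφ r))
  rintro _ ⟨x, hx, v, hv, rfl⟩
  exact (mem_innerBody hφ hr).1 hx v (le_of_lt hv)

/-- A neighbourhood `C + {φ < r}` whose perimeter bound is attained by no competitor is a
minimizer. -/
lemma isIsopMinimizer_add_openBallOf (hφ : IsNorm φ) {Ω C : Set (Fin 2 → ℝ)} (hC : IsCompact C)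
    {b r m : ℝ} (hr : 0 < r) (hb : ∀ s : ℝ, 0 ≤ s → volume.real (C + s • unitBall φ) =
      volume.real C + b * s + volume.real (unitBall φ) * s ^ 2)
    (hsub : C + openBallOf φ r ⊆ Ω)
    (hm : volume.real C + b * r + volume.real (unitBall φ) * r ^ 2 = m)
    (hmin : ∀ F, MeasurableSet F → F ⊆ Ω → volume.real F = m → anisoPerimeter φ F ≠ ∞ →
      b + 2 * r * volume.real (unitBall φ) ≤ (anisoPerimeter φ F).toReal) :
    IsIsopMinimizer φ Ω m (C + openBallOf φ r) := by
  refine ⟨(IsOpen.add_left (isOpen_openBallOf hφ r)).measurableSet, hsub,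
    (volume_add_openBallOf hφ hC hr hb).trans hm, fun F hF hFΩ hFm => ?_⟩
  by_cases hP : anisoPerimeter φ F = ∞
  · rw [hP]; exact le_top
  · exact (anisoPerimeter_add_openBallOf_le hφ hC hr hb).trans
      (ENNReal.ofReal_le_of_le_toReal (hmin F hF hFΩ hFm hP))

lemma volume_segment_copy_add (C W : Set (Fin 2 → ℝ)) (x : Fin 2 → ℝ) {a : ℝ} (ha : 0 < a) (s : ℝ) :
    volume.real (({x} + a • C) + s • W) = a ^ 2 * volume.real (C + (s / a) • W) := by
  rw [add_assoc, volume_singleton_add, ← volume_smul_real, smul_add, smul_smul,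
    mul_div_cancel₀ _ ha.ne']

lemma volume_closure_of_convex {Ω : Set (Fin 2 → ℝ)} (hΩc : Convex ℝ Ω) :
    volume.real (closure Ω) = volume.real Ω := by
  refine congrArg ENNReal.toReal (le_antisymm ?_ (measure_mono subset_closure))
  rw [closure_eq_self_union_frontier]
  exact (measure_union_le _ _).trans (by rw [hΩc.addHaar_frontier volume, add_zero])

lemma exists_isIsopMinimizer_mem_isopFamily (hφ : IsNorm φ) {Ω : Set (Fin 2 → ℝ)}
    (hΩo : IsOpen Ω) (hΩb : Bornology.IsBounded Ω) (hΩc : Convex ℝ Ω) {x₀ : Fin 2 → ℝ} {R : ℝ}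
    (hR : 0 < R) (hx : x₀ ∈ innerBody φ (closure Ω) R)
    (hR0 : volume.real (innerBody φ (closure Ω) R) = 0) {m : ℝ} (hm0 : 0 < m)
    (hm : m < volume.real Ω) :
    ∃ E ∈ isopFamily φ (closure Ω) x₀ R, IsIsopMinimizer φ Ω m E := by
  set K := closure Ω with hKdef
  set w := volume.real (unitBall φ) with hw
  have hw0 : 0 < w := volume_unitBall_pos hφ
  have hK : IsCompact K := hΩb.isCompact_closure
  have hKc : Convex ℝ K := hΩc.closure
  have hΩn : Ω.Nonempty := by
    rw [nonempty_iff_ne_empty]; rintro rfl; simp at hm; linarith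
  have hint : interior K = Ω := by
    rw [hKdef, hΩc.interior_closure_eq_interior_of_nonempty_interior
      (by rwa [hΩo.interior_eq]), hΩo.interior_eq]
  have hC := convex_innerBody (φ := φ) hKc R
  have hCcpt := isCompact_innerBody hφ hK R
  have hsub3 : ∀ r, 0 < r → innerBody φ K r + openBallOf φ r ⊆ Ω := fun r hr =>
    (innerBody_add_openBallOf_subset hφ K hr.le).trans hint.le
  have hsub1 : ∀ r, 0 < r → r ≤ R → {x₀} + openBallOf φ r ⊆ Ω := fun r hr hrR =>
    (add_subset_add (singleton_subset_iff.2 hx) (openBallOf_mono φ hrR)).trans (hsub3 R hR)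
  obtain ⟨b, hb⟩ := exists_steiner hφ hCcpt hC ⟨x₀, hx⟩
  have hopen : openingVol φ K R = b * R + w * R ^ 2 := by
    rw [openingVol, hb R hR.le, hR0, zero_add]
  rcases le_or_gt m (R ^ 2 * w) with h1 | h1
  · have hρ : 0 < √(m / w) := Real.sqrt_pos.2 (by positivity)
    have hρR : √(m / w) ≤ R := Real.sqrt_le_iff.2 ⟨hR.le, (div_le_iff₀ hw0).2 h1⟩
    have hρ2 : √(m / w) ^ 2 = m / w := Real.sq_sqrt (by positivity)
    refine ⟨_, .inl ⟨_, hρ, hρR, rfl⟩, isIsopMinimizer_add_openBallOf hφ isCompact_singleton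
      (b := 0) hρ (fun s hs => ?_) (hsub1 _ hρ hρR) ?_ fun F hF hFΩ hFm hP => ?_⟩
    · rw [volume_singleton_add, volume_smul_real]
      simp [Measure.real]
      ring
    · rw [hρ2, ← hw, mul_div_cancel₀ _ hw0.ne']
      simp [Measure.real]
    · refine le_trans (le_of_eq ?_) (isoperimetric hφ hΩb hΩc hF hFΩ hP)
      rw [hFm, ← hw, Real.sqrt_div hm0.le]
      have := Real.sq_sqrt hw0.le
      have h' := Real.sqrt_pos.2 hw0
      field_simp
      rw [this]
      ring
  rcases le_or_gt m (openingVol φ K R) with h2 | h2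
  · have hbR : 0 < b * R := by rw [hopen] at h2; linarith
    set a := (m - R ^ 2 * w) / (b * R) with ha
    have ha0 : 0 < a := div_pos (sub_pos.2 h1) hbR
    have ha1 : a ≤ 1 := (div_le_one hbR).2 (by linarith)
    have hab : a * (b * R) = m - R ^ 2 * w := div_mul_cancel₀ _ hbR.ne'
    have hvol : volume.real ({(1 - a) • x₀} + a • innerBody φ K R : Set (Fin 2 → ℝ)) = 0 := by
      rw [volume_singleton_add, volume_smul_real, hR0, mul_zero]
    refine ⟨_, .inr (.inl ⟨a, ha0, ha1, rfl⟩), isIsopMinimizer_add_openBallOf hφ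
      (isCompact_singleton.add (hCcpt.smul a)) (b := a * b) hR (fun s hs => ?_)
      ((add_subset_add_right (segment_copy_subset hC hx ha0.le ha1)).trans (hsub3 R hR)) ?_
      fun F hF hFΩ hFm hP => ?_⟩
    · rw [volume_segment_copy_add _ _ _ ha0, hb _ (by positivity), hR0, hvol]
      field_simp
      ring
    · rw [hvol, ← hw]; linarith
    · have := bonnesen hφ hΩb hΩc hF hFΩ hP hR.le
      rw [hFm, ← hw, min_eq_left h1.le] at this
      change _ ≤ volume.real (innerBody φ K R) + _ at this
      rw [hR0, zero_add] at this
      rw [← hw]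
      refine le_of_mul_le_mul_left ?_ hR
      linarith
  · obtain ⟨r, hr, hrR, hrm⟩ := exists_openingVol_eq hφ hK hKc hR.le ⟨x₀, hx⟩ h2
      (by rwa [hKdef, volume_closure_of_convex hΩc])
    have hxr : x₀ ∈ innerBody φ K r := innerBody_anti hφ K hr.le hrR hx
    obtain ⟨c, hc⟩ := exists_steiner hφ (isCompact_innerBody hφ hK r) (convex_innerBody hKc r)
      ⟨x₀, hxr⟩
    rw [openingVol, hc r hr.le] at hrm
    refine ⟨_, .inr (.inr ⟨r, hr, hrR, rfl⟩), isIsopMinimizer_add_openBallOf hφ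
      (isCompact_innerBody hφ hK r) hr hc (hsub3 r hr) hrm fun F hF hFΩ hFm hP => ?_⟩
    have := bonnesen hφ hΩb hΩc hF hFΩ hP hr.le
    have hle : r ^ 2 * w ≤ m :=
      (mul_le_mul_of_nonneg_right (pow_le_pow_left₀ hr.le hrR 2) hw0.le).trans h1.le
    rw [hFm, ← hw, min_eq_left hle] at this
    change _ ≤ volume.real (innerBody φ K r) + _ at this
    rw [← hw] at hrm ⊢
    refine le_of_mul_le_mul_left ?_ hr
    linarith

lemma exists_inradius (hφ : IsNorm φ) {Ω : Set (Fin 2 → ℝ)} (hΩb : Bornology.IsBounded Ω)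
    (hΩc : Convex ℝ Ω) (hΩ : 0 < volume.real Ω) :
    ∃ R : ℝ, 0 < R ∧ (innerBody φ (closure Ω) R).Nonempty ∧
      volume.real (innerBody φ (closure Ω) R) = 0 := by
  have hΩn : Ω.Nonempty := by
    rw [nonempty_iff_ne_empty]; rintro rfl; simp at hΩ
  obtain ⟨R, hR, hn, h0, -⟩ := exists_max_erosion hΩb.isCompact_closure hΩc.closure hΩn.closure
    (isCompact_unitBall hφ) (convex_unitBall hφ) (zero_mem_unitBall hφ) (volume_unitBall_pos hφ)
  refine ⟨R, hR.lt_of_ne fun h => ?_, hn, h0⟩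
  change volume.real (innerBody φ (closure Ω) R) = 0 at h0
  rw [← h, innerBody_zero hφ, volume_closure_of_convex hΩc] at h0
  exact hΩ.ne' h0

/-- In a bounded convex open set `Ω ⊆ ℝ²`, minimizers of the
isoperimetric problem (10) for a decreasing sequence of volumes `m_j ∈ (0, |Ω|)`
can be arranged as a decreasing (by inclusion) sequence of sets. -/
theorem nested_isop_minimizers (φ : (Fin 2 → ℝ) → ℝ) (hφ : IsNorm φ)
    (Ω : Set (Fin 2 → ℝ)) (hΩopen : IsOpen Ω) (hΩbdd : Bornology.IsBounded Ω)
    (hΩconv : Convex ℝ Ω) (m : ℕ → ℝ) (hmono : Antitone m)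
    (hm : ∀ j, m j ∈ Ioo 0 (volume Ω).toReal) :
    ∃ E : ℕ → Set (Fin 2 → ℝ), ∀ j,
      E (j + 1) ⊆ E j ∧ E j ⊆ Ω ∧ IsIsopMinimizer φ Ω (m j) (E j) := by
  obtain ⟨R, hR, ⟨x₀, hx⟩, hR0⟩ := exists_inradius hφ hΩbdd hΩconv ((hm 0).1.trans (hm 0).2)
  have hex : ∀ t : Ioo 0 (volume Ω).toReal, ∃ E ∈ isopFamily φ (closure Ω) x₀ R,
      IsIsopMinimizer φ Ω t E := fun t =>
    exists_isIsopMinimizer_mem_isopFamily hφ hΩopen hΩbdd hΩconv hR hx hR0 t.2.1 t.2.2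
  choose E hE hmin using hex
  refine ⟨fun j => E ⟨m j, hm j⟩, fun j => ⟨?_, (hmin _).2.1, hmin _⟩⟩
  rcases (hmono j.le_succ).eq_or_lt with h | h
  · simp only [Nat.succ_eq_add_one] at h
    simp only [h]
    exact le_rfl
  · refine ((isChain_isopFamily hφ hΩconv.closure hx).total (hE ⟨_, hm (j + 1)⟩)
      (hE ⟨_, hm j⟩)).resolve_right fun hsub => ?_
    have hfin : volume (E ⟨_, hm (j + 1)⟩) ≠ ∞ :=
      ((measure_mono (hmin _).2.1).trans_lt hΩbdd.measure_lt_top).ne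
    have := ENNReal.toReal_mono hfin (measure_mono hsub)
    rw [(hmin _).2.2.1, (hmin _).2.2.1] at this
    exact h.not_ge this

end NestedMinimizers

end
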